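/- Let d ≥ 1, T ∈ (0,∞], and let u : [0,T) × ℝ^d → ℝ be a real-valued bounded classical solution of the focusing equation ∂_t u = Δu − ζ(u) with bounded continuous real-valued initial datum g, such that u(t,x) < 1 for all (t,x). Set I = inf_x g(x) and S = sup_x g(x) and assume S < −2. Let k1 be the smallest positive integer with −2k1 ≤ I and let −2k2 be the smallest number of the form −2k (k a positive integer) with −2k ≥ S. Then −2k1 ≤ u(t,x) ≤ −2k2 for all (t,x) ∈ [0,T) × ℝ^d. Moreover, if T = ∞ and n1, n2 are positive integers with I ∈ (−4n1 − 2, −4n1 + 2) and S ∈ (−4n2 − 2, −4n2 + 2), then for every x ∈ ℝ^d: −4n1 ≤ liminf_{t→∞} u(t,x) ≤ limsup_{t→∞} u(t,x) ≤ −4n2. -/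

import Mathlib

open MeasureTheory
open scoped ENNReal

noncomputable section

/-- A bounded classical solution of `∂ₜ u = Δu + F(u)` (real-valued) on `[0,T)`. -/
def IsHeatSolutionR (d : ℕ) (F : ℝ → ℝ) (T : ℝ≥0∞)
    (g : EuclideanSpace ℝ (Fin d) → ℝ) (u : ℝ → EuclideanSpace ℝ (Fin d) → ℝ) : Prop :=
  ContinuousOn (fun p : ℝ × EuclideanSpace ℝ (Fin d) => u p.1 p.2)
      {p | 0 ≤ p.1 ∧ ENNReal.ofReal p.1 < T} ∧
  (∀ x, u 0 x = g x) ∧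
  (∀ t' : ℝ, ENNReal.ofReal t' < T → ∃ C : ℝ, ∀ t x, 0 ≤ t → t ≤ t' → |u t x| ≤ C) ∧
  ∃ (ut : ℝ → EuclideanSpace ℝ (Fin d) → ℝ)
    (ux uxx : ℝ → EuclideanSpace ℝ (Fin d) → Fin d → ℝ),
    (∀ t x, 0 < t → ENNReal.ofReal t < T → HasDerivAt (fun τ => u τ x) (ut t x) t) ∧
    (∀ t x i, 0 < t → ENNReal.ofReal t < T →
      HasDerivAt (fun s : ℝ => u t (x + s • EuclideanSpace.single i (1:ℝ))) (ux t x i) 0) ∧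
    (∀ t x i, 0 < t → ENNReal.ofReal t < T →
      HasDerivAt (fun s : ℝ => ux t (x + s • EuclideanSpace.single i (1:ℝ)) i) (uxx t x i) 0) ∧
    ContinuousOn (fun p : ℝ × EuclideanSpace ℝ (Fin d) => ut p.1 p.2)
      {p | 0 < p.1 ∧ ENNReal.ofReal p.1 < T} ∧
    (∀ i, ContinuousOn (fun p : ℝ × EuclideanSpace ℝ (Fin d) => uxx p.1 p.2 i)
      {p | 0 < p.1 ∧ ENNReal.ofReal p.1 < T}) ∧
    (∀ t x, 0 < t → ENNReal.ofReal t < T → ut t x = (∑ i, uxx t x i) + F (u t x))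

/-- The real value `ζ(x) = Re (riemannZeta x)` of the Riemann zeta function at a real point. -/
def zetaR (x : ℝ) : ℝ := (riemannZeta (x : ℂ)).re

/-- basis vector -/
abbrev eb {d : ℕ} (i : Fin d) : EuclideanSpace ℝ (Fin d) := EuclideanSpace.single i (1:ℝ)

lemma intg_of_vanish {d : ℕ} {h : EuclideanSpace ℝ (Fin d) → ℝ} {r : ℝ} (hc : Continuous h)
    (hz : ∀ x, r < ‖x‖ → h x = 0) : Integrable h := by
  apply hc.integrable_of_hasCompactSupport
  apply HasCompactSupport.of_support_subset_isCompact (isCompact_closedBall (0:EuclideanSpace ℝ (Fin d)) r)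
  intro x hx
  by_contra hx'
  exact hx (hz x (by simpa using hx'))

lemma ibp_test {d : ℕ} (i : Fin d) {r : ℝ} {f f' p p' : EuclideanSpace ℝ (Fin d) → ℝ}
    (cf : Continuous f) (cf' : Continuous f') (cp : Continuous p) (cp' : Continuous p')
    (hf : ∀ x, HasDerivAt (fun s : ℝ => f (x + s • eb i)) (f' x) 0)
    (hp : ∀ x, HasDerivAt (fun s : ℝ => p (x + s • eb i)) (p' x) 0)
    (hz : ∀ x, r < ‖x‖ → p x = 0) (hz' : ∀ x, r < ‖x‖ → p' x = 0) :
    ∫ x, p x * f' x = - ∫ x, p' x * f x := by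
  have := integral_bilinear_hasLineDerivAt_right_eq_neg_left_of_integrable (μ := (volume : Measure (EuclideanSpace ℝ (Fin d))))
    (f := p) (f' := p') (g := f) (g' := f') (v := eb i) (B := ContinuousLinearMap.mul ℝ ℝ) ?_ ?_ ?_ ?_ ?_
  · simpa using this
  · exact intg_of_vanish (r := r) (by simp; fun_prop) (fun x hx => by simp [hz' x hx])
  · exact intg_of_vanish (r := r) (by simp; fun_prop) (fun x hx => by simp [hz x hx])
  · exact intg_of_vanish (r := r) (by simp; fun_prop) (fun x hx => by simp [hz x hx])
  · intro x _; exact hp x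
  · intro x _; exact hf x

lemma cont_int_test {d : ℕ} {s : Set ℝ} {r : ℝ} {h : ℝ → EuclideanSpace ℝ (Fin d) → ℝ}
    (hc : ContinuousOn (fun p : ℝ × EuclideanSpace ℝ (Fin d) => h p.1 p.2) (s ×ˢ Set.univ))
    (hz : ∀ t ∈ s, ∀ x, r < ‖x‖ → h t x = 0) : ContinuousOn (fun t => ∫ x, h t x) s := by
  apply continuousOn_integral_of_compact_support (isCompact_closedBall (0:EuclideanSpace ℝ (Fin d)) r) hc
  intro t x ht hx
  exact hz t ht x (by simpa using hx)

lemma deriv_int_test {d : ℕ} {τ r : ℝ} {h ht : ℝ → EuclideanSpace ℝ (Fin d) → ℝ}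
    (hd : ∀ t ∈ Set.Ioo 0 τ, ∀ x, HasDerivAt (fun s => h s x) (ht t x) t)
    (hc : ContinuousOn (fun p : ℝ × EuclideanSpace ℝ (Fin d) => h p.1 p.2) (Set.Ioo 0 τ ×ˢ Set.univ))
    (hct : ContinuousOn (fun p : ℝ × EuclideanSpace ℝ (Fin d) => ht p.1 p.2) (Set.Ioo 0 τ ×ˢ Set.univ))
    (hz : ∀ t ∈ Set.Ioo 0 τ, ∀ x, r < ‖x‖ → h t x = 0)
    (hzt : ∀ t ∈ Set.Ioo 0 τ, ∀ x, r < ‖x‖ → ht t x = 0) {t : ℝ} (htt : t ∈ Set.Ioo 0 τ) :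
    HasDerivAt (fun t => ∫ x, h t x) (∫ x, ht t x) t := by
  have slice : ∀ {k : ℝ → EuclideanSpace ℝ (Fin d) → ℝ},
      ContinuousOn (fun p : ℝ × EuclideanSpace ℝ (Fin d) => k p.1 p.2) (Set.Ioo 0 τ ×ˢ Set.univ) →
      ∀ t ∈ Set.Ioo 0 τ, Continuous (k t) := by
    intro k hk t ht
    rw [← continuousOn_univ]
    exact hk.comp (f := fun x => (t, x)) (by fun_prop) (fun x _ => ⟨ht, trivial⟩)
  obtain ⟨ε, hε, hsub⟩ := Metric.nhds_basis_closedBall.mem_iff.1 (Ioo_mem_nhds htt.1 htt.2)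
  have hK : IsCompact (Metric.closedBall t ε ×ˢ Metric.closedBall (0:EuclideanSpace ℝ (Fin d)) r) :=
    (isCompact_closedBall _ _).prod (isCompact_closedBall _ _)
  obtain ⟨C, hC⟩ := hK.exists_bound_of_continuousOn
    (hct.mono (Set.prod_mono hsub (Set.subset_univ _)))
  have hbd : Integrable (Set.indicator (Metric.closedBall (0:EuclideanSpace ℝ (Fin d)) r) (fun _ => C)) := by
    rw [integrable_indicator_iff measurableSet_closedBall]
    exact continuous_const.continuousOn.integrableOn_compact (isCompact_closedBall 0 r)
  refine (hasDerivAt_integral_of_dominated_loc_of_deriv_le (s := Metric.closedBall t ε) (bound := Set.indicator (Metric.closedBall (0:EuclideanSpace ℝ (Fin d)) r) (fun _ => C)) (F := h) (F' := ht) (x₀ := t)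
    (Metric.closedBall_mem_nhds _ hε) ?_ ?_ ?_ ?_ hbd ?_).2
  · filter_upwards [Ioo_mem_nhds htt.1 htt.2] with s hs
    exact (slice hc s hs).aestronglyMeasurable
  · exact intg_of_vanish (slice hc t htt) (hz t htt)
  · exact (slice hct t htt).aestronglyMeasurable
  · refine Filter.Eventually.of_forall fun x s hs => ?_
    by_cases hx : x ∈ Metric.closedBall (0:EuclideanSpace ℝ (Fin d)) r
    · simpa [hx] using hC (s, x) ⟨hs, hx⟩
    · rw [hzt s (hsub hs) x (by simpa using hx)]; simp [hx]
  · exact Filter.Eventually.of_forall fun x s hs => hd s (hsub hs) x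

lemma second_deriv_nonneg_of_min {a a' : ℝ → ℝ} {b : ℝ} (h1 : ∀ s, HasDerivAt a (a' s) s)
    (h2 : HasDerivAt a' b 0) (hmin : ∀ s, a 0 ≤ a s) : 0 ≤ b := by
  by_contra hb
  push Not at hb
  have h0 : a' 0 = 0 := by
    have : IsLocalMin a 0 := Filter.Eventually.of_forall hmin
    exact this.hasDerivAt_eq_zero (h1 0)
  have hev : ∀ᶠ s in nhdsWithin 0 (Set.Ioi 0), a' s < 0 := by
    have := (hasDerivAt_iff_tendsto_slope.1 h2).mono_left
      (nhdsWithin_mono 0 (fun x (hx : 0 < x) => ne_of_gt hx))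
    filter_upwards [this.eventually_lt_const hb, self_mem_nhdsWithin] with s hs hs0
    rw [slope_def_field, h0] at hs
    have hs0 : 0 < s := hs0
    rw [sub_zero, sub_zero, div_lt_iff₀ hs0] at hs
    linarith
  obtain ⟨δ, hδ, hsub⟩ := mem_nhdsGT_iff_exists_Ioo_subset.1 hev
  have hδ : 0 < δ := hδ
  obtain ⟨c, hc, hce⟩ := exists_hasDerivAt_eq_slope a a' (half_pos hδ)
    (fun x _ => (h1 x).continuousAt.continuousWithinAt) (fun x _ => h1 x)
  have hc0 : a' c < 0 := hsub ⟨hc.1, hc.2.trans (half_lt_self hδ)⟩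
  rw [hce, div_lt_iff₀ (by linarith [half_pos hδ])] at hc0
  linarith [hmin (δ/2)]

lemma norm_sq_line {d : ℕ} (x : EuclideanSpace ℝ (Fin d)) (i : Fin d) (s : ℝ) :
    ‖x + s • eb i‖ ^ 2 = ‖x‖ ^ 2 + 2 * s * x i + s ^ 2 := by
  rw [norm_add_sq_real, inner_smul_right, norm_smul, EuclideanSpace.inner_single_right]
  simp
  ring

lemma line_shift {d : ℕ} {f f' : EuclideanSpace ℝ (Fin d) → ℝ} {v : EuclideanSpace ℝ (Fin d)}
    (hf : ∀ x, HasDerivAt (fun s : ℝ => f (x + s • v)) (f' x) 0) (x : EuclideanSpace ℝ (Fin d)) (s : ℝ) :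
    HasDerivAt (fun s : ℝ => f (x + s • v)) (f' (x + s • v)) s := by
  have h := hf (x + s • v)
  have h2 : HasDerivAt (fun r : ℝ => r - s) 1 s := (hasDerivAt_id s).sub_const s
  have h3 := HasDerivAt.comp s (h₂ := fun r : ℝ => f (x + s • v + r • v)) (by simpa using h) h2
  simp only [mul_one] at h3
  have e : ((fun r : ℝ => f (x + s • v + r • v)) ∘ fun r => r - s) = fun s : ℝ => f (x + s • v) := by
    funext r
    show f _ = f _
    congr 1
    rw [sub_smul]; abel
  rwa [e] at h3

lemma cmp_principle {d : ℕ} {τ Λ : ℝ} {k kt : ℝ → EuclideanSpace ℝ (Fin d) → ℝ}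
    {kx kxx : ℝ → EuclideanSpace ℝ (Fin d) → Fin d → ℝ}
    (hc : ContinuousOn (fun p : ℝ × EuclideanSpace ℝ (Fin d) => k p.1 p.2) (Set.Ico 0 τ ×ˢ Set.univ))
    (hb : ∀ t1 < τ, ∃ C, ∀ t ∈ Set.Icc 0 t1, ∀ x, -C ≤ k t x)
    (h0 : ∀ x, 0 ≤ k 0 x)
    (hdt : ∀ t ∈ Set.Ioo 0 τ, ∀ x, HasDerivAt (fun r => k r x) (kt t x) t)
    (hdx : ∀ t ∈ Set.Ioo 0 τ, ∀ x i, HasDerivAt (fun s : ℝ => k t (x + s • eb i)) (kx t x i) 0)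
    (hdxx : ∀ t ∈ Set.Ioo 0 τ, ∀ x i, HasDerivAt (fun s : ℝ => kx t (x + s • eb i) i) (kxx t x i) 0)
    (hi : ∀ t ∈ Set.Ioo 0 τ, ∀ x, k t x < 0 → (∑ i, kxx t x i) + Λ * k t x ≤ kt t x) :
    ∀ t ∈ Set.Ico 0 τ, ∀ x, 0 ≤ k t x := by
  intro T hT X
  by_contra hneg
  push Not at hneg
  obtain ⟨C0, hC0⟩ := hb T hT.2
  set C := max C0 0 with hCdef
  have hC : ∀ t ∈ Set.Icc 0 T, ∀ x, -C ≤ k t x := fun t ht x => by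
    have := hC0 t ht x; have := le_max_left C0 0; linarith
  have hCnn : 0 ≤ C := le_max_right _ _
  -- choose ε
  set A := 1 + ‖X‖ ^ 2 + (2 * d + 1) * T with hA
  have hApos : 0 < A := by have := hT.1; positivity
  obtain ⟨ε, hε, hεA⟩ : ∃ ε > 0, Real.exp (-Λ * T) * k T X + ε * A < 0 := by
    have hn : 0 < -(Real.exp (-Λ * T) * k T X) := by
      have := mul_pos (Real.exp_pos (-Λ * T)) (neg_pos.2 hneg); linarith
    refine ⟨-(Real.exp (-Λ * T) * k T X) / (2 * A), by positivity, ?_⟩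
    have : -(Real.exp (-Λ * T) * k T X) / (2 * A) * A = -(Real.exp (-Λ * T) * k T X) / 2 := by
      field_simp
    linarith
  let h : ℝ → EuclideanSpace ℝ (Fin d) → ℝ := fun t x =>
    Real.exp (-Λ * t) * k t x + ε * (1 + ‖x‖ ^ 2 + (2 * d + 1) * t)
  have hhX : h T X < 0 := hεA
  -- compact set
  set M := Real.exp (|Λ| * T) * C with hM
  set r := max ‖X‖ (M / ε + 1) with hr
  have hMnn : 0 ≤ M := by positivity
  have hout : ∀ t ∈ Set.Icc 0 T, ∀ x, r < ‖x‖ → 0 < h t x := by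
    intro t ht x hx
    have h1 : Real.exp (-Λ * t) ≤ Real.exp (|Λ| * T) := by
      apply Real.exp_le_exp.2
      have : -Λ * t ≤ |Λ| * t := mul_le_mul_of_nonneg_right (neg_le_abs Λ) ht.1
      have := mul_le_mul_of_nonneg_left ht.2 (abs_nonneg Λ)
      linarith
    have h2 : -M ≤ Real.exp (-Λ * t) * k t x := by
      have e1 : Real.exp (-Λ * t) * (-C) ≤ Real.exp (-Λ * t) * k t x :=
        mul_le_mul_of_nonneg_left (hC t ht x) (Real.exp_pos _).le
      have e2 : Real.exp (-Λ * t) * C ≤ M := mul_le_mul_of_nonneg_right h1 hCnn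
      linarith
    have h3 : M / ε + 1 < ‖x‖ := lt_of_le_of_lt (le_max_right _ _) hx
    have h4 : M / ε < ‖x‖ ^ 2 := by
      have : 0 ≤ M / ε := by positivity
      nlinarith
    have h5 : M < ε * ‖x‖ ^ 2 := by rw [div_lt_iff₀ hε] at h4; linarith
    have h6 : 0 ≤ ε * (1 + (2 * d + 1) * t) := by have := ht.1; positivity
    show 0 < Real.exp (-Λ * t) * k t x + ε * (1 + ‖x‖ ^ 2 + (2 * d + 1) * t)
    nlinarith
  have hK : IsCompact (Set.Icc 0 T ×ˢ Metric.closedBall (0:EuclideanSpace ℝ (Fin d)) r) :=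
    isCompact_Icc.prod (isCompact_closedBall _ _)
  have hcont : ContinuousOn (fun p : ℝ × EuclideanSpace ℝ (Fin d) => h p.1 p.2)
      (Set.Icc 0 T ×ˢ Metric.closedBall (0:EuclideanSpace ℝ (Fin d)) r) := by
    have : ContinuousOn (fun p : ℝ × EuclideanSpace ℝ (Fin d) => k p.1 p.2)
      (Set.Icc 0 T ×ˢ Metric.closedBall (0:EuclideanSpace ℝ (Fin d)) r) :=
      hc.mono (Set.prod_mono (fun t ht => ⟨ht.1, ht.2.trans_lt hT.2⟩) (Set.subset_univ _))
    apply ContinuousOn.add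
    · exact ContinuousOn.mul (by fun_prop) this
    · fun_prop
  obtain ⟨⟨t0, x0⟩, hmem, hmin⟩ := hK.exists_isMinOn
    ⟨(T, X), ⟨⟨hT.1, le_rfl⟩, by simp [hr]⟩⟩ hcont
  have hmin' : ∀ t ∈ Set.Icc 0 T, ∀ x, h t0 x0 ≤ h t x := by
    have hle : h t0 x0 ≤ h T X := hmin (a := (T, X)) ⟨⟨hT.1, le_rfl⟩, by simp [hr]⟩
    intro t ht x
    by_cases hx : ‖x‖ ≤ r
    · exact hmin (a := (t, x)) ⟨ht, by simpa using hx⟩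
    · push Not at hx
      linarith [hout t ht x hx]
  have hm0 : h t0 x0 < 0 := lt_of_le_of_lt (hmin' T ⟨hT.1, le_rfl⟩ X) hhX
  have ht0 : t0 ∈ Set.Icc 0 T := hmem.1
  have ht0pos : 0 < t0 := by
    rcases ht0.1.eq_or_lt with h' | h'
    · exfalso
      rw [← h'] at hm0
      have : 0 ≤ h 0 x0 := by
        have := h0 x0
        show 0 ≤ Real.exp (-Λ * 0) * k 0 x0 + ε * (1 + ‖x0‖ ^ 2 + (2 * d + 1) * 0)
        positivity
      linarith
    · exact h'
  have htI : t0 ∈ Set.Ioo 0 τ := ⟨ht0pos, ht0.2.trans_lt hT.2⟩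
  have hkneg : k t0 x0 < 0 := by
    by_contra hk
    push Not at hk
    have : 0 ≤ h t0 x0 := by
      show 0 ≤ Real.exp (-Λ * t0) * k t0 x0 + ε * (1 + ‖x0‖ ^ 2 + (2 * d + 1) * t0)
      positivity
    linarith
  -- time derivative
  have hder : HasDerivAt (fun t => h t x0)
      ((Real.exp (-Λ * t0) * (-Λ)) * k t0 x0 + Real.exp (-Λ * t0) * kt t0 x0 + ε * (2 * d + 1)) t0 := by
    have e1 : HasDerivAt (fun t : ℝ => Real.exp (-Λ * t)) (Real.exp (-Λ * t0) * (-Λ)) t0 := by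
      have : HasDerivAt (fun t : ℝ => -Λ * t) (-Λ) t0 := by
        simpa using (hasDerivAt_id t0).const_mul (-Λ)
      exact this.exp
    have e2 := e1.mul (hdt t0 htI x0)
    have e3 : HasDerivAt (fun t : ℝ => ε * (1 + ‖x0‖ ^ 2 + (2 * d + 1) * t)) (ε * (2 * d + 1)) t0 := by
      have : HasDerivAt (fun t : ℝ => (2 * d + 1 : ℝ) * t) (2 * d + 1) t0 := by
        simpa using (hasDerivAt_id t0).const_mul (2 * d + 1 : ℝ)
      exact (this.const_add _).const_mul ε
    exact e2.add e3
  have hder_le : (Real.exp (-Λ * t0) * (-Λ)) * k t0 x0 + Real.exp (-Λ * t0) * kt t0 x0 + ε * (2 * d + 1) ≤ 0 := by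
    have hs := (hasDerivAt_iff_tendsto_slope.1 hder).mono_left
      (nhdsWithin_mono t0 (show Set.Iio t0 ⊆ {t0}ᶜ from fun x hx => ne_of_lt hx))
    refine le_of_tendsto hs ?_
    filter_upwards [Ioo_mem_nhdsLT ht0pos] with s hs
    rw [slope_def_field]
    apply div_nonpos_of_nonneg_of_nonpos
    · linarith [hmin' s ⟨hs.1.le, hs.2.le.trans ht0.2⟩ x0]
    · linarith [hs.2]
  -- space derivatives
  have hsp : ∀ i, 0 ≤ Real.exp (-Λ * t0) * kxx t0 x0 i + ε * 2 := by
    intro i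
    refine second_deriv_nonneg_of_min (a := fun s => h t0 (x0 + s • eb i))
      (a' := fun s => Real.exp (-Λ * t0) * kx t0 (x0 + s • eb i) i + ε * (2 * x0 i + 2 * s)) ?_ ?_ ?_
    · intro s
      have e1 := (line_shift (f' := fun x => kx t0 x i) (fun x => hdx t0 htI x i) x0 s).const_mul (Real.exp (-Λ * t0))
      have e2 : HasDerivAt (fun s : ℝ => ε * (1 + ‖x0 + s • eb i‖ ^ 2 + (2 * d + 1) * t0)) (ε * (2 * x0 i + 2 * s)) s := by
        simp only [norm_sq_line]
        have f1 : HasDerivAt (fun s : ℝ => 2 * s * x0 i) (2 * x0 i) s := by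
          simpa using ((hasDerivAt_id s).const_mul 2).mul_const (x0 i)
        have f2 : HasDerivAt (fun s : ℝ => s ^ 2) (2 * s) s := by simpa using hasDerivAt_pow 2 s
        exact ((((f1.const_add (‖x0‖ ^ 2)).add f2).const_add 1).add_const ((2 * d + 1) * t0)).const_mul ε
      exact e1.add e2
    · have e1 := (hdxx t0 htI x0 i).const_mul (Real.exp (-Λ * t0))
      have e2 : HasDerivAt (fun s : ℝ => ε * (2 * x0 i + 2 * s)) (ε * 2) 0 := by
        have : HasDerivAt (fun s : ℝ => 2 * s) 2 0 := by simpa using (hasDerivAt_id (0:ℝ)).const_mul 2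
        exact (this.const_add _).const_mul ε
      exact e1.add e2
    · intro s
      simpa using hmin' t0 ht0 (x0 + s • eb i)
  have hsum : 0 ≤ Real.exp (-Λ * t0) * (∑ i, kxx t0 x0 i) + ε * 2 * d := by
    have := Finset.sum_nonneg (fun i (_ : i ∈ Finset.univ) => hsp i)
    rw [Finset.sum_add_distrib, ← Finset.mul_sum] at this
    simp only [Finset.sum_const, Finset.card_univ, Fintype.card_fin, nsmul_eq_mul] at this
    linarith
  have hik := mul_le_mul_of_nonneg_left (hi t0 htI x0 hkneg) (Real.exp_pos (-Λ * t0)).le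
  nlinarith

/-- spatial C² data -/
structure C2 {d : ℕ} (f : EuclideanSpace ℝ (Fin d) → ℝ)
    (f1 f2 : EuclideanSpace ℝ (Fin d) → Fin d → ℝ) : Prop where
  c0 : Continuous f
  c1 : ∀ i, Continuous (fun x => f1 x i)
  c2 : ∀ i, Continuous (fun x => f2 x i)
  d1 : ∀ x i, HasDerivAt (fun s : ℝ => f (x + s • eb i)) (f1 x i) 0
  d2 : ∀ x i, HasDerivAt (fun s : ℝ => f1 (x + s • eb i) i) (f2 x i) 0

/-- compactly supported C² data -/
structure TestF {d : ℕ} (r : ℝ) (f : EuclideanSpace ℝ (Fin d) → ℝ)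
    (f1 f2 : EuclideanSpace ℝ (Fin d) → Fin d → ℝ) : Prop extends C2 f f1 f2 where
  z0 : ∀ x, r < ‖x‖ → f x = 0
  z1 : ∀ x i, r < ‖x‖ → f1 x i = 0
  z2 : ∀ x i, r < ‖x‖ → f2 x i = 0

/-- space-time regularity data -/
structure Reg {d : ℕ} (τ : ℝ) (k kt : ℝ → EuclideanSpace ℝ (Fin d) → ℝ)
    (kx kxx : ℝ → EuclideanSpace ℝ (Fin d) → Fin d → ℝ) : Prop where
  dt : ∀ t ∈ Set.Ioo 0 τ, ∀ x, HasDerivAt (fun r => k r x) (kt t x) t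
  dx : ∀ t ∈ Set.Ioo 0 τ, ∀ x i, HasDerivAt (fun s : ℝ => k t (x + s • eb i)) (kx t x i) 0
  dxx : ∀ t ∈ Set.Ioo 0 τ, ∀ x i, HasDerivAt (fun s : ℝ => kx t (x + s • eb i) i) (kxx t x i) 0
  ck : ContinuousOn (fun p : ℝ × EuclideanSpace ℝ (Fin d) => k p.1 p.2) (Set.Ioo 0 τ ×ˢ Set.univ)
  ckt : ContinuousOn (fun p : ℝ × EuclideanSpace ℝ (Fin d) => kt p.1 p.2) (Set.Ioo 0 τ ×ˢ Set.univ)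
  ckx : ∀ i, ContinuousOn (fun p : ℝ × EuclideanSpace ℝ (Fin d) => kx p.1 p.2 i) (Set.Ioo 0 τ ×ˢ Set.univ)
  ckxx : ∀ i, ContinuousOn (fun p : ℝ × EuclideanSpace ℝ (Fin d) => kxx p.1 p.2 i) (Set.Ioo 0 τ ×ˢ Set.univ)

lemma slice_cont {d : ℕ} {s : Set ℝ} {k : ℝ → EuclideanSpace ℝ (Fin d) → ℝ}
    (hk : ContinuousOn (fun p : ℝ × EuclideanSpace ℝ (Fin d) => k p.1 p.2) (s ×ˢ Set.univ))
    {t : ℝ} (ht : t ∈ s) : Continuous (k t) := by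
  rw [← continuousOn_univ]
  exact hk.comp (f := fun x => (t, x)) (by fun_prop) (fun x _ => ⟨ht, trivial⟩)

lemma Reg.c2 {d : ℕ} {τ : ℝ} {k kt : ℝ → EuclideanSpace ℝ (Fin d) → ℝ}
    {kx kxx : ℝ → EuclideanSpace ℝ (Fin d) → Fin d → ℝ} (h : Reg τ k kt kx kxx) {t : ℝ}
    (ht : t ∈ Set.Ioo 0 τ) : C2 (k t) (kx t) (kxx t) where
  c0 := slice_cont h.ck ht
  c1 := fun i => slice_cont (k := fun t x => kx t x i) (h.ckx i) ht
  c2 := fun i => slice_cont (k := fun t x => kxx t x i) (h.ckxx i) ht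
  d1 := h.dx t ht
  d2 := h.dxx t ht

lemma Reg.sub {d : ℕ} {τ : ℝ} {k kt : ℝ → EuclideanSpace ℝ (Fin d) → ℝ}
    {kx kxx : ℝ → EuclideanSpace ℝ (Fin d) → Fin d → ℝ} (h : Reg τ k kt kx kxx)
    {l lt : ℝ → EuclideanSpace ℝ (Fin d) → ℝ}
    {lx lxx : ℝ → EuclideanSpace ℝ (Fin d) → Fin d → ℝ} (h' : Reg τ l lt lx lxx) :
    Reg τ (fun t x => k t x - l t x) (fun t x => kt t x - lt t x)
      (fun t x i => kx t x i - lx t x i) (fun t x i => kxx t x i - lxx t x i) where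
  dt := fun t ht x => (h.dt t ht x).sub (h'.dt t ht x)
  dx := fun t ht x i => (h.dx t ht x i).sub (h'.dx t ht x i)
  dxx := fun t ht x i => (h.dxx t ht x i).sub (h'.dxx t ht x i)
  ck := h.ck.sub h'.ck
  ckt := h.ckt.sub h'.ckt
  ckx := fun i => (h.ckx i).sub (h'.ckx i)
  ckxx := fun i => (h.ckxx i).sub (h'.ckxx i)

section ident
variable {d : ℕ} {r : ℝ} {p : EuclideanSpace ℝ (Fin d) → ℝ}
    {p1 p2 : EuclideanSpace ℝ (Fin d) → Fin d → ℝ}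
    {f : EuclideanSpace ℝ (Fin d) → ℝ} {f1 f2 : EuclideanSpace ℝ (Fin d) → Fin d → ℝ}

lemma line0 (x : EuclideanSpace ℝ (Fin d)) (i : Fin d) : x + (0:ℝ) • eb i = x := by simp

lemma TestF.intg (_hp : TestF r p p1 p2) {g : EuclideanSpace ℝ (Fin d) → ℝ} (hg : Continuous g) :
    Integrable (fun x => p x * g x) :=
  intg_of_vanish (r := r) (_hp.c0.mul hg) (fun x hx => by simp [_hp.z0 x hx])

lemma TestF.intg1 (_hp : TestF r p p1 p2) (i : Fin d) {g : EuclideanSpace ℝ (Fin d) → ℝ} (hg : Continuous g) :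
    Integrable (fun x => p1 x i * g x) :=
  intg_of_vanish (r := r) ((_hp.c1 i).mul hg) (fun x hx => by simp [_hp.z1 x i hx])

lemma TestF.intg2 (_hp : TestF r p p1 p2) (i : Fin d) {g : EuclideanSpace ℝ (Fin d) → ℝ} (hg : Continuous g) :
    Integrable (fun x => p2 x i * g x) :=
  intg_of_vanish (r := r) ((_hp.c2 i).mul hg) (fun x hx => by simp [_hp.z2 x i hx])

lemma TestF.mulC2 (hp : TestF r p p1 p2) (hf : C2 f f1 f2) :
    TestF r (fun x => p x * f x) (fun x i => p1 x i * f x + p x * f1 x i)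
      (fun x i => p2 x i * f x + 2 * (p1 x i * f1 x i) + p x * f2 x i) where
  c0 := hp.c0.mul hf.c0
  c1 := fun i => ((hp.c1 i).mul hf.c0).add (hp.c0.mul (hf.c1 i))
  c2 := fun i => (((hp.c2 i).mul hf.c0).add (continuous_const.mul ((hp.c1 i).mul (hf.c1 i)))).add
    (hp.c0.mul (hf.c2 i))
  d1 := fun x i => by
    have := (hp.d1 x i).fun_mul (hf.d1 x i)
    simp only [line0] at this
    exact this
  d2 := fun x i => by
    have := ((hp.d2 x i).fun_mul (hf.d1 x i)).fun_add ((hp.d1 x i).fun_mul (hf.d2 x i))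
    simp only [line0] at this
    rw [show p2 x i * f x + 2 * (p1 x i * f1 x i) + p x * f2 x i = p2 x i * f x + p1 x i * f1 x i + (p1 x i * f1 x i + p x * f2 x i) by ring]
    exact this
  z0 := fun x hx => by simp [hp.z0 x hx]
  z1 := fun x i hx => by simp [hp.z0 x hx, hp.z1 x i hx]
  z2 := fun x i hx => by simp [hp.z0 x hx, hp.z1 x i hx, hp.z2 x i hx]

lemma TestF.i1 (hp : TestF r p p1 p2) (hf : C2 f f1 f2) (i : Fin d) :
    ∫ x, p x * f2 x i = ∫ x, p2 x i * f x := by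
  rw [ibp_test i (hf.c1 i) (hf.c2 i) hp.c0 (hp.c1 i) (fun x => hf.d2 x i) (fun x => hp.d1 x i) hp.z0
    (fun x hx => hp.z1 x i hx),
    ibp_test i hf.c0 (hf.c1 i) (hp.c1 i) (hp.c2 i) (fun x => hf.d1 x i) (fun x => hp.d2 x i)
    (fun x hx => hp.z1 x i hx) (fun x hx => hp.z2 x i hx), neg_neg]

lemma TestF.i3 (hp : TestF r p p1 p2) (hf : C2 f f1 f2) {g : EuclideanSpace ℝ (Fin d) → ℝ}
    {g1 g2 : EuclideanSpace ℝ (Fin d) → Fin d → ℝ} (hg : C2 g g1 g2) (i : Fin d) :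
    ∫ x, p x * (f1 x i * g1 x i) = - ∫ x, f x * (p1 x i * g1 x i + p x * g2 x i) := by
  have := ibp_test i hf.c0 (hf.c1 i) (hp.c0.mul (hg.c1 i))
    (((hp.c1 i).mul (hg.c1 i)).add (hp.c0.mul (hg.c2 i))) (r := r) (fun x => hf.d1 x i)
    (fun x => by
      have := (hp.d1 x i).fun_mul (hg.d2 x i)
      simp only [line0] at this
      exact this)
    (fun x hx => by simp [hp.z0 x hx]) (fun x hx => by simp [hp.z0 x hx, hp.z1 x i hx])
  rw [show (fun x => p x * (f1 x i * g1 x i)) = (fun x => (p * fun x => g1 x i) x * f1 x i) from by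
    funext x; simp; ring, this]
  congr 2
  funext x; simp; ring

lemma TestF.i2 (hp : TestF r p p1 p2) (hf : C2 f f1 f2) (i : Fin d) :
    ∫ x, p x * (f x * f2 x i) = - (∫ x, p x * (f1 x i) ^ 2) + (1/2) * ∫ x, p2 x i * (f x) ^ 2 := by
  have h1 := hp.i3 hf hf i
  have h2 := ibp_test i (hf.c0.mul hf.c0) ((((hf.c1 i).mul hf.c0)).add (hf.c0.mul (hf.c1 i))) (hp.c1 i) (hp.c2 i)
    (fun x => by
      have := (hf.d1 x i).fun_mul (hf.d1 x i)
      simp only [line0] at this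
      exact this) (fun x => hp.d2 x i) (fun x hx => hp.z1 x i hx) (fun x hx => hp.z2 x i hx)
  have h3 : ∫ x, f x * (p1 x i * f1 x i + p x * f2 x i) = (∫ x, p1 x i * (f x * f1 x i)) + ∫ x, p x * (f x * f2 x i) := by
    have a1 : Integrable (fun x => p1 x i * (f x * f1 x i)) := hp.intg1 i (hf.c0.mul (hf.c1 i))
    have a2 : Integrable (fun x => p x * (f x * f2 x i)) := hp.intg (hf.c0.mul (hf.c2 i))
    rw [← integral_add a1 a2]
    congr 1; funext x; ring
  have h4 : ∫ x, p1 x i * ((fun x => f1 x i * f x) + fun x => f x * f1 x i) x = 2 * ∫ x, p1 x i * (f x * f1 x i) := by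
    rw [← integral_const_mul]
    congr 1; funext x; simp; ring
  have h5 : ∫ x, p x * f1 x i ^ 2 = ∫ x, p x * (f1 x i * f1 x i) := by
    congr 1; funext x; ring
  have h6 : ∫ x, p2 x i * f x ^ 2 = ∫ x, p2 x i * (f * f) x := by
    congr 1; funext x; rw [Pi.mul_apply]; ring
  have h2' : ∫ x, p1 x i * ((fun x => f1 x i * f x) + fun x => f x * f1 x i) x = - ∫ x, p2 x i * (f * f) x := h2
  rw [h4] at h2'
  rw [h5, h6]
  linarith

/-- the key identity for `∫ ψ v w_ii`, `v = c - z - w` -/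
lemma TestF.i4 (hp : TestF r p p1 p2) (hf : C2 f f1 f2) {g : EuclideanSpace ℝ (Fin d) → ℝ}
    {g1 g2 : EuclideanSpace ℝ (Fin d) → Fin d → ℝ} (hg : C2 g g1 g2) (c : ℝ) (i : Fin d) :
    ∫ x, p x * ((c - g x - f x) * f2 x i) = (∫ x, p x * (f1 x i) ^ 2) +
      ∫ x, f x * (p2 x i * (c - g x - f x / 2) - 2 * (p1 x i * g1 x i) - p x * g2 x i) := by
  have h1 := hp.i1 hf i
  have h2 := hp.i2 hf i
  have h3 := (hp.mulC2 hg).i1 hf i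
  have I0 := hp.intg (hf.c2 i)
  have I1 := (hp.mulC2 hg).intg (hf.c2 i)
  have I2 : Integrable (fun x => p x * (f x * f2 x i)) := hp.intg (hf.c0.mul (hf.c2 i))
  have I3 : Integrable (fun x => c * (p x * f2 x i) - p x * g x * f2 x i) := (I0.const_mul c).sub I1
  have e1 : ∫ x, p x * ((c - g x - f x) * f2 x i) = c * (∫ x, p x * f2 x i) - (∫ x, p x * g x * f2 x i)
      - ∫ x, p x * (f x * f2 x i) := by
    rw [← integral_const_mul, ← integral_sub (I0.const_mul c) I1, ← integral_sub I3 I2]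
    congr 1; funext x; ring
  have J0 := hp.intg2 i hf.c0
  have J1 : Integrable (fun x => (p2 x i * g x + 2 * (p1 x i * g1 x i) + p x * g2 x i) * f x) := (hp.mulC2 hg).intg2 i hf.c0
  have J2 : Integrable (fun x => p2 x i * f x ^ 2) := hp.intg2 i (hf.c0.pow 2)
  have J3 : Integrable (fun x => c * (p2 x i * f x) - (p2 x i * g x + 2 * (p1 x i * g1 x i) + p x * g2 x i) * f x) := (J0.const_mul c).sub J1
  have e2 : ∫ x, f x * (p2 x i * (c - g x - f x / 2) - 2 * (p1 x i * g1 x i) - p x * g2 x i) =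
      c * (∫ x, p2 x i * f x) - (∫ x, (p2 x i * g x + 2 * (p1 x i * g1 x i) + p x * g2 x i) * f x)
      - (1/2) * ∫ x, p2 x i * (f x)^2 := by
    rw [← integral_const_mul, ← integral_const_mul, ← integral_sub (J0.const_mul c) J1, ← integral_sub J3 (J2.const_mul _)]
    congr 1; funext x; simp; ring
  rw [e1, e2, h1, h2, h3]
  ring
end ident

/-- hypotheses for the energy step -/
structure Core {d : ℕ} (τ K c : ℝ) (w wt : ℝ → EuclideanSpace ℝ (Fin d) → ℝ)
    (wx wxx : ℝ → EuclideanSpace ℝ (Fin d) → Fin d → ℝ)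
    (z zt : ℝ → EuclideanSpace ℝ (Fin d) → ℝ)
    (zx zxx : ℝ → EuclideanSpace ℝ (Fin d) → Fin d → ℝ)
    (nu Gu P : ℝ → EuclideanSpace ℝ (Fin d) → ℝ) : Prop where
  rw : Reg τ w wt wx wxx
  rz : Reg τ z zt zx zxx
  pde : ∀ t ∈ Set.Ioo 0 τ, ∀ x, wt t x = (∑ i, wxx t x i) + P t x + nu t x
  cnu : ContinuousOn (fun p : ℝ × EuclideanSpace ℝ (Fin d) => nu p.1 p.2) (Set.Ioo 0 τ ×ˢ Set.univ)
  cG : ContinuousOn (fun p : ℝ × EuclideanSpace ℝ (Fin d) => Gu p.1 p.2) (Set.Ioo 0 τ ×ˢ Set.univ)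
  cP : ContinuousOn (fun p : ℝ × EuclideanSpace ℝ (Fin d) => P p.1 p.2) (Set.Ioo 0 τ ×ˢ Set.univ)
  nu0 : ∀ t ∈ Set.Ioo 0 τ, ∀ x, 0 ≤ nu t x
  dG : ∀ t ∈ Set.Ioo 0 τ, ∀ x, HasDerivAt (fun r => Gu r x) (nu t x * (wt t x + zt t x)) t
  G0 : ∀ t ∈ Set.Ioo 0 τ, ∀ x, 0 ≤ Gu t x
  G1 : ∀ t ∈ Set.Ioo 0 τ, ∀ x, Gu t x ≤ nu t x / 8
  w0 : ∀ t ∈ Set.Ioo 0 τ, ∀ x, 0 ≤ w t x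
  w1 : ∀ t ∈ Set.Ioo 0 τ, ∀ x, w t x ≤ K
  hP : ∀ t ∈ Set.Ioo 0 τ, ∀ x, |P t x| ≤ K * w t x
  vnu : ∀ t ∈ Set.Ioo 0 τ, ∀ x, (c - z t x - w t x) * nu t x ≤ 0
  cz : ∀ t ∈ Set.Ioo 0 τ, ∀ x, |c - z t x| ≤ K
  cv : ∀ t ∈ Set.Ioo 0 τ, ∀ x, |c - z t x - w t x| ≤ K
  hY : ∀ t ∈ Set.Ioo 0 τ, ∀ x, 1 ≤ 2 * (c - z t x) - w t x
  hd : (d : ℝ) ≤ K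
  K1 : 1 ≤ K
  bzt : ∀ t ∈ Set.Ioo 0 τ, ∀ x, |zt t x| ≤ K / (2 * t)
  bzx : ∀ t ∈ Set.Ioo 0 τ, ∀ x i, |zx t x i| ≤ K / √(2 * t)
  bzxx : ∀ t ∈ Set.Ioo 0 τ, ∀ x i, |zxx t x i| ≤ K / (2 * t)

/-- cutoff weights at scale s -/
structure WP {d : ℕ} (s r : ℝ) (φ ψ : EuclideanSpace ℝ (Fin d) → ℝ)
    (ψ1 ψ2 : EuclideanSpace ℝ (Fin d) → Fin d → ℝ) (χ : EuclideanSpace ℝ (Fin d) → ℝ)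
    (χ1 χ2 : EuclideanSpace ℝ (Fin d) → Fin d → ℝ) : Prop where
  tp : TestF r ψ ψ1 ψ2
  tc : TestF r χ χ1 χ2
  cphi : Continuous φ
  iphi : Integrable φ
  p0 : ∀ x, 0 ≤ ψ x
  pc : ∀ x, ψ x ≤ χ x
  cp : ∀ x, χ x ≤ φ x
  b1 : ∀ x i, |ψ1 x i| ≤ φ x / √s
  b2 : ∀ x i, |ψ2 x i| ≤ 5 * φ x / s
  bc2 : ∀ x i, |χ2 x i| ≤ 5 * φ x / s
  b11 : ∀ x i, (ψ1 x i) ^ 2 ≤ 4 / s * (ψ x * χ x)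

lemma C2.add {d : ℕ} {f g : EuclideanSpace ℝ (Fin d) → ℝ}
    {f1 f2 g1 g2 : EuclideanSpace ℝ (Fin d) → Fin d → ℝ} (hf : C2 f f1 f2) (hg : C2 g g1 g2) :
    C2 (fun x => f x + g x) (fun x i => f1 x i + g1 x i) (fun x i => f2 x i + g2 x i) where
  c0 := hf.c0.add hg.c0
  c1 := fun i => (hf.c1 i).add (hg.c1 i)
  c2 := fun i => (hf.c2 i).add (hg.c2 i)
  d1 := fun x i => (hf.d1 x i).add (hg.d1 x i)
  d2 := fun x i => (hf.d2 x i).add (hg.d2 x i)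

lemma C2.sub {d : ℕ} {f g : EuclideanSpace ℝ (Fin d) → ℝ}
    {f1 f2 g1 g2 : EuclideanSpace ℝ (Fin d) → Fin d → ℝ} (hf : C2 f f1 f2) (hg : C2 g g1 g2) :
    C2 (fun x => f x - g x) (fun x i => f1 x i - g1 x i) (fun x i => f2 x i - g2 x i) where
  c0 := hf.c0.sub hg.c0
  c1 := fun i => (hf.c1 i).sub (hg.c1 i)
  c2 := fun i => (hf.c2 i).sub (hg.c2 i)
  d1 := fun x i => (hf.d1 x i).sub (hg.d1 x i)
  d2 := fun x i => (hf.d2 x i).sub (hg.d2 x i)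

/-- derivative of the Dirichlet energy in one coordinate direction, no mixed derivatives needed -/
lemma deriv_dirichlet {d : ℕ} {τ r : ℝ} {p : EuclideanSpace ℝ (Fin d) → ℝ}
    {p1 p2 : EuclideanSpace ℝ (Fin d) → Fin d → ℝ} (hp : TestF r p p1 p2)
    {w wt : ℝ → EuclideanSpace ℝ (Fin d) → ℝ}
    {wx wxx : ℝ → EuclideanSpace ℝ (Fin d) → Fin d → ℝ} (h : Reg τ w wt wx wxx) (i : Fin d)
    {t : ℝ} (ht : t ∈ Set.Ioo 0 τ) :
    HasDerivAt (fun t => (1/2) * ∫ x, p x * (wx t x i) ^ 2)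
      (- ∫ x, wt t x * (p1 x i * wx t x i + p x * wxx t x i)) t := by
  have key : ∀ t2 ∈ Set.Ioo 0 τ, t2 ≠ t → slope (fun t => (1/2) * ∫ x, p x * (wx t x i) ^ 2) t t2 =
      - ∫ x, slope (fun t => w t x) t t2 * ((p1 x i * (wx t2 x i + wx t x i) + p x * (wxx t2 x i + wxx t x i)) / 2) := by
    intro t2 ht2 hne
    have e := hp.i3 ((h.c2 ht2).sub (h.c2 ht)) ((h.c2 ht2).add (h.c2 ht)) i
    have I2 : Integrable (fun x => p x * (wx t2 x i) ^ 2) := hp.intg (((h.c2 ht2).c1 i).pow 2)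
    have I1 : Integrable (fun x => p x * (wx t x i) ^ 2) := hp.intg (((h.c2 ht).c1 i).pow 2)
    have e2 : (∫ x, p x * (wx t2 x i) ^ 2) - (∫ x, p x * (wx t x i) ^ 2) =
        ∫ x, p x * ((wx t2 x i - wx t x i) * (wx t2 x i + wx t x i)) := by
      rw [← integral_sub I2 I1]; congr 1; funext x; ring
    rw [slope_def_field, ← mul_sub, e2, e]
    have hne' : t2 - t ≠ 0 := sub_ne_zero.2 hne
    rw [show (1/2:ℝ) * (-∫ x, (w t2 x - w t x) * (p1 x i * (wx t2 x i + wx t x i) + p x * (wxx t2 x i + wxx t x i))) / (t2 - t)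
      = - ((1 / (2 * (t2 - t))) * ∫ x, (w t2 x - w t x) * (p1 x i * (wx t2 x i + wx t x i) + p x * (wxx t2 x i + wxx t x i))) by
        field_simp]
    rw [← integral_const_mul]
    congr 2; funext x
    rw [slope_def_field]
    field_simp
  rw [hasDerivAt_iff_tendsto_slope]
  have hnear : ∀ᶠ t2 in nhdsWithin t {t}ᶜ, t2 ∈ Set.Ioo 0 τ ∧ t2 ≠ t :=
    (Filter.eventually_of_mem (mem_nhdsWithin_of_mem_nhds (Ioo_mem_nhds ht.1 ht.2)) (fun _ h => h)).and
      (Filter.eventually_of_mem self_mem_nhdsWithin (fun _ h => h))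
  refine Filter.Tendsto.congr' (f₁ := fun t2 => - ∫ x, slope (fun t => w t x) t t2 * ((p1 x i * (wx t2 x i + wx t x i) + p x * (wxx t2 x i + wxx t x i)) / 2)) ?_ ?_
  · filter_upwards [hnear] with t2 h2
    exact (key t2 h2.1 h2.2).symm
  apply Filter.Tendsto.neg
  obtain ⟨ε, hε, hsub⟩ := Metric.nhds_basis_closedBall.mem_iff.1 (Ioo_mem_nhds ht.1 ht.2)
  have hK : IsCompact (Metric.closedBall t ε ×ˢ Metric.closedBall (0:EuclideanSpace ℝ (Fin d)) r) :=
    (isCompact_closedBall _ _).prod (isCompact_closedBall _ _)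
  have hKsub : Metric.closedBall t ε ×ˢ Metric.closedBall (0:EuclideanSpace ℝ (Fin d)) r ⊆ Set.Ioo 0 τ ×ˢ Set.univ :=
    Set.prod_mono hsub (Set.subset_univ _)
  obtain ⟨C, hC⟩ := hK.exists_bound_of_continuousOn (h.ckt.mono hKsub)
  have cont2 : ContinuousOn (fun q : ℝ × EuclideanSpace ℝ (Fin d) =>
      (p1 q.2 i * (wx q.1 q.2 i + wx t q.2 i) + p q.2 * (wxx q.1 q.2 i + wxx t q.2 i)) / 2)
      (Set.Ioo 0 τ ×ˢ Set.univ) := by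
    have a1 : Continuous (fun q : ℝ × EuclideanSpace ℝ (Fin d) => p1 q.2 i) := (hp.c1 i).comp continuous_snd
    have a2 : Continuous (fun q : ℝ × EuclideanSpace ℝ (Fin d) => p q.2) := hp.c0.comp continuous_snd
    have a3 : Continuous (fun q : ℝ × EuclideanSpace ℝ (Fin d) => wx t q.2 i) := ((h.c2 ht).c1 i).comp continuous_snd
    have a4 : Continuous (fun q : ℝ × EuclideanSpace ℝ (Fin d) => wxx t q.2 i) := ((h.c2 ht).c2 i).comp continuous_snd
    exact ((a1.continuousOn.mul ((h.ckx i).add a3.continuousOn)).add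
      (a2.continuousOn.mul ((h.ckxx i).add a4.continuousOn))).div_const 2
  obtain ⟨C', hC'⟩ := hK.exists_bound_of_continuousOn (cont2.mono hKsub)
  refine tendsto_integral_filter_of_dominated_convergence
    (Set.indicator (Metric.closedBall (0:EuclideanSpace ℝ (Fin d)) r) (fun _ => C * C')) ?_ ?_ ?_ ?_
  · filter_upwards [hnear] with t2 h2
    apply Continuous.aestronglyMeasurable
    have b1 := slice_cont (k := fun t2 x => (p1 x i * (wx t2 x i + wx t x i) + p x * (wxx t2 x i + wxx t x i)) / 2) cont2 h2.1
    simp only [slope_def_field]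
    exact ((((h.c2 h2.1).c0).sub (h.c2 ht).c0).div_const _).mul b1
  · filter_upwards [hnear, mem_nhdsWithin_of_mem_nhds (Metric.closedBall_mem_nhds t hε)] with t2 h2 h2b
    refine Filter.Eventually.of_forall fun x => ?_
    by_cases hx : x ∈ Metric.closedBall (0:EuclideanSpace ℝ (Fin d)) r
    · simp only [hx, Set.indicator_of_mem, norm_mul]
      have hb2 := hC' (t2, x) ⟨h2b, hx⟩
      have hb1 : ‖slope (fun t => w t x) t t2‖ ≤ C := by
        have := Convex.norm_image_sub_le_of_norm_hasDerivWithin_le (f := fun t => w t x) (f' := fun t => wt t x)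
          (s := Metric.closedBall t ε) (C := C) (x := t) (y := t2)
          (fun s hs => (h.dt s (hsub hs) x).hasDerivWithinAt) (fun s hs => hC (s, x) ⟨hs, hx⟩)
          (convex_closedBall t ε) (Metric.mem_closedBall_self hε.le) h2b
        rw [slope_def_field, norm_div, div_le_iff₀ (norm_pos_iff.2 (sub_ne_zero.2 h2.2))]
        exact this
      exact mul_le_mul hb1 hb2 (norm_nonneg _) ((norm_nonneg _).trans hb1)
    · have hx' : r < ‖x‖ := by simpa using hx
      simp [hx, hp.z0 x hx', hp.z1 x i hx']
  · rw [integrable_indicator_iff measurableSet_closedBall]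
    exact continuous_const.continuousOn.integrableOn_compact (isCompact_closedBall 0 r)
  · refine Filter.Eventually.of_forall fun x => ?_
    have l1 := hasDerivAt_iff_tendsto_slope.1 (h.dt t ht x)
    have l2 : Filter.Tendsto (fun t2 => (p1 x i * (wx t2 x i + wx t x i) + p x * (wxx t2 x i + wxx t x i)) / 2)
        (nhdsWithin t {t}ᶜ) (nhds ((p1 x i * (wx t x i + wx t x i) + p x * (wxx t x i + wxx t x i)) / 2)) := by
      have : ContinuousAt (fun q : ℝ × EuclideanSpace ℝ (Fin d) =>
        (p1 q.2 i * (wx q.1 q.2 i + wx t q.2 i) + p q.2 * (wxx q.1 q.2 i + wxx t q.2 i)) / 2) (t, x) :=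
        cont2.continuousAt (prod_mem_nhds (Ioo_mem_nhds ht.1 ht.2) Filter.univ_mem)
      have h2 : ContinuousAt (fun t2 => (p1 x i * (wx t2 x i + wx t x i) + p x * (wxx t2 x i + wxx t x i)) / 2) t :=
        ContinuousAt.comp (f := fun t2 : ℝ => (t2, x)) this (by fun_prop)
      exact h2.tendsto.mono_left nhdsWithin_le_nhds
    have := l1.mul l2
    convert this using 2
    ring

section step
variable {d : ℕ} {τ K c : ℝ} {w wt : ℝ → EuclideanSpace ℝ (Fin d) → ℝ}
    {wx wxx : ℝ → EuclideanSpace ℝ (Fin d) → Fin d → ℝ}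
    {z zt : ℝ → EuclideanSpace ℝ (Fin d) → ℝ}
    {zx zxx : ℝ → EuclideanSpace ℝ (Fin d) → Fin d → ℝ}
    {nu Gu P : ℝ → EuclideanSpace ℝ (Fin d) → ℝ}
    {s r : ℝ} {φ p : EuclideanSpace ℝ (Fin d) → ℝ}
    {p1 p2 : EuclideanSpace ℝ (Fin d) → Fin d → ℝ}

lemma int_le_m {h φ v : EuclideanSpace ℝ (Fin d) → ℝ} {A : ℝ} (hh : Integrable h)
    (iphi : Integrable φ) (cv : Continuous v) (v0 : ∀ x, 0 ≤ v x) (v1 : ∀ x, v x ≤ K)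
    (hle : ∀ x, h x ≤ A * (φ x * v x)) : ∫ x, h x ≤ A * ∫ x, φ x * v x := by
  rw [← integral_const_mul]
  apply integral_mono hh _ hle
  apply Integrable.const_mul
  apply iphi.mul_bdd (c := K) cv.aestronglyMeasurable
  exact Filter.Eventually.of_forall fun x => by
    rw [Real.norm_eq_abs, abs_of_nonneg (v0 x)]; exact v1 x

lemma Core.expand (hC : Core τ K c w wt wx wxx z zt zx zxx nu Gu P) (hp : TestF r p p1 p2)
    {t : ℝ} (ht : t ∈ Set.Ioo 0 τ) {a : EuclideanSpace ℝ (Fin d) → ℝ} (ha : Continuous a) :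
    ∫ x, p x * (a x * wt t x) = (∑ i, ∫ x, p x * (a x * wxx t x i)) + (∫ x, p x * (a x * P t x))
      + ∫ x, p x * (a x * nu t x) := by
  have i1 : ∀ i ∈ Finset.univ, Integrable (fun x => p x * (a x * wxx t x i)) := fun i _ => hp.intg (ha.mul ((hC.rw.c2 ht).c2 i))
  have i2 : Integrable (fun x => p x * (a x * P t x)) := hp.intg (ha.mul (slice_cont hC.cP ht))
  have i3 : Integrable (fun x => p x * (a x * nu t x)) := hp.intg (ha.mul (slice_cont hC.cnu ht))
  have i4 : Integrable (fun x => ∑ i, p x * (a x * wxx t x i)) := integrable_finsetSum _ i1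
  have i5 : Integrable (fun x => (∑ i, p x * (a x * wxx t x i)) + p x * (a x * P t x)) := i4.add i2
  rw [← integral_finsetSum _ i1, ← integral_add i4 i2, ← integral_add i5 i3]
  congr 1; funext x
  rw [hC.pde t ht x, ← Finset.mul_sum, ← Finset.mul_sum]
  ring

lemma prod_snd_cont {f : EuclideanSpace ℝ (Fin d) → ℝ} (hf : Continuous f) (S : Set (ℝ × EuclideanSpace ℝ (Fin d))) :
    ContinuousOn (fun q : ℝ × EuclideanSpace ℝ (Fin d) => f q.2) S :=
  (hf.comp continuous_snd).continuousOn

lemma Core.l1 (hC : Core τ K c w wt wx wxx z zt zx zxx nu Gu P) (hp : TestF r p p1 p2)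
    (hs : 0 < s) (hs1 : s ≤ 1) (iphi : Integrable φ) (p0 : ∀ x, 0 ≤ p x) (pphi : ∀ x, p x ≤ φ x)
    (b2 : ∀ x i, |p2 x i| ≤ 5 * φ x / s) {t : ℝ} (ht : t ∈ Set.Ioo 0 τ) :
    HasDerivAt (fun t => ∫ x, p x * w t x) (∫ x, p x * wt t x) t ∧
    (∫ x, p x * nu t x) - 6 * K / s * (∫ x, φ x * w t x) ≤ ∫ x, p x * wt t x := by
  have K1 := hC.K1
  have hm0 : 0 ≤ ∫ x, φ x * w t x := integral_nonneg fun x => mul_nonneg ((p0 x).trans (pphi x)) (hC.w0 t ht x)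
  constructor
  · exact deriv_int_test (r := r) (fun t ht x => (hC.rw.dt t ht x).const_mul (p x))
      ((prod_snd_cont hp.c0 _).mul hC.rw.ck) ((prod_snd_cont hp.c0 _).mul hC.rw.ckt)
      (fun t ht x hx => by simp [hp.z0 x hx]) (fun t ht x hx => by simp [hp.z0 x hx]) ht
  · have e := hC.expand hp ht (a := fun _ => 1) continuous_const
    simp only [one_mul] at e
    rw [e]
    have hb : ∀ i, -(5 / s * ∫ x, φ x * w t x) ≤ ∫ x, p x * wxx t x i := by
      intro i
      rw [hp.i1 (hC.rw.c2 ht) i, neg_le, ← integral_neg]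
      refine int_le_m (hp.intg2 i (hC.rw.c2 ht).c0).neg iphi (hC.rw.c2 ht).c0 (hC.w0 t ht) (hC.w1 t ht) ?_
      intro x
      have h1 := neg_le_of_abs_le (b2 x i)
      have h2 := mul_le_mul_of_nonneg_right h1 (hC.w0 t ht x)
      have : 5 * φ x / s * w t x = 5 / s * (φ x * w t x) := by ring
      linarith
    have hsum : -(5 * K / s * ∫ x, φ x * w t x) ≤ ∑ i, ∫ x, p x * wxx t x i := by
      have h1 := Finset.sum_le_sum (fun i (_ : i ∈ Finset.univ) => hb i)
      simp only [Finset.sum_const, Finset.card_univ, Fintype.card_fin, nsmul_eq_mul] at h1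
      have h2 : (d:ℝ) * (5 / s * ∫ x, φ x * w t x) ≤ K * (5 / s * ∫ x, φ x * w t x) :=
        mul_le_mul_of_nonneg_right hC.hd (by positivity)
      have h3 : K * (5 / s * ∫ x, φ x * w t x) = 5 * K / s * ∫ x, φ x * w t x := by ring
      linarith
    have hPb : -(K / s * ∫ x, φ x * w t x) ≤ ∫ x, p x * P t x := by
      rw [neg_le, ← integral_neg]
      refine int_le_m (hp.intg (slice_cont hC.cP ht)).neg iphi (hC.rw.c2 ht).c0 (hC.w0 t ht) (hC.w1 t ht) ?_
      intro x
      have h1 := neg_le_of_abs_le (hC.hP t ht x)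
      have hw := hC.w0 t ht x
      have h2 : p x * (-P t x) ≤ p x * (K * w t x) := mul_le_mul_of_nonneg_left (by linarith) (p0 x)
      have h3 : p x * (K * w t x) ≤ φ x * (K * w t x) := mul_le_mul_of_nonneg_right (pphi x) (by positivity)
      have h4 : K ≤ K / s := by rw [le_div_iff₀ hs]; nlinarith
      have h5 : K * (φ x * w t x) ≤ K / s * (φ x * w t x) := mul_le_mul_of_nonneg_right h4 (mul_nonneg ((p0 x).trans (pphi x)) hw)
      linarith
    have : 6 * K / s * (∫ x, φ x * w t x) = 5 * K / s * (∫ x, φ x * w t x) + K / s * ∫ x, φ x * w t x := by ring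
    linarith

lemma Core.l2 (hC : Core τ K c w wt wx wxx z zt zx zxx nu Gu P) (hp : TestF r p p1 p2)
    (hs : 0 < s) (hs1 : s ≤ 1) (iphi : Integrable φ) (p0 : ∀ x, 0 ≤ p x) (pphi : ∀ x, p x ≤ φ x)
    (b2 : ∀ x i, |p2 x i| ≤ 5 * φ x / s) {t : ℝ} (ht : t ∈ Set.Ioo 0 τ) :
    HasDerivAt (fun t => ∫ x, p x * (w t x * w t x / 2)) (∫ x, p x * (w t x * wt t x)) t ∧
    (∫ x, p x * (w t x * wt t x)) ≤ - 2 * (∑ i, (1/2) * ∫ x, p x * (wx t x i)^2)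
      + 4 * K ^ 2 / s * (∫ x, φ x * w t x) + K * ∫ x, p x * nu t x := by
  have K1 := hC.K1
  have hm0 : 0 ≤ ∫ x, φ x * w t x := integral_nonneg fun x => mul_nonneg ((p0 x).trans (pphi x)) (hC.w0 t ht x)
  constructor
  · refine deriv_int_test (r := r) (h := fun t x => p x * (w t x * w t x / 2)) (ht := fun t x => p x * (w t x * wt t x)) (fun t ht x => ?_)
      ((prod_snd_cont hp.c0 _).mul ((hC.rw.ck.mul hC.rw.ck).div_const 2)) ((prod_snd_cont hp.c0 _).mul (hC.rw.ck.mul hC.rw.ckt))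
      (fun t ht x hx => by simp [hp.z0 x hx]) (fun t ht x hx => by simp [hp.z0 x hx]) ht
    have := (((hC.rw.dt t ht x).fun_mul (hC.rw.dt t ht x)).div_const 2).const_mul (p x)
    rwa [show p x * ((wt t x * w t x + w t x * wt t x) / 2) = p x * (w t x * wt t x) by ring] at this
  · rw [hC.expand hp ht (hC.rw.c2 ht).c0]
    have hb : ∀ i, ∫ x, p x * (w t x * wxx t x i) ≤ - (∫ x, p x * (wx t x i)^2) + 5 * K / (2 * s) * ∫ x, φ x * w t x := by
      intro i
      rw [hp.i2 (hC.rw.c2 ht) i]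
      refine add_le_add_right ?_ _
      rw [← integral_const_mul]
      refine int_le_m ((hp.intg2 i ((hC.rw.c2 ht).c0.pow 2)).const_mul _) iphi (hC.rw.c2 ht).c0 (hC.w0 t ht) (hC.w1 t ht) ?_
      intro x
      have h1 := le_of_abs_le (b2 x i)
      have hw := hC.w0 t ht x
      have hw2 : w t x ^ 2 ≤ K * w t x := by have := hC.w1 t ht x; nlinarith
      have hphi := (p0 x).trans (pphi x)
      have h2 := mul_le_mul_of_nonneg_right h1 (sq_nonneg (w t x))
      have h3 : 5 * φ x / s * w t x ^ 2 ≤ 5 * φ x / s * (K * w t x) := mul_le_mul_of_nonneg_left hw2 (by positivity)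
      have : 5 * K / (2 * s) * (φ x * w t x) = (1/2) * (5 * φ x / s * (K * w t x)) := by field_simp
      linarith
    have hsum : ∑ i, ∫ x, p x * (w t x * wxx t x i) ≤ - 2 * (∑ i, (1/2) * ∫ x, p x * (wx t x i)^2) + 5 * K^2 / (2 * s) * ∫ x, φ x * w t x := by
      have h1 := Finset.sum_le_sum (fun i (_ : i ∈ Finset.univ) => hb i)
      rw [Finset.sum_add_distrib] at h1
      simp only [Finset.sum_const, Finset.card_univ, Fintype.card_fin, nsmul_eq_mul, Finset.sum_neg_distrib] at h1
      have h2 : (d:ℝ) * (5 * K / (2 * s) * ∫ x, φ x * w t x) ≤ K * (5 * K / (2 * s) * ∫ x, φ x * w t x) :=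
        mul_le_mul_of_nonneg_right hC.hd (by positivity)
      have h3 : K * (5 * K / (2 * s) * ∫ x, φ x * w t x) = 5 * K^2 / (2 * s) * ∫ x, φ x * w t x := by ring
      rw [← Finset.mul_sum]
      linarith
    have hPb : ∫ x, p x * (w t x * P t x) ≤ K^2 / s * ∫ x, φ x * w t x := by
      refine int_le_m (hp.intg ((hC.rw.c2 ht).c0.mul (slice_cont hC.cP ht))) iphi (hC.rw.c2 ht).c0 (hC.w0 t ht) (hC.w1 t ht) ?_
      intro x
      have h1 := le_of_abs_le (hC.hP t ht x)
      have hw := hC.w0 t ht x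
      have hw1 := hC.w1 t ht x
      have h2 : w t x * P t x ≤ K * (K * w t x) := by
        calc w t x * P t x ≤ w t x * (K * w t x) := mul_le_mul_of_nonneg_left h1 hw
          _ ≤ K * (K * w t x) := mul_le_mul_of_nonneg_right hw1 (by positivity)
      have h3 : p x * (w t x * P t x) ≤ p x * (K * (K * w t x)) := mul_le_mul_of_nonneg_left h2 (p0 x)
      have h4 : p x * (K * (K * w t x)) ≤ φ x * (K * (K * w t x)) := mul_le_mul_of_nonneg_right (pphi x) (by positivity)
      have h5 : K^2 ≤ K^2 / s := by rw [le_div_iff₀ hs]; nlinarith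
      have h6 : K^2 * (φ x * w t x) ≤ K^2 / s * (φ x * w t x) := mul_le_mul_of_nonneg_right h5 (mul_nonneg ((p0 x).trans (pphi x)) hw)
      nlinarith
    have hnu : ∫ x, p x * (w t x * nu t x) ≤ K * ∫ x, p x * nu t x := by
      rw [← integral_const_mul]
      apply integral_mono (hp.intg ((hC.rw.c2 ht).c0.mul (slice_cont hC.cnu ht))) ((hp.intg (slice_cont hC.cnu ht)).const_mul K)
      intro x
      have := mul_le_mul_of_nonneg_right (hC.w1 t ht x) (mul_nonneg (p0 x) (hC.nu0 t ht x))
      simp only [Pi.mul_apply]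
      linarith
    have h7 : 4 * K ^ 2 / s * (∫ x, φ x * w t x) = 5 * K^2 / (2 * s) * (∫ x, φ x * w t x) + K^2 / s * (∫ x, φ x * w t x)
       + K ^ 2 / (2 * s) * (∫ x, φ x * w t x) := by field_simp; ring
    have h8 : 0 ≤ K ^ 2 / (2 * s) * (∫ x, φ x * w t x) := by positivity
    linarith

lemma quad_ineq {a X q Y : ℝ} (hq : 0 ≤ q) (hY : 0 ≤ Y) (h : X ^ 2 ≤ q * Y) : -(q * a ^ 2) / 2 - a * X ≤ Y / 2 := by
  rcases hq.eq_or_lt with h0 | h0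
  · subst h0
    have : X = 0 := by nlinarith [sq_nonneg X]
    subst this
    linarith
  · have : 0 ≤ q * (q * a ^ 2 + 2 * a * X + Y) := by nlinarith [sq_nonneg (q * a + X)]
    have := nonneg_of_mul_nonneg_right this h0
    linarith

variable {χ : EuclideanSpace ℝ (Fin d) → ℝ} {χ1 χ2 : EuclideanSpace ℝ (Fin d) → Fin d → ℝ}

lemma Core.l3 (hC : Core τ K c w wt wx wxx z zt zx zxx nu Gu P) (hW : WP s r φ p p1 p2 χ χ1 χ2)
    (hs : 0 < s) {t : ℝ} (ht : t ∈ Set.Ioo 0 τ) (hst : s / 2 ≤ t) :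
    ∃ E', HasDerivAt (fun t => (∑ i, (1/2) * ∫ x, p x * (wx t x i)^2) - ∫ x, p x * Gu t x) E' t ∧
    E' ≤ K ^ 3 / 2 * (∫ x, φ x * w t x) + 4 * K / s * (∑ i, (1/2) * ∫ x, χ x * (wx t x i)^2)
      + K / s * ∫ x, p x * nu t x := by
  have K1 := hC.K1
  have hp := hW.tp
  have c2 := hC.rw.c2 ht
  have ct := slice_cont hC.rw.ckt ht
  have czt := slice_cont hC.rz.ckt ht
  have cnu := slice_cont hC.cnu ht
  have hG : HasDerivAt (fun t => ∫ x, p x * Gu t x) (∫ x, p x * (nu t x * (wt t x + zt t x))) t :=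
    deriv_int_test (r := r) (fun t ht x => (hC.dG t ht x).const_mul (p x))
      ((prod_snd_cont hp.c0 _).mul hC.cG) ((prod_snd_cont hp.c0 _).mul (hC.cnu.mul (hC.rw.ckt.add hC.rz.ckt)))
      (fun t ht x hx => by simp [hp.z0 x hx]) (fun t ht x hx => by simp [hp.z0 x hx]) ht
  have hD := HasDerivAt.fun_sum (u := Finset.univ) (fun i _ => deriv_dirichlet hp hC.rw i ht)
  refine ⟨_, hD.fun_sub hG, ?_⟩
  have ia : ∀ i ∈ Finset.univ, Integrable (fun x => wt t x * (p1 x i * wx t x i + p x * wxx t x i)) := by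
    intro i _
    have h1 : Integrable (fun x => p1 x i * (wt t x * wx t x i)) := hp.intg1 i (ct.mul (c2.c1 i))
    have h2 : Integrable (fun x => p x * (wt t x * wxx t x i)) := hp.intg (ct.mul (c2.c2 i))
    refine (h1.add h2).congr (Filter.Eventually.of_forall fun x => ?_)
    simp only [Pi.add_apply]; ring
  have ib : Integrable (fun x => p x * (nu t x * (wt t x + zt t x))) := hp.intg (cnu.mul (ct.add czt))
  have ic : Integrable (fun x => φ x * w t x) := by
    apply hW.iphi.mul_bdd (c := K) c2.c0.aestronglyMeasurable
    exact Filter.Eventually.of_forall fun x => by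
      rw [Real.norm_eq_abs, abs_of_nonneg (hC.w0 t ht x)]; exact hC.w1 t ht x
  have id' : ∀ i ∈ Finset.univ, Integrable (fun x => χ x * (wx t x i)^2) := fun i _ => hW.tc.intg ((c2.c1 i).pow 2)
  have ie : Integrable (fun x => p x * nu t x) := hp.intg cnu
  have iA : Integrable (fun x => -∑ i, wt t x * (p1 x i * wx t x i + p x * wxx t x i)) := (integrable_finsetSum _ ia).neg
  have iD : Integrable (fun x => ∑ i, χ x * (wx t x i)^2) := integrable_finsetSum _ id'
  have e1 : (∑ i, -∫ x, wt t x * (p1 x i * wx t x i + p x * wxx t x i)) - ∫ x, p x * (nu t x * (wt t x + zt t x))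
     = ∫ x, (-∑ i, wt t x * (p1 x i * wx t x i + p x * wxx t x i)) - p x * (nu t x * (wt t x + zt t x)) := by
    rw [integral_sub iA ib, integral_neg, integral_finsetSum _ ia, Finset.sum_neg_distrib]
  have e2 : K ^ 3 / 2 * (∫ x, φ x * w t x) + 4 * K / s * (∑ i, (1/2) * ∫ x, χ x * (wx t x i)^2)
      + K / s * ∫ x, p x * nu t x = ∫ x, (K ^ 3 / 2 * (φ x * w t x) + 2 * K / s * (∑ i, χ x * (wx t x i)^2))
        + K / s * (p x * nu t x) := by
    have iCD : Integrable (fun x => K ^ 3 / 2 * (φ x * w t x) + 2 * K / s * (∑ i, χ x * (wx t x i)^2)) := (ic.const_mul _).add (iD.const_mul _)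
    rw [integral_add iCD (ie.const_mul _), integral_add (ic.const_mul _) (iD.const_mul _), integral_const_mul, integral_const_mul, integral_const_mul,
      integral_finsetSum _ id', ← Finset.mul_sum]
    ring
  rw [e1, e2]
  apply integral_mono (iA.sub ib) (((ic.const_mul _).add (iD.const_mul _)).add (ie.const_mul _))
  intro x
  simp only [Pi.sub_apply, Pi.add_apply]
  have hpde := hC.pde t ht x
  have hw := hC.w0 t ht x
  have hw1 := hC.w1 t ht x
  have hp0 := hW.p0 x
  have hχ0 : 0 ≤ χ x := hp0.trans (hW.pc x)
  have hφ : p x ≤ φ x := (hW.pc x).trans (hW.cp x)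
  have hsum : ∑ i, wt t x * (p1 x i * wx t x i + p x * wxx t x i) = wt t x * (∑ i, p1 x i * wx t x i) + wt t x * p x * (∑ i, wxx t x i) := by
    rw [Finset.mul_sum, Finset.mul_sum, ← Finset.sum_add_distrib]
    exact Finset.sum_congr rfl fun i _ => by ring
  set X := ∑ i, p1 x i * wx t x i with hX
  have hX2 : X ^ 2 ≤ p x * (4 * K / s * ∑ i, χ x * (wx t x i)^2) := by
    have h1 := sq_sum_le_card_mul_sum_sq (s := Finset.univ) (f := fun i => p1 x i * wx t x i)
    simp only [Finset.card_univ, Fintype.card_fin] at h1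
    have h2 : ∑ i, (p1 x i * wx t x i) ^ 2 ≤ ∑ i, 4 / s * (p x * χ x) * (wx t x i)^2 := by
      apply Finset.sum_le_sum
      intro i _
      rw [mul_pow]
      exact mul_le_mul_of_nonneg_right (hW.b11 x i) (sq_nonneg _)
    have h3 : (d:ℝ) * ∑ i, (p1 x i * wx t x i) ^ 2 ≤ K * ∑ i, (p1 x i * wx t x i) ^ 2 :=
      mul_le_mul_of_nonneg_right hC.hd (Finset.sum_nonneg fun i _ => sq_nonneg _)
    have h4 := mul_le_mul_of_nonneg_left h2 (by linarith : 0 ≤ K)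
    refine (h1.trans h3).trans (h4.trans (le_of_eq ?_))
    rw [← Finset.mul_sum, ← Finset.mul_sum]
    ring
  have hY0 : 0 ≤ 4 * K / s * ∑ i, χ x * (wx t x i)^2 :=
    mul_nonneg (by positivity) (Finset.sum_nonneg fun i _ => mul_nonneg hχ0 (sq_nonneg _))
  have hq := quad_ineq (a := wt t x) hp0 hY0 hX2
  have hP2 : (P t x)^2 ≤ K^3 * w t x := by
    have h1 : (P t x)^2 ≤ (K * w t x)^2 := sq_le_sq' (neg_le_of_abs_le (hC.hP t ht x)) (le_of_abs_le (hC.hP t ht x))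
    have h2 : w t x * w t x ≤ K * w t x := mul_le_mul_of_nonneg_right hw1 hw
    calc (P t x)^2 ≤ K^2 * (w t x * w t x) := by linarith
      _ ≤ K^2 * (K * w t x) := mul_le_mul_of_nonneg_left h2 (by positivity)
      _ = _ := by ring
  have hP3 : p x * (wt t x * P t x) ≤ p x * (wt t x)^2 / 2 + p x * (P t x)^2/2 := by nlinarith [mul_nonneg hp0 (sq_nonneg (wt t x - P t x))]
  have hP4 : p x * (P t x)^2 ≤ K^3 * (φ x * w t x) := by
    calc p x * (P t x)^2 ≤ p x * (K^3 * w t x) := mul_le_mul_of_nonneg_left hP2 hp0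
      _ ≤ φ x * (K^3 * w t x) := mul_le_mul_of_nonneg_right hφ (by positivity)
      _ = _ := by ring
  have hz : -(zt t x) ≤ K / s := by
    refine (neg_le_abs _).trans ((hC.bzt t ht x).trans ?_)
    exact div_le_div_of_nonneg_left (by linarith) hs (by linarith)
  have hz2 := mul_le_mul_of_nonneg_left hz (mul_nonneg hp0 (hC.nu0 t ht x))
  have hY2 : 4 * K / s * (∑ i, χ x * (wx t x i)^2) = 2 * (2 * K / s * ∑ i, χ x * (wx t x i)^2) := by ring
  rw [hsum]
  have hwxx : ∑ i, wxx t x i = wt t x - P t x - nu t x := by linarith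
  rw [hwxx]
  nlinarith
lemma Core.l4 (hC : Core τ K c w wt wx wxx z zt zx zxx nu Gu P) (hW : WP s r φ p p1 p2 χ χ1 χ2)
    (hs : 0 < s) (hs1 : s ≤ 1) {t : ℝ} (ht : t ∈ Set.Ioo 0 τ) (hst : s / 2 ≤ t) :
    ∃ Y', HasDerivAt (fun t => ∫ x, p x * (w t x * (2 * (c - z t x) - w t x) / 2)) Y' t ∧
    Y' ≤ 2 * (∑ i, (1/2) * ∫ x, p x * (wx t x i)^2) + 10 * K ^ 2 / s * (∫ x, φ x * w t x) := by
  have K1 := hC.K1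
  have hp := hW.tp
  have c2 := hC.rw.c2 ht
  have cz2 := hC.rz.c2 ht
  have ct := slice_cont hC.rw.ckt ht
  have czt := slice_cont hC.rz.ckt ht
  have cnu := slice_cont hC.cnu ht
  have hst' : s ≤ 2 * t := by linarith
  have hφ0 : ∀ x, 0 ≤ φ x := fun x => (hW.p0 x).trans ((hW.pc x).trans (hW.cp x))
  have hpφ : ∀ x, p x ≤ φ x := fun x => (hW.pc x).trans (hW.cp x)
  have hm0 : 0 ≤ ∫ x, φ x * w t x := integral_nonneg fun x => mul_nonneg (hφ0 x) (hC.w0 t ht x)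
  refine ⟨∫ x, p x * ((c - z t x - w t x) * wt t x - w t x * zt t x), ?_, ?_⟩
  · have hcz : ContinuousOn (fun q : ℝ × EuclideanSpace ℝ (Fin d) => c - z q.1 q.2) (Set.Ioo 0 τ ×ˢ Set.univ) :=
      continuousOn_const.sub hC.rz.ck
    refine deriv_int_test (r := r) (h := fun t x => p x * (w t x * (2 * (c - z t x) - w t x) / 2))
      (ht := fun t x => p x * ((c - z t x - w t x) * wt t x - w t x * zt t x)) (fun t ht x => ?_)
      ((prod_snd_cont hp.c0 _).mul ((hC.rw.ck.mul ((continuousOn_const.mul hcz).sub hC.rw.ck)).div_const 2))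
      ((prod_snd_cont hp.c0 _).mul (((hcz.sub hC.rw.ck).mul hC.rw.ckt).sub (hC.rw.ck.mul hC.rz.ckt)))
      (fun t ht x hx => by simp [hp.z0 x hx]) (fun t ht x hx => by simp [hp.z0 x hx]) ht
    have h1 := hC.rw.dt t ht x
    have h2 := (((hC.rz.dt t ht x).const_sub c).const_mul 2).fun_sub h1
    have := ((h1.fun_mul h2).div_const 2).const_mul (p x)
    exact this.congr_deriv (by ring)
  · have iA : Integrable (fun x => p x * ((c - z t x - w t x) * wt t x)) :=
      hp.intg (((continuous_const.sub cz2.c0).sub c2.c0).mul ct)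
    have iB : Integrable (fun x => p x * (w t x * zt t x)) := hp.intg (c2.c0.mul czt)
    have e0 : ∫ x, p x * ((c - z t x - w t x) * wt t x - w t x * zt t x) =
        (∫ x, p x * ((c - z t x - w t x) * wt t x)) - ∫ x, p x * (w t x * zt t x) := by
      rw [← integral_sub iA iB]; congr 1; funext x; ring
    rw [e0, hC.expand hp ht (a := fun x => c - z t x - w t x) ((continuous_const.sub cz2.c0).sub c2.c0)]
    have hb : ∀ i, ∫ x, p x * ((c - z t x - w t x) * wxx t x i) ≤ (∫ x, p x * (wx t x i)^2) + 8 * K / s * ∫ x, φ x * w t x := by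
      intro i
      rw [hp.i4 c2 cz2 c i]
      refine add_le_add_right ?_ _
      refine int_le_m ?_ hW.iphi c2.c0 (hC.w0 t ht) (hC.w1 t ht) ?_
      · have j1 : Integrable (fun x => p2 x i * (w t x * (c - z t x - w t x / 2))) :=
          hp.intg2 i (c2.c0.mul ((continuous_const.sub cz2.c0).sub (c2.c0.div_const 2)))
        have j2 : Integrable (fun x => p1 x i * (w t x * (2 * zx t x i))) := hp.intg1 i (c2.c0.mul (continuous_const.mul (cz2.c1 i)))
        have j3 : Integrable (fun x => p x * (w t x * zxx t x i)) := hp.intg (c2.c0.mul (cz2.c2 i))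
        refine ((j1.sub j2).sub j3).congr (Filter.Eventually.of_forall fun x => ?_)
        simp only [Pi.sub_apply]; ring
      intro x
      have hw := hC.w0 t ht x
      have hφ := hφ0 x
      have a1 : p2 x i * (c - z t x - w t x / 2) ≤ 5 * φ x / s * K := by
        refine (le_abs_self _).trans ?_
        rw [abs_mul]
        refine mul_le_mul (hW.b2 x i) ?_ (abs_nonneg _) (by positivity)
        have b1 := abs_le.1 (hC.cz t ht x)
        have b2 := abs_le.1 (hC.cv t ht x)
        rw [abs_le]; constructor <;> linarith [b1.1, b1.2, b2.1, b2.2]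
      have a2 : -(p1 x i * zx t x i) ≤ φ x * K / s := by
        refine (neg_le_abs _).trans ?_
        rw [abs_mul]
        have : |zx t x i| ≤ K / √s := (hC.bzx t ht x i).trans
          (div_le_div_of_nonneg_left (by linarith) (Real.sqrt_pos.2 hs) (Real.sqrt_le_sqrt hst'))
        refine (mul_le_mul (hW.b1 x i) this (abs_nonneg _) (by positivity)).trans (le_of_eq ?_)
        rw [div_mul_div_comm, Real.mul_self_sqrt hs.le]
      have a3 : -(p x * zxx t x i) ≤ φ x * K / s := by
        refine (neg_le_abs _).trans ?_
        rw [abs_mul, abs_of_nonneg (hW.p0 x)]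
        have : |zxx t x i| ≤ K / s := (hC.bzxx t ht x i).trans (div_le_div_of_nonneg_left (by linarith) hs hst')
        refine (mul_le_mul (hpφ x) this (abs_nonneg _) hφ).trans (le_of_eq ?_)
        ring
      have a4 : p2 x i * (c - z t x - w t x / 2) - 2 * (p1 x i * zx t x i) - p x * zxx t x i ≤ 8 * K / s * φ x := by
        have : 8 * K / s * φ x = 5 * φ x / s * K + 2 * (φ x * K / s) + φ x * K / s := by ring
        linarith
      calc _ ≤ w t x * (8 * K / s * φ x) := mul_le_mul_of_nonneg_left a4 hw
        _ = _ := by ring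
    have hsum : ∑ i, ∫ x, p x * ((c - z t x - w t x) * wxx t x i) ≤ 2 * (∑ i, (1/2) * ∫ x, p x * (wx t x i)^2) + 8 * K^2 / s * ∫ x, φ x * w t x := by
      have h1 := Finset.sum_le_sum (fun i (_ : i ∈ Finset.univ) => hb i)
      rw [Finset.sum_add_distrib] at h1
      simp only [Finset.sum_const, Finset.card_univ, Fintype.card_fin, nsmul_eq_mul] at h1
      have h2 : (d:ℝ) * (8 * K / s * ∫ x, φ x * w t x) ≤ K * (8 * K / s * ∫ x, φ x * w t x) :=
        mul_le_mul_of_nonneg_right hC.hd (by positivity)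
      have h3 : K * (8 * K / s * ∫ x, φ x * w t x) = 8 * K^2 / s * ∫ x, φ x * w t x := by ring
      rw [← Finset.mul_sum]
      linarith
    have hPb : ∫ x, p x * ((c - z t x - w t x) * P t x) ≤ K^2 / s * ∫ x, φ x * w t x := by
      refine int_le_m (hp.intg (((continuous_const.sub cz2.c0).sub c2.c0).mul (slice_cont hC.cP ht))) hW.iphi c2.c0 (hC.w0 t ht) (hC.w1 t ht) ?_
      intro x
      have hw := hC.w0 t ht x
      have h2 : (c - z t x - w t x) * P t x ≤ K * (K * w t x) := by
        refine (le_abs_self _).trans ?_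
        rw [abs_mul]
        exact mul_le_mul (hC.cv t ht x) (hC.hP t ht x) (abs_nonneg _) (by linarith)
      have h3 : p x * ((c - z t x - w t x) * P t x) ≤ p x * (K * (K * w t x)) := mul_le_mul_of_nonneg_left h2 (hW.p0 x)
      have h4 : p x * (K * (K * w t x)) ≤ φ x * (K * (K * w t x)) := mul_le_mul_of_nonneg_right (hpφ x) (by positivity)
      have h5 : K^2 ≤ K^2 / s := by rw [le_div_iff₀ hs]; nlinarith
      have h6 : K^2 * (φ x * w t x) ≤ K^2 / s * (φ x * w t x) := mul_le_mul_of_nonneg_right h5 (mul_nonneg (hφ0 x) hw)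
      nlinarith
    have hnu : ∫ x, p x * ((c - z t x - w t x) * nu t x) ≤ 0 :=
      integral_nonpos fun x => mul_nonpos_of_nonneg_of_nonpos (hW.p0 x) (hC.vnu t ht x)
    have hzt : -∫ x, p x * (w t x * zt t x) ≤ K^2 / s * ∫ x, φ x * w t x := by
      rw [← integral_neg]
      refine int_le_m iB.neg hW.iphi c2.c0 (hC.w0 t ht) (hC.w1 t ht) ?_
      intro x
      have hw := hC.w0 t ht x
      have hz : -(zt t x) ≤ K / s := by
        refine (neg_le_abs _).trans ((hC.bzt t ht x).trans ?_)
        exact div_le_div_of_nonneg_left (by linarith) hs (by linarith)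
      have h1 : p x * (w t x * -(zt t x)) ≤ φ x * (w t x * (K / s)) := by
        calc p x * (w t x * -(zt t x)) ≤ p x * (w t x * (K / s)) :=
              mul_le_mul_of_nonneg_left (mul_le_mul_of_nonneg_left hz hw) (hW.p0 x)
          _ ≤ _ := mul_le_mul_of_nonneg_right (hpφ x) (by positivity)
      have h5 : K / s ≤ K^2 / s := by gcongr; nlinarith
      have h6 := mul_le_mul_of_nonneg_right h5 (mul_nonneg (hφ0 x) hw)
      nlinarith
    have h7 : 10 * K ^ 2 / s * (∫ x, φ x * w t x) = 8 * K^2 / s * (∫ x, φ x * w t x) + K^2 / s * (∫ x, φ x * w t x)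
       + K ^ 2 / s * (∫ x, φ x * w t x) := by ring
    linarith
end step

lemma deriv_mono {f f' : ℝ → ℝ} {a b : ℝ} (hab : a ≤ b) (hd : ∀ t ∈ Set.Icc a b, HasDerivAt f (f' t) t)
    (h0 : ∀ t ∈ Set.Icc a b, 0 ≤ f' t) : f a ≤ f b := by
  have := monotoneOn_of_hasDerivWithinAt_nonneg (f := f) (f' := f') (convex_Icc a b)
    (fun t ht => (hd t ht).continuousAt.continuousWithinAt)
    (fun t ht => (hd t (interior_subset ht)).hasDerivWithinAt) (fun t ht => h0 t (interior_subset ht))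
  exact this (Set.left_mem_Icc.2 hab) (Set.right_mem_Icc.2 hab) hab

lemma step_abs {s b K μ M : ℝ} (hs : 0 < s) (hs1 : s ≤ 1) (hsb : s ≤ b) (hK : 1 ≤ K) (hb : 2700 * K ^ 3 * (b - s) ≤ s)
    (hμ : 0 ≤ μ)
    {mp mp' mc mc' Np Nc Dp Dc Ac Ac' G E' Y Y' JNp JNc JDc : ℝ → ℝ}
    (dmp : ∀ t ∈ Set.Icc (s/2) b, HasDerivAt mp (mp' t) t)
    (dmc : ∀ t ∈ Set.Icc (s/2) b, HasDerivAt mc (mc' t) t)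
    (dAc : ∀ t ∈ Set.Icc (s/2) b, HasDerivAt Ac (Ac' t) t)
    (dE : ∀ t ∈ Set.Icc (s/2) b, HasDerivAt (fun t => Dp t - G t) (E' t) t)
    (dY : ∀ t ∈ Set.Icc (s/2) b, HasDerivAt Y (Y' t) t)
    (dJNp : ∀ t ∈ Set.Icc (s/2) b, HasDerivAt JNp (Np t) t)
    (dJNc : ∀ t ∈ Set.Icc (s/2) b, HasDerivAt JNc (Nc t) t)
    (dJDc : ∀ t ∈ Set.Icc (s/2) b, HasDerivAt JDc (Dc t) t)
    (hmp : ∀ t ∈ Set.Icc (s/2) b, Np t - 6 * K / s * μ ≤ mp' t)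
    (hmc : ∀ t ∈ Set.Icc (s/2) b, Nc t - 6 * K / s * μ ≤ mc' t)
    (hAc : ∀ t ∈ Set.Icc (s/2) b, Ac' t ≤ - 2 * Dc t + 4 * K ^ 2 / s * μ + K * Nc t)
    (hE : ∀ t ∈ Set.Icc (s/2) b, E' t ≤ K ^ 3 / 2 * μ + 4 * K / s * Dc t + K / s * Np t)
    (hY : ∀ t ∈ Set.Icc (s/2) b, Y' t ≤ 2 * Dp t + 10 * K ^ 2 / s * μ)
    (p0 : ∀ t ∈ Set.Icc (s/2) b, 0 ≤ mp t) (c0 : ∀ t ∈ Set.Icc (s/2) b, 0 ≤ mc t) (c1 : ∀ t ∈ Set.Icc (s/2) b, mc t ≤ μ)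
    (A0 : ∀ t ∈ Set.Icc (s/2) b, 0 ≤ Ac t) (A1 : ∀ t ∈ Set.Icc (s/2) b, Ac t ≤ K * μ)
    (N0 : ∀ t ∈ Set.Icc (s/2) b, 0 ≤ Np t) (N1 : ∀ t ∈ Set.Icc (s/2) b, Np t ≤ Nc t)
    (D1 : ∀ t ∈ Set.Icc (s/2) b, Dp t ≤ Dc t) (D0 : ∀ t ∈ Set.Icc (s/2) b, 0 ≤ Dc t)
    (G0 : ∀ t ∈ Set.Icc (s/2) b, 0 ≤ G t) (G1 : ∀ t ∈ Set.Icc (s/2) b, G t ≤ Np t / 8)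
    (Y0 : mp b / 2 ≤ Y b) (Y1 : Y s ≤ K * M) :
    mp b ≤ 4 * K * M + μ / 2 := by
  have hK2 : 1 ≤ K ^ 2 := one_le_pow₀ hK
  have hK3 : 1 ≤ K ^ 3 := one_le_pow₀ hK
  have hbs : b - s ≤ s / 2 := by nlinarith
  have hab : s / 2 ≤ b := by linarith
  have hba : b - s / 2 ≤ 3 / 2 * s := by linarith
  have hKK2 : K ≤ K ^ 2 := by nlinarith
  have hKK3 : K ^ 2 ≤ K ^ 3 := by nlinarith
  -- (1)
  have s1 : ∀ t1 ∈ Set.Icc (s/2) b, JNp b - JNp t1 ≤ mp b + 6 * K / s * μ * (b - t1) := by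
    intro t1 h1
    have := deriv_mono (f := fun t => mp t + 6 * K / s * μ * t - JNp t) (a := t1) (b := b) h1.2
      (fun t ht => ((dmp t ⟨h1.1.trans ht.1, ht.2⟩).fun_add ((hasDerivAt_id t).const_mul (6 * K / s * μ))).fun_sub (dJNp t ⟨h1.1.trans ht.1, ht.2⟩))
      (fun t ht => by have := hmp t ⟨h1.1.trans ht.1, ht.2⟩; simp only [mul_one]; linarith)
    have := p0 t1 h1
    linarith
  have s1t : ∀ t ∈ Set.Icc (s/2) b, JNc t - JNc (s/2) ≤ 10 * K * μ := by
    intro t h1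
    have := deriv_mono (f := fun t => mc t + 6 * K / s * μ * t - JNc t) (a := s/2) (b := t) h1.1
      (fun t ht => ((dmc t ⟨ht.1, ht.2.trans h1.2⟩).fun_add ((hasDerivAt_id t).const_mul (6 * K / s * μ))).fun_sub (dJNc t ⟨ht.1, ht.2.trans h1.2⟩))
      (fun t ht => by have := hmc t ⟨ht.1, ht.2.trans h1.2⟩; simp only [mul_one]; linarith)
    have h2 := c0 (s/2) ⟨le_rfl, hab⟩
    have h3 := c1 t h1
    have h4 : 6 * K / s * μ * (t - s/2) ≤ 6 * K / s * μ * (3 / 2 * s) :=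
      mul_le_mul_of_nonneg_left (by linarith [h1.2]) (by positivity)
    have h5 : 6 * K / s * μ * (3 / 2 * s) = 9 * K * μ := by field_simp; ring
    have h6 : μ ≤ K * μ := by nlinarith
    linarith
  -- (2)
  have s2 : ∀ t ∈ Set.Icc (s/2) b, JDc t - JDc (s/2) ≤ 9 * K ^ 2 * μ := by
    intro t h1
    have := deriv_mono (f := fun t => K * JNc t + 4 * K ^ 2 / s * μ * t - 2 * JDc t - Ac t) (a := s/2) (b := t) h1.1
      (fun t ht => ((((dJNc t ⟨ht.1, ht.2.trans h1.2⟩).const_mul K).fun_add ((hasDerivAt_id t).const_mul (4 * K ^ 2 / s * μ))).fun_sub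
        ((dJDc t ⟨ht.1, ht.2.trans h1.2⟩).const_mul 2)).fun_sub (dAc t ⟨ht.1, ht.2.trans h1.2⟩))
      (fun t ht => by have := hAc t ⟨ht.1, ht.2.trans h1.2⟩; simp only [mul_one]; linarith)
    have h2 := A0 t h1
    have h3 := A1 (s/2) ⟨le_rfl, hab⟩
    have h4 : 4 * K^2 / s * μ * (t - s/2) ≤ 4 * K^2 / s * μ * (3 / 2 * s) :=
      mul_le_mul_of_nonneg_left (by linarith [h1.2]) (by positivity)
    have h5 : 4 * K^2 / s * μ * (3 / 2 * s) = 6 * K^2 * μ := by field_simp; ring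
    have h6 : K * μ ≤ K ^ 2 * μ := mul_le_mul_of_nonneg_right hKK2 hμ
    have h7 := mul_le_mul_of_nonneg_left (s1t t h1) (by linarith : 0 ≤ K)
    nlinarith
  have s3 : ∀ t ∈ Set.Icc s b, Dp t - G t ≤ 160 * K ^ 3 / s * μ := by
    intro t h1
    have h1' : t ∈ Set.Icc (s/2) b := ⟨by linarith [h1.1], h1.2⟩
    have key := deriv_mono (f := fun t => 7 * K * JDc t + 3 / 4 * s * K ^ 3 * μ * t + 3 / 2 * K * JNc t - (t - s/2) * (Dp t - G t)) (a := s/2) (b := t) h1'.1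
      (fun t ht => ((((dJDc t ⟨ht.1, ht.2.trans h1.2⟩).const_mul (7 * K)).fun_add ((hasDerivAt_id t).const_mul (3 / 4 * s * K ^ 3 * μ))).fun_add
        ((dJNc t ⟨ht.1, ht.2.trans h1.2⟩).const_mul (3/2 * K))).fun_sub (((hasDerivAt_id t).sub_const (s/2)).fun_mul (dE t ⟨ht.1, ht.2.trans h1.2⟩)))
      (fun t ht => by
        have hm : t ∈ Set.Icc (s/2) b := ⟨ht.1, ht.2.trans h1.2⟩
        have e1 := hE t hm
        have e2 := G0 t hm
        have e3 := D1 t hm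
        have e4 := D0 t hm
        have e5 := N0 t hm
        have e6 := N1 t hm
        have e7 : (t - s/2) * E' t ≤ (t - s/2) * (K ^ 3 / 2 * μ + 4 * K / s * Dc t + K / s * Np t) :=
          mul_le_mul_of_nonneg_left e1 (by linarith [ht.1])
        have e8 : (t - s/2) * (K ^ 3 / 2 * μ + 4 * K / s * Dc t + K / s * Np t) ≤ (3/2 * s) * (K ^ 3 / 2 * μ + 4 * K / s * Dc t + K / s * Np t) :=
          mul_le_mul_of_nonneg_right (by linarith [hm.2]) (by positivity)
        have e9 : (3/2 * s) * (K ^ 3 / 2 * μ + 4 * K / s * Dc t + K / s * Np t) = 3/4 * s * K^3 * μ + 6 * K * Dc t + 3/2 * K * Np t := by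
          field_simp; ring
        have e10 : Dc t ≤ K * Dc t := by nlinarith
        have e11 : K * Np t ≤ K * Nc t := mul_le_mul_of_nonneg_left e6 (by linarith)
        simp only [id, mul_one, one_mul]
        linarith)
    have a1 := mul_le_mul_of_nonneg_left (s2 t h1') (by linarith : 0 ≤ 7 * K)
    have a2 := mul_le_mul_of_nonneg_left (s1t t h1') (by linarith : 0 ≤ 3/2 * K)
    have a3 : 3 / 4 * s * K ^ 3 * μ * (t - s/2) ≤ 3 / 4 * s * K ^ 3 * μ * (3/2) :=
      mul_le_mul_of_nonneg_left (by linarith [h1.2]) (by positivity)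
    have a4 : 3 / 4 * s * K ^ 3 * μ * (3/2) ≤ 2 * (K ^ 3 * μ) := by
      have : 0 ≤ K ^ 3 * μ := by positivity
      nlinarith
    have a5 : K ^ 2 * μ ≤ K ^ 3 * μ := mul_le_mul_of_nonneg_right hKK3 hμ
    have a6 : (t - s/2) * (Dp t - G t) ≤ 80 * K ^ 3 * μ := by
      simp only [sub_self, zero_mul] at key
      nlinarith
    by_contra hcon
    push Not at hcon
    have hpos : 0 ≤ 160 * K ^ 3 / s * μ := by positivity
    have a7 : s / 2 * (160 * K ^ 3 / s * μ) = 80 * K ^ 3 * μ := by field_simp; ring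
    have a8 : s / 2 * (160 * K ^ 3 / s * μ) < s/2 * (Dp t - G t) := mul_lt_mul_of_pos_left hcon (by linarith)
    have a9 : s / 2 * (Dp t - G t) ≤ (t - s/2) * (Dp t - G t) := mul_le_mul_of_nonneg_right (by linarith [h1.1]) (by linarith)
    linarith
  have s4 := deriv_mono (f := fun t => 330 * K ^ 3 / s * μ * t + 1 / 4 * JNp t - Y t) (a := s) (b := b) hsb
      (fun t ht => (((hasDerivAt_id t).const_mul (330 * K ^ 3 / s * μ)).fun_add
        ((dJNp t ⟨by linarith [ht.1], ht.2⟩).const_mul (1/4))).fun_sub (dY t ⟨by linarith [ht.1], ht.2⟩))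
      (fun t ht => by
        have hm : t ∈ Set.Icc (s/2) b := ⟨by linarith [ht.1], ht.2⟩
        have e1 := hY t hm
        have e2 := s3 t ht
        have e3 := G1 t hm
        have e4 : 10 * K ^ 2 / s * μ ≤ 10 * K ^ 3 / s * μ := by gcongr
        have e5 : 330 * K ^ 3 / s * μ = 2 * (160 * K ^ 3 / s * μ) + 10 * K ^ 3 / s * μ := by ring
        simp only [mul_one]
        linarith)
  have s5 := s1 s ⟨by linarith, hsb⟩
  have f1 : 330 * K ^ 3 / s * μ * (b - s) ≤ 330 / 2700 * μ := by
    have : 330 * K ^ 3 / s * μ * (b - s) = (330 / 2700 * μ / s) * (2700 * K ^ 3 * (b - s)) := by field_simp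
    rw [this]
    have h2 : (330 / 2700 * μ / s) * (2700 * K ^ 3 * (b - s)) ≤ (330 / 2700 * μ / s) * s := mul_le_mul_of_nonneg_left hb (by positivity)
    have h3 : (330 / 2700 * μ / s) * s = 330 / 2700 * μ := by field_simp
    linarith
  have f2 : 6 * K / s * μ * (b - s) ≤ 6 / 2700 * μ := by
    have e0 : 6 * K / s * μ * (b - s) ≤ 6 * K ^ 3 / s * μ * (b - s) := by
      have : 0 ≤ b - s := by linarith
      gcongr
      linarith
    have : 6 * K ^ 3 / s * μ * (b - s) = (6 / 2700 * μ / s) * (2700 * K ^ 3 * (b - s)) := by field_simp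
    rw [this] at e0
    have h2 : (6 / 2700 * μ / s) * (2700 * K ^ 3 * (b - s)) ≤ (6 / 2700 * μ / s) * s := mul_le_mul_of_nonneg_left hb (by positivity)
    have h3 : (6 / 2700 * μ / s) * s = 6 / 2700 * μ := by field_simp
    linarith
  linarith

lemma J_deriv {N : ℝ → ℝ} {τ a : ℝ} (hN : ContinuousOn N (Set.Ioo 0 τ)) (ha : a ∈ Set.Ioo 0 τ) {t : ℝ} (ht : t ∈ Set.Ioo 0 τ) :
    HasDerivAt (fun t => ∫ r in a..t, N r) (N t) t := by
  apply intervalIntegral.integral_hasDerivAt_right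
  · apply ContinuousOn.intervalIntegrable
    exact hN.mono ((Set.ordConnected_Ioo).uIcc_subset ha ht)
  · exact hN.stronglyMeasurableAtFilter isOpen_Ioo t ht
  · exact hN.continuousAt (Ioo_mem_nhds ht.1 ht.2)

section step
variable {d : ℕ} {τ K c : ℝ} {w wt : ℝ → EuclideanSpace ℝ (Fin d) → ℝ}
    {wx wxx : ℝ → EuclideanSpace ℝ (Fin d) → Fin d → ℝ}
    {z zt : ℝ → EuclideanSpace ℝ (Fin d) → ℝ}
    {zx zxx : ℝ → EuclideanSpace ℝ (Fin d) → Fin d → ℝ}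
    {nu Gu P : ℝ → EuclideanSpace ℝ (Fin d) → ℝ}
    {s r : ℝ} {φ p : EuclideanSpace ℝ (Fin d) → ℝ}
    {p1 p2 : EuclideanSpace ℝ (Fin d) → Fin d → ℝ}
    {χ : EuclideanSpace ℝ (Fin d) → ℝ} {χ1 χ2 : EuclideanSpace ℝ (Fin d) → Fin d → ℝ}

lemma Core.step (hC : Core τ K c w wt wx wxx z zt zx zxx nu Gu P) (hW : WP s r φ p p1 p2 χ χ1 χ2)
    (hs : 0 < s) (hs1 : s ≤ 1) {b μ M : ℝ} (hsb : s ≤ b) (hbτ : b < τ) (hb : 2700 * K ^ 3 * (b - s) ≤ s)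
    (hμ : ∀ t ∈ Set.Icc (s/2) b, ∫ x, φ x * w t x ≤ μ) (hM : ∫ x, φ x * w s x ≤ M) :
    ∫ x, p x * w b x ≤ 4 * K * M + μ / 2 := by
  have K1 := hC.K1
  have hsub : ∀ t ∈ Set.Icc (s/2) b, t ∈ Set.Ioo 0 τ := fun t ht => ⟨by linarith [ht.1], by linarith [ht.2]⟩
  have hφ0 : ∀ x, 0 ≤ φ x := fun x => (hW.p0 x).trans ((hW.pc x).trans (hW.cp x))
  have hpφ : ∀ x, p x ≤ φ x := fun x => (hW.pc x).trans (hW.cp x)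
  have hc0 : ∀ x, 0 ≤ χ x := fun x => (hW.p0 x).trans (hW.pc x)
  have hm0 : ∀ t ∈ Set.Ioo 0 τ, 0 ≤ ∫ x, φ x * w t x := fun t ht => integral_nonneg fun x => mul_nonneg (hφ0 x) (hC.w0 t ht x)
  have hsm : s/2 ∈ Set.Icc (s/2) b := ⟨le_rfl, by linarith⟩
  have hss : s ∈ Set.Icc (s/2) b := ⟨by linarith, hsb⟩
  have hbb : b ∈ Set.Icc (s/2) b := ⟨by linarith, le_rfl⟩
  have hμ0 : 0 ≤ μ := (hm0 _ (hsub _ hss)).trans (hμ s hss)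
  have cN : ∀ {p : EuclideanSpace ℝ (Fin d) → ℝ} {p1 p2 : EuclideanSpace ℝ (Fin d) → Fin d → ℝ}, TestF r p p1 p2 →
      ContinuousOn (fun t => ∫ x, p x * nu t x) (Set.Ioo 0 τ) := fun hp =>
    cont_int_test (r := r) ((prod_snd_cont hp.c0 _).mul hC.cnu) (fun t ht x hx => by simp [hp.z0 x hx])
  have cD : ContinuousOn (fun t => ∑ i, (1/2) * ∫ x, χ x * (wx t x i)^2) (Set.Ioo 0 τ) := by
    apply continuousOn_finsetSum
    intro i _
    exact continuousOn_const.mul (cont_int_test (r := r) ((prod_snd_cont hW.tc.c0 _).mul ((hC.rw.ckx i).pow 2))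
      (fun t ht x hx => by simp [hW.tc.z0 x hx]))
  have hL1p := fun t (ht : t ∈ Set.Icc (s/2) b) => hC.l1 hW.tp hs hs1 hW.iphi hW.p0 hpφ hW.b2 (hsub t ht)
  have hL1c := fun t (ht : t ∈ Set.Icc (s/2) b) => hC.l1 hW.tc hs hs1 hW.iphi hc0 hW.cp hW.bc2 (hsub t ht)
  have hL2c := fun t (ht : t ∈ Set.Icc (s/2) b) => hC.l2 hW.tc hs hs1 hW.iphi hc0 hW.cp hW.bc2 (hsub t ht)
  have hL3 := fun t (ht : t ∈ Set.Icc (s/2) b) => hC.l3 hW hs (hsub t ht) ht.1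
  have hL4 := fun t (ht : t ∈ Set.Icc (s/2) b) => hC.l4 hW hs hs1 (hsub t ht) ht.1
  choose! E' hE' hE'2 using hL3
  choose! Y' hY' hY'2 using hL4
  have cw := fun t (ht : t ∈ Set.Icc (s/2) b) => (hC.rw.c2 (hsub t ht)).c0
  have cwx := fun t (ht : t ∈ Set.Icc (s/2) b) => (hC.rw.c2 (hsub t ht)).c1
  have cnu := fun t (ht : t ∈ Set.Icc (s/2) b) => slice_cont hC.cnu (hsub t ht)
  have cz := fun t (ht : t ∈ Set.Icc (s/2) b) => (hC.rz.c2 (hsub t ht)).c0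
  have w0 := fun t (ht : t ∈ Set.Icc (s/2) b) => hC.w0 t (hsub t ht)
  have w1 := fun t (ht : t ∈ Set.Icc (s/2) b) => hC.w1 t (hsub t ht)
  have nu0 := fun t (ht : t ∈ Set.Icc (s/2) b) => hC.nu0 t (hsub t ht)
  refine step_abs (s := s) (b := b) (K := K) (μ := μ) (M := M) hs hs1 hsb K1 hb hμ0
    (mp := fun t => ∫ x, p x * w t x) (mp' := fun t => ∫ x, p x * wt t x)
    (mc := fun t => ∫ x, χ x * w t x) (mc' := fun t => ∫ x, χ x * wt t x)
    (Np := fun t => ∫ x, p x * nu t x) (Nc := fun t => ∫ x, χ x * nu t x)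
    (Dp := fun t => ∑ i, (1/2) * ∫ x, p x * (wx t x i)^2) (Dc := fun t => ∑ i, (1/2) * ∫ x, χ x * (wx t x i)^2)
    (Ac := fun t => ∫ x, χ x * (w t x * w t x / 2)) (Ac' := fun t => ∫ x, χ x * (w t x * wt t x))
    (G := fun t => ∫ x, p x * Gu t x) (E' := E')
    (Y := fun t => ∫ x, p x * (w t x * (2 * (c - z t x) - w t x) / 2)) (Y' := Y')
    (JNp := fun t => ∫ r in (s/2)..t, ∫ x, p x * nu r x)
    (JNc := fun t => ∫ r in (s/2)..t, ∫ x, χ x * nu r x)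
    (JDc := fun t => ∫ r in (s/2)..t, ∑ i, (1/2) * ∫ x, χ x * (wx r x i)^2)
    (fun t ht => (hL1p t ht).1) (fun t ht => (hL1c t ht).1) (fun t ht => (hL2c t ht).1) hE' hY'
    (fun t ht => J_deriv (cN hW.tp) (hsub _ hsm) (hsub t ht)) (fun t ht => J_deriv (cN hW.tc) (hsub _ hsm) (hsub t ht))
    (fun t ht => J_deriv cD (hsub _ hsm) (hsub t ht))
    (fun t ht => ?_) (fun t ht => ?_) (fun t ht => ?_) (fun t ht => ?_) (fun t ht => ?_) (fun t ht => ?_) (fun t ht => ?_) (fun t ht => ?_)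
    (fun t ht => ?_) (fun t ht => ?_) (fun t ht => ?_) (fun t ht => ?_) (fun t ht => ?_) (fun t ht => ?_) (fun t ht => ?_) (fun t ht => ?_) ?_ ?_
  · refine le_trans ?_ (hL1p t ht).2
    have := mul_le_mul_of_nonneg_left (hμ t ht) (by positivity : 0 ≤ 6 * K / s)
    linarith
  · refine le_trans ?_ (hL1c t ht).2
    have := mul_le_mul_of_nonneg_left (hμ t ht) (by positivity : 0 ≤ 6 * K / s)
    linarith
  · refine le_trans (hL2c t ht).2 ?_
    have := mul_le_mul_of_nonneg_left (hμ t ht) (by positivity : 0 ≤ 4 * K ^ 2 / s)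
    linarith
  · refine le_trans (hE'2 t ht) ?_
    have := mul_le_mul_of_nonneg_left (hμ t ht) (by positivity : 0 ≤ K ^ 3 / 2)
    linarith
  · refine le_trans (hY'2 t ht) ?_
    have := mul_le_mul_of_nonneg_left (hμ t ht) (by positivity : 0 ≤ 10 * K ^ 2 / s)
    linarith
  · exact integral_nonneg fun x => mul_nonneg (hW.p0 x) (w0 t ht x)
  · exact integral_nonneg fun x => mul_nonneg (hc0 x) (w0 t ht x)
  · have := int_le_m (A := 1) (hW.tc.intg (cw t ht)) hW.iphi (cw t ht) (w0 t ht) (w1 t ht)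
      (fun x => by rw [one_mul]; exact mul_le_mul_of_nonneg_right (hW.cp x) (w0 t ht x))
    rw [one_mul] at this
    exact this.trans (hμ t ht)
  · exact integral_nonneg fun x => mul_nonneg (hc0 x) (by nlinarith [w0 t ht x])
  · have := int_le_m (A := K) (hW.tc.intg (((cw t ht).mul (cw t ht)).div_const 2)) hW.iphi (cw t ht) (w0 t ht) (w1 t ht)
      (fun x => by
        have h1 := w0 t ht x
        have h2 : w t x * w t x / 2 ≤ K * w t x := by nlinarith [w1 t ht x]
        calc χ x * (w t x * w t x / 2) ≤ χ x * (K * w t x) := mul_le_mul_of_nonneg_left h2 (hc0 x)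
          _ ≤ φ x * (K * w t x) := mul_le_mul_of_nonneg_right (hW.cp x) (by positivity)
          _ = _ := by ring)
    exact this.trans (mul_le_mul_of_nonneg_left (hμ t ht) (by linarith))
  · exact integral_nonneg fun x => mul_nonneg (hW.p0 x) (nu0 t ht x)
  · exact integral_mono (hW.tp.intg (cnu t ht)) (hW.tc.intg (cnu t ht)) fun x => mul_le_mul_of_nonneg_right (hW.pc x) (nu0 t ht x)
  · refine Finset.sum_le_sum fun i _ => mul_le_mul_of_nonneg_left ?_ (by norm_num)
    exact integral_mono (hW.tp.intg ((cwx t ht i).pow 2)) (hW.tc.intg ((cwx t ht i).pow 2)) fun x => mul_le_mul_of_nonneg_right (hW.pc x) (sq_nonneg _)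
  · exact Finset.sum_nonneg fun i _ => mul_nonneg (by norm_num) (integral_nonneg fun x => mul_nonneg (hc0 x) (sq_nonneg _))
  · exact integral_nonneg fun x => mul_nonneg (hW.p0 x) (hC.G0 t (hsub t ht) x)
  · rw [← integral_div]
    apply integral_mono (hW.tp.intg (slice_cont hC.cG (hsub t ht))) ((hW.tp.intg (cnu t ht)).div_const 8)
    intro x
    have := mul_le_mul_of_nonneg_left (hC.G1 t (hsub t ht) x) (hW.p0 x)
    simp only
    linarith
  · rw [← integral_div]
    apply integral_mono ((hW.tp.intg (cw b hbb)).div_const 2)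
      (hW.tp.intg (((cw b hbb).mul ((continuous_const.mul (continuous_const.sub (cz b hbb))).sub (cw b hbb))).div_const 2))
    intro x
    have h1 := mul_le_mul_of_nonneg_left (hC.hY b (hsub b hbb) x) (mul_nonneg (hW.p0 x) (w0 b hbb x))
    simp only [Pi.mul_apply, Pi.sub_apply]
    linarith
  · have := int_le_m (A := K) (hW.tp.intg (((cw s hss).mul ((continuous_const.mul (continuous_const.sub (cz s hss))).sub (cw s hss))).div_const 2))
       hW.iphi (cw s hss) (w0 s hss) (w1 s hss)
      (fun x => by
        have h1 := w0 s hss x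
        have a1 := le_of_abs_le (hC.cz s (hsub s hss) x)
        have a2 := le_of_abs_le (hC.cv s (hsub s hss) x)
        have h2 : w s x * (2 * (c - z s x) - w s x) / 2 ≤ K * w s x := by nlinarith
        calc p x * (w s x * (2 * (c - z s x) - w s x) / 2) ≤ p x * (K * w s x) := mul_le_mul_of_nonneg_left h2 (hW.p0 x)
          _ ≤ φ x * (K * w s x) := mul_le_mul_of_nonneg_right (hpφ x) (by positivity)
          _ = _ := by ring)
    exact this.trans (mul_le_mul_of_nonneg_left hM (by linarith))
end step

section weights
variable {d : ℕ}

lemma C2.comp {f : EuclideanSpace ℝ (Fin d) → ℝ} {f1 f2 : EuclideanSpace ℝ (Fin d) → Fin d → ℝ} (hf : C2 f f1 f2)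
    {h h' h'' : ℝ → ℝ} (e1 : ∀ x, HasDerivAt h (h' (f x)) (f x)) (e2 : ∀ x, HasDerivAt h' (h'' (f x)) (f x))
    (c2 : Continuous fun x => h'' (f x)) :
    C2 (fun x => h (f x)) (fun x i => h' (f x) * f1 x i) (fun x i => h'' (f x) * (f1 x i) ^ 2 + h' (f x) * f2 x i) where
  c0 := continuous_iff_continuousAt.2 fun x => (e1 x).continuousAt.comp hf.c0.continuousAt
  c1 := fun i => (continuous_iff_continuousAt.2 fun x => (e2 x).continuousAt.comp (f := f) hf.c0.continuousAt).mul (hf.c1 i)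
  c2 := fun i => (c2.mul ((hf.c1 i).pow 2)).add
    ((continuous_iff_continuousAt.2 fun x => (e2 x).continuousAt.comp (f := f) hf.c0.continuousAt).mul (hf.c2 i))
  d1 := fun x i => by
    have := e1 x
    exact HasDerivAt.comp (h₂ := h) (h := fun s : ℝ => f (x + s • eb i)) 0 (by simpa using this) (hf.d1 x i)
  d2 := fun x i => by
    have h1 : HasDerivAt (fun s : ℝ => h' (f (x + s • eb i))) (h'' (f x) * f1 x i) 0 :=
      HasDerivAt.comp (h₂ := h') (h := fun s : ℝ => f (x + s • eb i)) 0 (by simpa using e2 x) (hf.d1 x i)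
    have h2 := h1.fun_mul (hf.d2 x i)
    refine h2.congr_deriv ?_
    simp; ring

lemma C2_normsq : C2 (fun x : EuclideanSpace ℝ (Fin d) => ‖x‖ ^ 2) (fun x i => 2 * x i) (fun _ _ => 2) where
  c0 := by fun_prop
  c1 := fun i => by fun_prop
  c2 := fun i => continuous_const
  d1 := fun x i => by
    simp only [norm_sq_line]
    have := (((hasDerivAt_id (0:ℝ)).const_mul (2 * x i)).const_add (‖x‖^2)).fun_add ((hasDerivAt_id (0:ℝ)).fun_pow 2)
    refine HasDerivAt.congr_deriv (HasDerivAt.congr_of_eventuallyEq this (Filter.Eventually.of_forall fun s => ?_)) ?_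
    · simp; ring
    · simp
  d2 := fun x i => by
    have := (((hasDerivAt_id (0:ℝ)).const_add (x i))).const_mul 2
    refine HasDerivAt.congr_deriv (HasDerivAt.congr_of_eventuallyEq this (Filter.Eventually.of_forall fun s => ?_)) ?_
    · simp
    · simp

/-- `√(1+|x|²)` -/
def rho (x : EuclideanSpace ℝ (Fin d)) : ℝ := √(1 + ‖x‖ ^ 2)

lemma rho_sq (x : EuclideanSpace ℝ (Fin d)) : rho x ^ 2 = 1 + ‖x‖ ^ 2 := Real.sq_sqrt (by positivity)
lemma rho_ge_one (x : EuclideanSpace ℝ (Fin d)) : 1 ≤ rho x := Real.one_le_sqrt.2 (by nlinarith [sq_nonneg ‖x‖])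
lemma norm_le_rho (x : EuclideanSpace ℝ (Fin d)) : ‖x‖ ≤ rho x := Real.le_sqrt_of_sq_le (by linarith)
lemma rho_le (x : EuclideanSpace ℝ (Fin d)) : rho x ≤ 1 + ‖x‖ := by
  have := norm_nonneg x
  exact Real.sqrt_le_iff.2 ⟨by linarith, by nlinarith⟩
lemma cont_rho : Continuous (rho : EuclideanSpace ℝ (Fin d) → ℝ) := by unfold rho; fun_prop
lemma coord_le_rho (x : EuclideanSpace ℝ (Fin d)) (i : Fin d) : (x i) ^ 2 ≤ rho x ^ 2 := by
  have h1 := PiLp.norm_apply_le x i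
  rw [Real.norm_eq_abs] at h1
  rw [rho_sq, ← sq_abs]
  nlinarith [abs_nonneg (x i)]

lemma C2_rho : C2 (rho : EuclideanSpace ℝ (Fin d) → ℝ) (fun x i => x i / rho x)
    (fun x i => 1 / rho x - (x i) ^ 2 / rho x ^ 3) := by
  have key := C2.comp (C2_normsq (d := d)) (h := fun y => √(1 + y)) (h' := fun y => 1 / (2 * √(1 + y)))
    (h'' := fun y => - 1 / (4 * √(1 + y) ^ 3))
    (fun x => by
      have h1 : 1 + ‖x‖^2 ≠ 0 := by positivity
      have := ((hasDerivAt_id (‖x‖^2)).const_add 1).sqrt h1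
      simpa using this)
    (fun x => by
      have h1 : 1 + ‖x‖^2 ≠ 0 := by positivity
      have h2 : √(1 + ‖x‖^2) ≠ 0 := by positivity
      have := ((((hasDerivAt_id (‖x‖^2)).const_add 1).sqrt h1).const_mul 2).fun_inv (by simpa using h2)
      refine HasDerivAt.congr_deriv (HasDerivAt.congr_of_eventuallyEq this (Filter.Eventually.of_forall fun s => ?_)) ?_
      · simp
      · simp only [id]; field_simp; norm_num)
    (by
      apply Continuous.div continuous_const (by fun_prop)
      intro x
      have h2 : √(1 + ‖x‖^2) ≠ 0 := by positivity
      positivity)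
  convert key using 3
  · simp only [rho]
  · simp only [rho]; field_simp
  · rename_i x i
    have h0 : √(1 + ‖x‖^2) ≠ 0 := by positivity
    simp only [rho]; field_simp; ring

/-- `exp (α (R - ρ))` -/
def wexp (α R : ℝ) (x : EuclideanSpace ℝ (Fin d)) : ℝ := Real.exp (α * (R - rho x))

lemma cont_wexp (α R : ℝ) : Continuous (wexp (d := d) α R) := by
  unfold wexp; exact Real.continuous_exp.comp (continuous_const.mul (continuous_const.sub cont_rho))

lemma wexp_pos (α R : ℝ) (x : EuclideanSpace ℝ (Fin d)) : 0 < wexp α R x := Real.exp_pos _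

lemma C2_wexp (α R : ℝ) : C2 (wexp (d := d) α R) (fun x i => (-α * wexp α R x) * (x i / rho x))
    (fun x i => (α ^ 2 * wexp α R x) * (x i / rho x) ^ 2 + (-α * wexp α R x) * (1 / rho x - (x i) ^ 2 / rho x ^ 3)) := by
  have hd : ∀ y : ℝ, HasDerivAt (fun y => Real.exp (α * (R - y))) (-α * Real.exp (α * (R - y))) y := by
    intro y
    have := (((hasDerivAt_id y).const_sub R).const_mul α).exp
    refine this.congr_deriv ?_
    simp; ring
  exact C2.comp (C2_rho (d := d)) (h := fun y => Real.exp (α * (R - y))) (h' := fun y => -α * Real.exp (α * (R - y)))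
    (h'' := fun y => α ^ 2 * Real.exp (α * (R - y))) (fun x => hd _)
    (fun x => ((hd _).const_mul (-α)).congr_deriv (by ring))
    (continuous_const.mul (cont_wexp α R))

lemma intg_wexp {α : ℝ} (hα : 0 < α) (R : ℝ) : Integrable (wexp (d := d) α R) := by
  have h1 : Integrable (fun x : EuclideanSpace ℝ (Fin d) => (1 + ‖x‖) ^ (-((d:ℝ) + 1))) :=
    integrable_one_add_norm (by simp)
  refine Integrable.mono' (h1.const_mul (Real.exp (α * R) * ((d+1).factorial * (2 / α) ^ (d+1)))) (cont_wexp α R).aestronglyMeasurable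
    (Filter.Eventually.of_forall fun x => ?_)
  have hn := norm_nonneg x
  rw [Real.norm_eq_abs, abs_of_pos (wexp_pos _ _ _)]
  have hr : (1 + ‖x‖) / 2 ≤ rho x := by linarith [norm_le_rho x, rho_ge_one x]
  have h2 := Real.pow_div_factorial_le_exp (α * ((1 + ‖x‖) / 2)) (by positivity) (d+1)
  have h3 : Real.exp (α * ((1 + ‖x‖) / 2)) ≤ Real.exp (α * rho x) := Real.exp_le_exp.2 (mul_le_mul_of_nonneg_left hr hα.le)
  have h4 : wexp α R x = Real.exp (α * R) * (Real.exp (α * rho x))⁻¹ := by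
    rw [wexp, mul_sub, Real.exp_sub]; rfl
  rw [h4, mul_assoc]
  refine mul_le_mul_of_nonneg_left ?_ (Real.exp_pos _).le
  have h5 : (Real.exp (α * rho x))⁻¹ ≤ ((α * ((1 + ‖x‖) / 2)) ^ (d+1) / (d+1).factorial)⁻¹ :=
    inv_anti₀ (by positivity) (h2.trans h3)
  refine h5.trans (le_of_eq ?_)
  rw [Real.rpow_neg (by positivity)]
  rw [show (d:ℝ) + 1 = ((d+1 : ℕ) : ℝ) by push_cast; ring, Real.rpow_natCast]
  rw [inv_div, mul_pow, div_pow, div_pow]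
  field_simp

lemma hd_pos2 (y : ℝ) : HasDerivAt (fun y : ℝ => max y 0 ^ 2) (2 * max y 0) y := by
  rcases lt_trichotomy y 0 with h | h | h
  · rw [max_eq_right h.le, mul_zero]
    refine (hasDerivAt_const y (0:ℝ)).congr_of_eventuallyEq ?_
    filter_upwards [Iio_mem_nhds h] with x hx
    rw [max_eq_right (le_of_lt hx)]; simp
  · subst h
    rw [max_self, mul_zero]
    rw [hasDerivAt_iff_isLittleO]
    refine Asymptotics.IsBigO.trans_isLittleO (g := fun x : ℝ => x ^ 2) ?_ ?_
    · refine Asymptotics.IsBigO.of_bound 1 (Filter.Eventually.of_forall fun x => ?_)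
      simp only [max_self, ne_eq, OfNat.ofNat_ne_zero, not_false_eq_true, zero_pow, sub_zero, smul_eq_mul, mul_zero, one_mul]
      rw [Real.norm_eq_abs, Real.norm_eq_abs, abs_of_nonneg (by positivity), abs_of_nonneg (by positivity)]
      rcases le_total x 0 with hx | hx
      · rw [max_eq_right hx]; nlinarith
      · rw [max_eq_left hx]
    · simpa using Asymptotics.isLittleO_pow_id (𝕜 := ℝ) (n := 2) (by norm_num)
  · rw [max_eq_left h.le]
    have := (hasDerivAt_id y).fun_pow 2
    refine (this.congr_deriv (by simp)).congr_of_eventuallyEq ?_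
    filter_upwards [Ioi_mem_nhds h] with x hx
    rw [max_eq_left (le_of_lt hx)]; simp

lemma hd_pos4 (δ y : ℝ) : HasDerivAt (fun y : ℝ => max (y - δ) 0 ^ 4) (4 * max (y - δ) 0 ^ 3) y := by
  have h1 := (hd_pos2 (y - δ)).comp_sub_const y δ
  have h2 := h1.fun_pow 2
  refine HasDerivAt.congr_deriv (HasDerivAt.congr_of_eventuallyEq h2 (Filter.Eventually.of_forall fun s => ?_)) ?_
  · ring
  · push_cast; ring

lemma hd_pos3 (δ y : ℝ) : HasDerivAt (fun y : ℝ => 4 * max (y - δ) 0 ^ 3) (12 * max (y - δ) 0 ^ 2) y := by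
  have h1 := (hd_pos2 (y - δ)).comp_sub_const y δ
  have h2 := (((hasDerivAt_id y).sub_const δ).fun_mul h1).const_mul 4
  have e : ∀ y : ℝ, (y - δ) * max (y - δ) 0 = max (y - δ) 0 ^ 2 := by
    intro y
    rcases le_total (y - δ) 0 with hx | hx
    · rw [max_eq_right hx]; ring
    · rw [max_eq_left hx]; ring
  refine HasDerivAt.congr_deriv (HasDerivAt.congr_of_eventuallyEq h2 (Filter.Eventually.of_forall fun s => ?_)) ?_
  · simp only [id]
    have := e s
    linear_combination (-4 * max (s - δ) 0) * this
  · simp only [id]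
    have := e y
    linear_combination 8 * this

/-- truncated weight -/
def wcut (α R δ : ℝ) (x : EuclideanSpace ℝ (Fin d)) : ℝ := max (wexp α R x - δ) 0 ^ 4
def wcut1 (α R δ : ℝ) (x : EuclideanSpace ℝ (Fin d)) (i : Fin d) : ℝ :=
  4 * max (wexp α R x - δ) 0 ^ 3 * ((-α * wexp α R x) * (x i / rho x))
def wcut2 (α R δ : ℝ) (x : EuclideanSpace ℝ (Fin d)) (i : Fin d) : ℝ :=
  12 * max (wexp α R x - δ) 0 ^ 2 * ((-α * wexp α R x) * (x i / rho x)) ^ 2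
   + 4 * max (wexp α R x - δ) 0 ^ 3 * ((α ^ 2 * wexp α R x) * (x i / rho x) ^ 2 + (-α * wexp α R x) * (1 / rho x - (x i) ^ 2 / rho x ^ 3))

lemma C2_wcut (α R δ : ℝ) : C2 (wcut (d := d) α R δ) (wcut1 α R δ) (wcut2 α R δ) :=
  C2.comp (C2_wexp (d := d) α R) (h := fun y => max (y - δ) 0 ^ 4) (h' := fun y => 4 * max (y - δ) 0 ^ 3)
    (h'' := fun y => 12 * max (y - δ) 0 ^ 2) (fun x => hd_pos4 _ _) (fun x => hd_pos3 _ _)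
    (by have := cont_wexp (d := d) α R; fun_prop)

lemma Test_wcut {α R δ : ℝ} (hα : 0 < α) (hδ : 0 < δ) {r : ℝ} (hr : R + Real.log (1/δ) / α ≤ r) :
    TestF r (wcut (d := d) α R δ) (wcut1 α R δ) (wcut2 α R δ) := by
  have key : ∀ x : EuclideanSpace ℝ (Fin d), r < ‖x‖ → max (wexp α R x - δ) 0 = 0 := by
    intro x hx
    apply max_eq_right
    rw [sub_nonpos, wexp, ← Real.le_log_iff_exp_le hδ]
    have h1 : Real.log (1/δ) / α ≤ rho x - R := by linarith [norm_le_rho x]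
    rw [div_le_iff₀ hα, one_div, Real.log_inv] at h1
    linarith
  exact { C2_wcut α R δ with
    z0 := fun x hx => by simp [wcut, key x hx]
    z1 := fun x i hx => by simp [wcut1, key x hx]
    z2 := fun x i hx => by simp [wcut2, key x hx] }

lemma WP_wcut {s R δ : ℝ} (hs : 0 < s) (hs1 : s ≤ 1) (hδ : 0 < δ) :
    ∃ r, WP (d := d) s r (wexp (1/√s) R) (wcut (1/(4*√s)) R δ) (wcut1 (1/(4*√s)) R δ) (wcut2 (1/(4*√s)) R δ)
      (wcut (1/(4*√s)) R (δ/2)) (wcut1 (1/(4*√s)) R (δ/2)) (wcut2 (1/(4*√s)) R (δ/2)) := by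
  have hq : 0 < √s := Real.sqrt_pos.2 hs
  have hqq : √s * √s = s := Real.mul_self_sqrt hs.le
  set α := 1/(4*√s) with hαdef
  have hα : 0 < α := by positivity
  have hα2 : α ^ 2 = 1 / (16 * s) := by rw [hαdef, div_pow, mul_pow, Real.sq_sqrt hs.le]; norm_num
  have hα1 : α ≤ 1 / (4 * s) := by
    rw [hαdef]
    apply div_le_div_of_nonneg_left (by norm_num) (by positivity)
    have : s ≤ √s := by nlinarith [Real.sqrt_le_one.2 hs1]
    linarith
  have hφ : ∀ x : EuclideanSpace ℝ (Fin d), wexp (1/√s) R x = wexp α R x ^ 4 := by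
    intro x
    rw [wexp, wexp, ← Real.exp_nat_mul]; congr 1; rw [hαdef]; push_cast; field_simp
  have hρ1 : ∀ (x : EuclideanSpace ℝ (Fin d)) (i : Fin d), (x i / rho x) ^ 2 ≤ 1 := by
    intro x i
    rw [div_pow]
    exact div_le_one_of_le₀ (coord_le_rho x i) (sq_nonneg _)
  have hρ2 : ∀ (x : EuclideanSpace ℝ (Fin d)) (i : Fin d), |1 / rho x - (x i) ^ 2 / rho x ^ 3| ≤ 1 := by
    intro x i
    have h1 := rho_ge_one x
    have h2 : 1 / rho x - (x i) ^ 2 / rho x ^ 3 = (1 / rho x) * (1 - (x i / rho x) ^ 2) := by field_simp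
    have h3 := hρ1 x i
    have h4 : 1 / rho x ≤ 1 := by rw [div_le_one (by linarith)]; exact h1
    have h5 : 0 ≤ 1 / rho x := by positivity
    rw [h2, abs_of_nonneg (mul_nonneg h5 (by linarith))]
    have := sq_nonneg (x i / rho x)
    nlinarith
  have hP : ∀ (δ : ℝ), 0 < δ → ∀ x : EuclideanSpace ℝ (Fin d), max (wexp α R x - δ) 0 ≤ wexp α R x := fun δ hδ x =>
    max_le (by linarith) (wexp_pos _ _ _).le
  have hP0 : ∀ (δ : ℝ) (x : EuclideanSpace ℝ (Fin d)), 0 ≤ max (wexp α R x - δ) 0 := fun δ x => le_max_right _ _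
  have hb2 : ∀ (δ : ℝ), 0 < δ → ∀ (x : EuclideanSpace ℝ (Fin d)) i, |wcut2 α R δ x i| ≤ 5 * wexp (1/√s) R x / s := by
    intro δ hδ x i
    rw [wcut2, hφ]
    set θ := wexp α R x
    have hθ : 0 < θ := wexp_pos _ _ _
    set Q := max (θ - δ) 0
    have h1 : Q ≤ θ := hP δ hδ x
    have h0 : 0 ≤ Q := hP0 δ x
    have h2 := hρ1 x i
    have h3 := hρ2 x i
    set a := x i / rho x
    set b := 1 / rho x - (x i) ^ 2 / rho x ^ 3
    have t1 : |12 * Q ^ 2 * (-α * θ * a) ^ 2| ≤ 12 * θ ^ 2 * (1 / (16 * s) * θ ^ 2 * 1) := by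
      rw [abs_of_nonneg (by positivity)]
      have : (-α * θ * a) ^ 2 = α ^ 2 * θ ^ 2 * a ^ 2 := by ring
      rw [this, hα2]
      gcongr
    have t2 : |α ^ 2 * θ * a ^ 2 + -α * θ * b| ≤ 1 / (16 * s) * θ * 1 + 1 / (4 * s) * θ * 1 := by
      refine (abs_add_le _ _).trans (add_le_add ?_ ?_)
      · rw [abs_of_nonneg (by positivity), hα2]; gcongr
      · rw [abs_mul, abs_mul, abs_neg, abs_of_pos hα, abs_of_pos hθ]; gcongr
    have t3 : |4 * Q ^ 3 * (α ^ 2 * θ * a ^ 2 + -α * θ * b)| ≤ 4 * θ ^ 3 * (1 / (16 * s) * θ * 1 + 1 / (4 * s) * θ * 1) := by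
      rw [abs_mul, abs_of_nonneg (by positivity : 0 ≤ 4 * Q ^ 3)]
      gcongr
    refine (abs_add_le _ _).trans ((add_le_add t1 t3).trans ?_)
    rw [show 12 * θ ^ 2 * (1 / (16 * s) * θ ^ 2 * 1) + 4 * θ ^ 3 * (1 / (16 * s) * θ * 1 + 1 / (4 * s) * θ * 1) = 2 * θ ^ 4 / s by field_simp; ring]
    gcongr
    norm_num
  refine ⟨R + Real.log (1/(δ/2)) / α, ?_⟩
  exact {
    tp := Test_wcut hα hδ (by
      gcongr
      linarith)
    tc := Test_wcut hα (by linarith) le_rfl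
    cphi := cont_wexp _ _
    iphi := intg_wexp (by positivity) _
    p0 := fun x => by unfold wcut; positivity
    pc := fun x => by
      unfold wcut
      gcongr
      linarith
    cp := fun x => by
      rw [hφ]; unfold wcut
      exact pow_le_pow_left₀ (hP0 _ _) (hP _ (by linarith) x) 4
    b1 := fun x i => by
      rw [hφ, wcut1]
      set θ := wexp α R x
      have hθ : 0 < θ := wexp_pos _ _ _
      have h1 : max (θ - δ) 0 ≤ θ := hP δ hδ x
      have h0 : 0 ≤ max (θ - δ) 0 := hP0 δ x
      have h2 : |x i / rho x| ≤ 1 := (sq_le_one_iff_abs_le_one _).1 (hρ1 x i)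
      rw [abs_mul, abs_of_nonneg (by positivity : 0 ≤ 4 * max (θ - δ) 0 ^ 3), abs_mul, abs_mul, abs_neg, abs_of_pos hα, abs_of_pos hθ]
      calc 4 * max (θ - δ) 0 ^ 3 * (α * θ * |x i / rho x|) ≤ 4 * θ ^ 3 * (α * θ * 1) := by gcongr
        _ = θ ^ 4 / √s := by rw [hαdef]; field_simp
    b2 := hb2 δ hδ
    bc2 := hb2 (δ/2) (by linarith)
    b11 := fun x i => by
      rw [wcut1]; unfold wcut
      set θ := wexp α R x
      have hθ : 0 < θ := wexp_pos _ _ _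
      have h2 := hρ1 x i
      have h0 : 0 ≤ max (θ - δ) 0 := hP0 δ x
      have h3 : θ * max (θ - δ) 0 ≤ max (θ - δ/2) 0 ^ 2 := by
        rcases le_total θ δ with h | h
        · rw [max_eq_right (by linarith : θ - δ ≤ 0), mul_zero]; positivity
        · rw [max_eq_left (by linarith : 0 ≤ θ - δ), max_eq_left (by linarith)]; nlinarith
      set Q := max (θ - δ) 0
      set Q2 := max (θ - δ/2) 0
      have h4 : (4 * Q ^ 3 * (-α * θ * (x i / rho x))) ^ 2 = 16 * α ^ 2 * (Q ^ 4 * (θ * Q) ^ 2) * (x i / rho x) ^ 2 := by ring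
      rw [h4, hα2]
      have h5 : (θ * Q) ^ 2 ≤ (Q2 ^ 2) ^ 2 := pow_le_pow_left₀ (by positivity) h3 2
      calc 16 * (1 / (16 * s)) * (Q ^ 4 * (θ * Q) ^ 2) * (x i / rho x) ^ 2 ≤ 16 * (1 / (16 * s)) * (Q ^ 4 * (Q2 ^ 2) ^ 2) * 1 := by gcongr
        _ = 1 / s * (Q ^ 4 * Q2 ^ 4) := by field_simp
        _ ≤ 4 / s * (Q ^ 4 * Q2 ^ 4) := by gcongr; norm_num }
end weights

section chain
variable {d : ℕ} {τ K c : ℝ} {w wt : ℝ → EuclideanSpace ℝ (Fin d) → ℝ}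
    {wx wxx : ℝ → EuclideanSpace ℝ (Fin d) → Fin d → ℝ}
    {z zt : ℝ → EuclideanSpace ℝ (Fin d) → ℝ}
    {zx zxx : ℝ → EuclideanSpace ℝ (Fin d) → Fin d → ℝ}
    {nu Gu P : ℝ → EuclideanSpace ℝ (Fin d) → ℝ}

lemma Core.intgw (hC : Core τ K c w wt wx wxx z zt zx zxx nu Gu P) {t : ℝ} (ht : t ∈ Set.Ioo 0 τ)
    {φ : EuclideanSpace ℝ (Fin d) → ℝ} (iphi : Integrable φ) : Integrable (fun x => φ x * w t x) := by
  apply iphi.mul_bdd (c := K) (hC.rw.c2 ht).c0.aestronglyMeasurable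
  exact Filter.Eventually.of_forall fun x => by
    rw [Real.norm_eq_abs, abs_of_nonneg (hC.w0 t ht x)]; exact hC.w1 t ht x

lemma Core.step2 (hC : Core τ K c w wt wx wxx z zt zx zxx nu Gu P) {s R : ℝ}
    (hs : 0 < s) (hs1 : s ≤ 1) {b μ M : ℝ} (hsb : s ≤ b) (hbτ : b < τ) (hb : 2700 * K ^ 3 * (b - s) ≤ s)
    (hμ : ∀ t ∈ Set.Icc (s/2) b, ∫ x, wexp (1/√s) R x * w t x ≤ μ) (hM : ∫ x, wexp (1/√s) R x * w s x ≤ M) :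
    ∫ x, wexp (1/√s) R x * w b x ≤ 4 * K * M + μ / 2 := by
  have hbm : b ∈ Set.Ioo 0 τ := ⟨by linarith, hbτ⟩
  have hq : 0 < √s := Real.sqrt_pos.2 hs
  have hφ : ∀ x : EuclideanSpace ℝ (Fin d), wexp (1/√s) R x = wexp (1/(4*√s)) R x ^ 4 := by
    intro x
    rw [wexp, wexp, ← Real.exp_nat_mul]; congr 1; push_cast; field_simp
  have key : ∀ δ : ℝ, 0 < δ → ∫ x, wcut (1/(4*√s)) R δ x * w b x ≤ 4 * K * M + μ / 2 := by
    intro δ hδ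
    obtain ⟨r, hW⟩ := WP_wcut (d := d) (R := R) hs hs1 hδ
    exact hC.step hW hs hs1 hsb hbτ hb hμ hM
  have lim : Filter.Tendsto (fun δ : ℝ => ∫ x, wcut (1/(4*√s)) R δ x * w b x) (nhdsWithin 0 (Set.Ioi 0))
      (nhds (∫ x, wexp (1/√s) R x * w b x)) := by
    refine tendsto_integral_filter_of_dominated_convergence (fun x => wexp (1/√s) R x * w b x) ?_ ?_
      (hC.intgw hbm (intg_wexp (by positivity) R)) ?_
    · exact Filter.Eventually.of_forall fun δ =>
        ((C2_wcut (1/(4*√s)) R δ).c0.mul (hC.rw.c2 hbm).c0).aestronglyMeasurable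
    · filter_upwards [self_mem_nhdsWithin] with δ hδ
      refine Filter.Eventually.of_forall fun x => ?_
      have hw := hC.w0 b hbm x
      have hδ' : (0:ℝ) < δ := hδ
      have h0 : 0 ≤ wcut (1/(4*√s)) R δ x := by unfold wcut; positivity
      rw [Real.norm_eq_abs, abs_of_nonneg (mul_nonneg h0 hw), hφ]
      refine mul_le_mul_of_nonneg_right ?_ hw
      exact pow_le_pow_left₀ (le_max_right _ _) (max_le (by linarith) (wexp_pos _ _ _).le) 4
    · refine Filter.Eventually.of_forall fun x => ?_
      have : Continuous (fun δ : ℝ => wcut (1/(4*√s)) R δ x * w b x) := by unfold wcut; fun_prop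
      have h2 := this.tendsto 0
      have h3 : wcut (1/(4*√s)) R 0 x = wexp (1/√s) R x := by
        rw [hφ, wcut, sub_zero, max_eq_left (wexp_pos _ _ _).le]
      rw [h3] at h2
      exact h2.mono_left nhdsWithin_le_nhds
  exact le_of_tendsto lim (by filter_upwards [self_mem_nhdsWithin] with δ hδ using key δ hδ)

lemma Core.step3 (hC : Core τ K c w wt wx wxx z zt zx zxx nu Gu P) {s R : ℝ}
    (hs : 0 < s) (hs1 : s ≤ 1) {b M : ℝ} (hsb : s ≤ b) (hbτ : b < τ) (hb : 2700 * K ^ 3 * (b - s) ≤ s)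
    (hM : ∀ t ∈ Set.Icc (s/2) s, ∫ x, wexp (1/√s) R x * w t x ≤ M) :
    ∀ t ∈ Set.Icc (s/2) b, ∫ x, wexp (1/√s) R x * w t x ≤ 8 * K * M := by
  have K1 := hC.K1
  have hsub : ∀ t ∈ Set.Icc (s/2) b, t ∈ Set.Ioo 0 τ := fun t ht => ⟨by linarith [ht.1], by linarith [ht.2]⟩
  have hq : 0 < √s := Real.sqrt_pos.2 hs
  set f := fun t => ∫ x, wexp (1/√s) R x * w t x with hf
  set S := f '' Set.Icc (s/2) b with hS
  have hbdd : BddAbove S := by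
    refine ⟨K * ∫ x, wexp (d := d) (1/√s) R x, ?_⟩
    rintro _ ⟨t, ht, rfl⟩
    rw [hf, ← integral_const_mul]
    refine integral_mono (hC.intgw (hsub t ht) (intg_wexp (by positivity) R)) ((intg_wexp (by positivity) R).const_mul K) fun x => ?_
    have := mul_le_mul_of_nonneg_left (hC.w1 t (hsub t ht) x) (wexp_pos (1/√s) R x).le
    simp only; linarith
  have hmem : ∀ t ∈ Set.Icc (s/2) b, f t ≤ sSup S := fun t ht => le_csSup hbdd ⟨t, ht, rfl⟩
  have hf0 : ∀ t ∈ Set.Icc (s/2) b, 0 ≤ f t := fun t ht => integral_nonneg fun x => mul_nonneg (wexp_pos _ _ _).le (hC.w0 t (hsub t ht) x)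
  have hss : s ∈ Set.Icc (s/2) s := ⟨by linarith, le_rfl⟩
  have hss' : s ∈ Set.Icc (s/2) b := ⟨by linarith, hsb⟩
  have hM0 : 0 ≤ M := (hf0 s hss').trans (hM s hss)
  have hS0 : 0 ≤ sSup S := (hf0 s hss').trans (hmem s hss')
  have hle : sSup S ≤ 4 * K * M + sSup S / 2 := by
    refine csSup_le (⟨f s, ⟨s, hss', rfl⟩⟩ : S.Nonempty) ?_
    rintro _ ⟨t, ht, rfl⟩
    rcases le_total t s with h | h
    · have := hM t ⟨ht.1, h⟩
      have h2 : M ≤ K * M := by nlinarith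
      have h3 : f t ≤ M := this
      linarith
    · refine hC.step2 hs hs1 h (by linarith [ht.2]) (le_trans ?_ hb) (fun t' ht' => hmem t' ⟨ht'.1, ht'.2.trans ht.2⟩) (hM s hss)
      have : 0 ≤ 2700 * K ^ 3 := by positivity
      exact mul_le_mul_of_nonneg_left (by linarith [ht.2]) this
  intro t ht
  have := hmem t ht
  have h3 : f t ≤ 8 * K * M := by linarith
  exact h3

/-- comparison of weights at consecutive scales -/
lemma wexp_cmp {X X' R R' : ℝ} (hX : 1 ≤ X) (hXX : X ≤ X') (hR : R ≤ R') (x : EuclideanSpace ℝ (Fin d)) :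
    wexp X R x ≤ wexp X' R' x + Real.exp (-(R' - R) * X / 2) * wexp (1/2) R x := by
  rcases le_total (rho x) R' with h | h
  · have h1 : wexp X R x ≤ wexp X' R' x := by
      unfold wexp
      apply Real.exp_le_exp.2
      nlinarith
    have := mul_pos (Real.exp_pos (-(R' - R) * X / 2)) (wexp_pos (1/2) R x)
    linarith
  · have h1 : wexp X R x ≤ Real.exp (-(R' - R) * X / 2) * wexp (1/2) R x := by
      unfold wexp
      rw [← Real.exp_add]
      apply Real.exp_le_exp.2
      nlinarith
    have := wexp_pos X' R' x
    linarith


lemma Core.chain1 (hC : Core τ K c w wt wx wxx z zt zx zxx nu Gu P) {β X R R' M : ℝ} (hβ : 1 < β)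
    (hβK : 2700 * K ^ 3 * (β ^ 4 - 1) ≤ 1) (hX : 1 ≤ X) (hXτ : 1 / X ^ 2 < τ) (hR : R ≤ R')
    (hM : ∀ t ∈ Set.Icc (1 / (β ^ 2 * X) ^ 2 / 2) (1 / (β ^ 2 * X) ^ 2), ∫ x, wexp (β ^ 2 * X) R' x * w t x ≤ M) :
    ∀ t ∈ Set.Icc (1 / X ^ 2 / 2) (1 / X ^ 2), ∫ x, wexp X R x * w t x ≤
      8 * K * M + Real.exp (-(R' - R) * X / 2) * Real.exp (R / 2) * (K * ∫ x : EuclideanSpace ℝ (Fin d), wexp (1/2) 0 x) := by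
  intro t ht
  have hX0 : 0 < X := by linarith
  have hb2 : 1 < β ^ 2 := by nlinarith
  have hX'1 : 1 ≤ β ^ 2 * X := by nlinarith
  have hX'0 : 0 < β ^ 2 * X := by linarith
  have hXX : X ≤ β ^ 2 * X := by nlinarith
  have hinv : 1 / (β ^ 2 * X) ^ 2 ≤ 1 / X ^ 2 := by gcongr
  have hs0 : 0 < 1 / (β ^ 2 * X) ^ 2 := by positivity
  have hsq : 1 / √(1 / (β ^ 2 * X) ^ 2) = β ^ 2 * X := by
    rw [Real.sqrt_div zero_le_one, Real.sqrt_one, Real.sqrt_sq hX'0.le]; field_simp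
  have htτ : t ∈ Set.Ioo 0 τ := ⟨lt_of_lt_of_le (by positivity) ht.1, lt_of_le_of_lt ht.2 hXτ⟩
  have h3 := hC.step3 (s := 1 / (β ^ 2 * X) ^ 2) (R := R') (b := 1 / X ^ 2) (M := M) hs0
    (by rw [div_le_one (by positivity)]; nlinarith) hinv hXτ (by
      have e : 1 / X ^ 2 - 1 / (β ^ 2 * X) ^ 2 = (β ^ 4 - 1) * (1 / (β ^ 2 * X) ^ 2) := by
        field_simp
      rw [e, ← mul_assoc]
      nlinarith) (by rw [hsq]; exact hM) t ⟨le_trans (by linarith) ht.1, ht.2⟩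
  rw [hsq] at h3
  have i1 := hC.intgw htτ (intg_wexp (d := d) hX0 R)
  have i2 := hC.intgw htτ (intg_wexp (d := d) hX'0 R')
  have i3 : Integrable (fun x : EuclideanSpace ℝ (Fin d) => wexp (1/2) 0 x) := intg_wexp (by norm_num) 0
  have hle : ∫ x, wexp X R x * w t x ≤ ∫ x, (wexp (β ^ 2 * X) R' x * w t x +
      Real.exp (-(R' - R) * X / 2) * Real.exp (R / 2) * K * wexp (1/2) 0 x) := by
    refine integral_mono i1 (i2.add (i3.const_mul _)) fun x => ?_
    have h := wexp_cmp hX hXX hR x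
    have hw0 := hC.w0 t htτ x
    have hw1 := hC.w1 t htτ x
    have e : wexp (1/2) R x = Real.exp (R / 2) * wexp (1/2) 0 x := by
      unfold wexp; rw [← Real.exp_add]; congr 1; ring
    rw [e] at h
    have hp : 0 ≤ Real.exp (-(R' - R) * X / 2) * (Real.exp (R / 2) * wexp (1/2) 0 x) := by
      have := wexp_pos (1/2) 0 x
      positivity
    have h4 := mul_le_mul_of_nonneg_right h hw0
    have h5 := mul_le_mul_of_nonneg_left hw1 hp
    simp only
    linarith
  rw [integral_add i2 (i3.const_mul _), integral_const_mul] at hle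
  linarith

lemma Core.chain2 (hC : Core τ K c w wt wx wxx z zt zx zxx nu Gu P) {β L : ℝ} (hβ : 1 < β)
    (hβK : 2700 * K ^ 3 * (β ^ 4 - 1) ≤ 1) (hL : 0 ≤ L) (hLβ : 8 * K * Real.exp (-(2 * L * (β - 1))) ≤ 1 / 2)
    (N : ℕ) : ∀ (X A M : ℝ), 1 ≤ X → 1 / X ^ 2 < τ → 0 < A → A ≤ 1 → 4 ≤ (1 - 1 / β) * X * A →
    (∀ t ∈ Set.Icc (1 / (β ^ (2 * N) * X) ^ 2 / 2) (1 / (β ^ (2 * N) * X) ^ 2),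
      ∫ x, wexp (β ^ (2 * N) * X) (L * (2 - A / β ^ N)) x * w t x ≤ M) →
    ∀ t ∈ Set.Icc (1 / X ^ 2 / 2) (1 / X ^ 2), ∫ x, wexp X (L * (2 - A)) x * w t x ≤
      (8 * K) ^ N * M + (2 - 2 * (1/2) ^ N) * Real.exp (L - (1 - 1 / β) * X * A / 2 * L) * (K * ∫ x : EuclideanSpace ℝ (Fin d), wexp (1/2) 0 x) := by
  have K1 := hC.K1
  have hI : 0 ≤ K * ∫ x : EuclideanSpace ℝ (Fin d), wexp (1/2) 0 x :=
    mul_nonneg (by linarith) (integral_nonneg fun x => (wexp_pos _ _ _).le)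
  set I := K * ∫ x : EuclideanSpace ℝ (Fin d), wexp (1/2) 0 x with hIdef
  induction N with
  | zero =>
    intro X A M hX hXτ hA hA1 h4 hM t ht
    have := hM t (by simpa using ht)
    simpa using this
  | succ N ih =>
    intro X A M hX hXτ hA hA1 h4 hM t ht
    have hβ0 : 0 < β := by linarith
    have hX0 : 0 < X := by linarith
    have hb2 : 1 < β ^ 2 := by nlinarith
    have hX'1 : 1 ≤ β ^ 2 * X := by nlinarith
    have hX'0 : 0 < β ^ 2 * X := by linarith
    have hXX : X ≤ β ^ 2 * X := by nlinarith
    have hinv : 1 / (β ^ 2 * X) ^ 2 ≤ 1 / X ^ 2 := by gcongr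
    have hA' : A / β ≤ A := div_le_self hA.le hβ.le
    have e1 : (1 - 1 / β) * (β ^ 2 * X) * (A / β) = β * ((1 - 1 / β) * X * A) := by field_simp
    set q := (1 - 1 / β) * X * A with hq
    have ih' := ih (β ^ 2 * X) (A / β) M hX'1 (lt_of_le_of_lt hinv hXτ) (by positivity) (hA'.trans hA1)
      (by rw [e1]; nlinarith) (by
        have e2 : β ^ (2 * N) * (β ^ 2 * X) = β ^ (2 * (N + 1)) * X := by ring
        have e3 : A / β / β ^ N = A / β ^ (N + 1) := by rw [div_div, pow_succ']
        rw [e2, e3]; exact hM)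
    have hR : L * (2 - A) ≤ L * (2 - A / β) := mul_le_mul_of_nonneg_left (by linarith) hL
    have h1 := hC.chain1 hβ hβK hX hXτ hR ih' t ht
    refine h1.trans ?_
    rw [e1]
    have e4 : -(L * (2 - A / β) - L * (2 - A)) * X / 2 = - (q / 2 * L) := by
      rw [hq]; field_simp; ring
    rw [e4, ← Real.exp_add]
    have b1 : Real.exp (-(q / 2 * L) + L * (2 - A) / 2) ≤ Real.exp (L - q / 2 * L) := by
      apply Real.exp_le_exp.2; nlinarith
    have b2 : Real.exp (L - β * q / 2 * L) ≤ Real.exp (L - q / 2 * L) * Real.exp (-(2 * L * (β - 1))) := by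
      rw [← Real.exp_add]
      apply Real.exp_le_exp.2
      nlinarith [mul_nonneg (mul_nonneg hL (sub_nonneg.2 hβ.le)) (sub_nonneg.2 h4)]
    set Ex := Real.exp (L - q / 2 * L)
    have hEx : 0 < Ex := Real.exp_pos _
    have hN : (0:ℝ) ≤ 2 - 2 * (1/2) ^ N := by
      have : ((1:ℝ)/2) ^ N ≤ 1 := pow_le_one₀ (by norm_num) (by norm_num)
      linarith
    have b3 : 8 * K * Real.exp (L - β * q / 2 * L) ≤ Ex / 2 := by
      have := mul_le_mul_of_nonneg_left b2 (by linarith : (0:ℝ) ≤ 8 * K)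
      nlinarith
    have b4 := mul_le_mul_of_nonneg_right (mul_le_mul_of_nonneg_left b3 hN) hI
    have b5 := mul_le_mul_of_nonneg_right b1 hI
    have e5 : ((1:ℝ)/2) ^ (N+1) = (1/2) ^ N / 2 := by rw [pow_succ]; ring
    rw [e5, pow_succ]
    linarith

lemma chain_lim {γ B X : ℝ} (hγ : 1 < γ) (hB : 1 ≤ B) (hX : 1 ≤ X) (D : ℝ) :
    Filter.Tendsto (fun N : ℕ => B ^ N * (D * Real.exp (-(γ ^ N * X)))) Filter.atTop (nhds 0) := by
  have h1 : Filter.Tendsto (fun N : ℕ => B ^ N * Real.exp (-(γ ^ N * X))) Filter.atTop (nhds 0) := by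
    have h2 := tendsto_pow_const_div_const_pow_of_one_lt 1 hγ
    have h3 : Filter.Tendsto (fun N : ℕ => Real.exp (-(1:ℝ)) ^ N) Filter.atTop (nhds 0) :=
      tendsto_pow_atTop_nhds_zero_of_lt_one (Real.exp_pos _).le (by rw [Real.exp_lt_one_iff]; norm_num)
    refine squeeze_zero' (Filter.Eventually.of_forall fun N => by positivity) ?_ h3
    have hlog : 0 ≤ Real.log B := Real.log_nonneg hB
    have h4 := h2.eventually (gt_mem_nhds (show (0:ℝ) < 1 / (Real.log B + 1) by positivity))
    filter_upwards [h4] with N hN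
    have hp : 0 < γ ^ N := by positivity
    rw [pow_one, div_lt_div_iff₀ hp (by positivity)] at hN
    rw [← Real.exp_log (show 0 < B by linarith), ← Real.exp_nat_mul, ← Real.exp_nat_mul, ← Real.exp_add]
    apply Real.exp_le_exp.2
    nlinarith
  have := h1.const_mul D
  rw [mul_zero] at this
  refine this.congr fun N => by ring

lemma Core.base (hC : Core τ K c w wt wx wxx z zt zx zxx nu Gu P)
    (hinit : ∀ r : ℝ, ∃ C c t0 : ℝ, 0 < c ∧ 0 < t0 ∧ ∀ t ∈ Set.Ioo 0 t0, t < τ → ∀ x, ‖x‖ ≤ r →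
      w t x ≤ C * Real.exp (-c / t)) {L : ℝ} (hL : 0 ≤ L) :
    ∃ D X1 : ℝ, ∀ X, 1 ≤ X → X1 ≤ X → 1 / X ^ 2 < τ → ∀ R ≤ 2 * L, ∀ t ∈ Set.Icc (1 / X ^ 2 / 2) (1 / X ^ 2),
      ∫ x, wexp X R x * w t x ≤ D * Real.exp (-X) := by
  have K1 := hC.K1
  obtain ⟨C, c', t0, hc', ht0, hin⟩ := hinit (2 * L + 1)
  set E := |C| * Real.exp ((2 * L + 1) ^ 2 / (4 * c')) + K * Real.exp (L + 1/2) with hE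
  refine ⟨E * ∫ x : EuclideanSpace ℝ (Fin d), wexp (1/2) 0 x, 1 / t0 + 1, fun X hX hX1 hXτ R hR t ht => ?_⟩
  have hX0 : 0 < X := by linarith
  have htτ : t ∈ Set.Ioo 0 τ := ⟨lt_of_lt_of_le (by positivity) ht.1, lt_of_le_of_lt ht.2 hXτ⟩
  have ht0' : t < t0 := by
    refine lt_of_le_of_lt ht.2 ?_
    rw [div_lt_iff₀ (by positivity)]
    have : 1 / t0 < X := by linarith
    rw [div_lt_iff₀ ht0] at this
    nlinarith
  have i3 : Integrable (fun x : EuclideanSpace ℝ (Fin d) => wexp (1/2) 0 x) := intg_wexp (by norm_num) 0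
  rw [mul_assoc, mul_comm _ (Real.exp (-X)), ← mul_assoc, ← integral_const_mul]
  refine integral_mono (hC.intgw htτ (intg_wexp (d := d) hX0 R)) (i3.const_mul _) fun x => ?_
  have hw0 := hC.w0 t htτ x
  have hw1 := hC.w1 t htτ x
  have hrho := rho_ge_one x
  have hE1 : 0 ≤ |C| * Real.exp ((2 * L + 1) ^ 2 / (4 * c')) := by positivity
  have hE2 : 0 ≤ K * Real.exp (L + 1/2) := by positivity
  have hpos := wexp_pos (1/2) 0 x
  simp only
  rcases le_total ‖x‖ (2 * L + 1) with h | h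
  · have h1 := hin t ⟨htτ.1, ht0'⟩ htτ.2 x h
    have h2 : w t x ≤ |C| * Real.exp (-c' * X ^ 2) := by
      refine h1.trans ((mul_le_mul_of_nonneg_right (le_abs_self C) (Real.exp_pos _).le).trans ?_)
      refine mul_le_mul_of_nonneg_left (Real.exp_le_exp.2 ?_) (abs_nonneg C)
      have : X ^ 2 ≤ 1 / t := by
        rw [le_div_iff₀ htτ.1]
        have := ht.2
        rw [le_div_iff₀ (by positivity)] at this
        linarith
      have := mul_le_mul_of_nonneg_left this hc'.le
      rw [neg_div, ← mul_one_div]; linarith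
    have h3 : wexp X R x ≤ Real.exp (2 * L * X) * wexp (1/2) 0 x := by
      unfold wexp; rw [← Real.exp_add]; apply Real.exp_le_exp.2; nlinarith
    have h4 : wexp X R x * w t x ≤ (Real.exp (2 * L * X) * wexp (1/2) 0 x) * (|C| * Real.exp (-c' * X ^ 2)) :=
      mul_le_mul h3 h2 hw0 (by positivity)
    have h5 : Real.exp (2 * L * X) * Real.exp (-c' * X ^ 2) ≤ Real.exp ((2 * L + 1) ^ 2 / (4 * c')) * Real.exp (-X) := by
      rw [← Real.exp_add, ← Real.exp_add]
      apply Real.exp_le_exp.2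
      have : (2 * L + 1) ^ 2 / (4 * c') - (2 * L + 1) * X + c' * X ^ 2 = (c' * (X - (2 * L + 1) / (2 * c')) ^ 2) := by
        field_simp; ring
      have h0 : 0 ≤ c' * (X - (2 * L + 1) / (2 * c')) ^ 2 := by positivity
      linarith
    have h6 := mul_le_mul_of_nonneg_left h5 (mul_nonneg (abs_nonneg C) hpos.le)
    have h7 : 0 ≤ K * Real.exp (L + 1/2) * Real.exp (-X) * wexp (1/2) 0 x := by positivity
    rw [hE]; linarith
  · have h1 := norm_le_rho x
    have h3 : wexp X R x ≤ Real.exp (L + 1/2) * Real.exp (-X) * wexp (1/2) 0 x := by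
      unfold wexp; rw [← Real.exp_add, ← Real.exp_add]; apply Real.exp_le_exp.2; nlinarith
    have h4 : wexp X R x * w t x ≤ (Real.exp (L + 1/2) * Real.exp (-X) * wexp (1/2) 0 x) * K :=
      mul_le_mul h3 hw1 hw0 (by positivity)
    have h7 : 0 ≤ |C| * Real.exp ((2 * L + 1) ^ 2 / (4 * c')) * Real.exp (-X) * wexp (1/2) 0 x := by positivity
    rw [hE]; linarith

end chain

/-- uniqueness for the core system -/
theorem core_zero (K : ℝ) (hK : 1 ≤ K) : ∃ s1 : ℝ, 0 < s1 ∧ ∀ {d : ℕ} {τ c : ℝ} {w wt : ℝ → EuclideanSpace ℝ (Fin d) → ℝ}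
    {wx wxx : ℝ → EuclideanSpace ℝ (Fin d) → Fin d → ℝ}
    {z zt : ℝ → EuclideanSpace ℝ (Fin d) → ℝ}
    {zx zxx : ℝ → EuclideanSpace ℝ (Fin d) → Fin d → ℝ}
    {nu Gu P : ℝ → EuclideanSpace ℝ (Fin d) → ℝ} (_hC : Core τ K c w wt wx wxx z zt zx zxx nu Gu P)
    (_hinit : ∀ r : ℝ, ∃ C c t0 : ℝ, 0 < c ∧ 0 < t0 ∧ ∀ t ∈ Set.Ioo 0 t0, t < τ → ∀ x, ‖x‖ ≤ r →
      w t x ≤ C * Real.exp (-c / t)), ∀ t ∈ Set.Ioo 0 τ, t ≤ s1 → ∀ x, w t x = 0 := by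
  obtain ⟨β, hβ, hβK⟩ : ∃ β : ℝ, 1 < β ∧ 2700 * K ^ 3 * (β ^ 4 - 1) ≤ 1 := by
    have hq : (0:ℝ) < 1 / (2700 * K ^ 3) := by positivity
    have hcont : Filter.Tendsto (fun β : ℝ => β ^ 4 - 1) (nhdsWithin 1 (Set.Ioi 1)) (nhds (1 ^ 4 - 1)) :=
      ((by fun_prop : Continuous fun β : ℝ => β ^ 4 - 1).tendsto 1).mono_left nhdsWithin_le_nhds
    have h1 := hcont.eventually (gt_mem_nhds (show (1:ℝ) ^ 4 - 1 < 1 / (2700 * K ^ 3) by norm_num; positivity))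
    obtain ⟨β, h2, h3⟩ := (h1.and self_mem_nhdsWithin).exists
    refine ⟨β, h3, ?_⟩
    rw [lt_div_iff₀ (by positivity)] at h2
    linarith
  have hβ0 : 0 < β := by linarith
  have hκ : 0 < 1 - 1 / β := by
    rw [sub_pos, div_lt_one hβ0]; exact hβ
  set κ := 1 - 1 / β with hκd
  refine ⟨1 / (4 / κ + 1) ^ 2, by positivity, ?_⟩
  intro d τ c w wt wx wxx z zt zx zxx nu Gu P hC hinit t ht hts x
  have ht0 := ht.1
  set X := 1 / √t with hXd
  have hst : 0 < √t := Real.sqrt_pos.2 ht0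
  have hX0 : 0 < X := by positivity
  have hXt : 1 / X ^ 2 = t := by
    rw [hXd, div_pow, Real.sq_sqrt ht0.le]; field_simp
  have hX : 4 / κ + 1 ≤ X := by
    rw [hXd, le_div_iff₀ hst]
    have h1 : √t ≤ 1 / (4 / κ + 1) := by
      rw [← Real.sqrt_sq (show (0:ℝ) ≤ 1 / (4 / κ + 1) by positivity)]
      apply Real.sqrt_le_sqrt
      rw [div_pow, one_pow]; exact hts
    calc (4 / κ + 1) * √t ≤ (4 / κ + 1) * (1 / (4 / κ + 1)) := by gcongr
      _ = 1 := by field_simp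
  have h4κ : 0 < 4 / κ := by positivity
  have hX1 : 1 ≤ X := by linarith
  have h4 : 4 ≤ κ * X * 1 := by
    have : 4 / κ ≤ X := by linarith
    rw [div_le_iff₀ hκ] at this; linarith
  set I := K * ∫ x : EuclideanSpace ℝ (Fin d), wexp (1/2) 0 x with hI
  have hI0 : 0 ≤ I := mul_nonneg (by linarith) (integral_nonneg fun x => (wexp_pos _ _ _).le)
  have key : ∀ L : ℝ, 0 ≤ L → 8 * K * Real.exp (-(2 * L * (β - 1))) ≤ 1 / 2 →
      ∫ x, wexp X 0 x * w t x ≤ 2 * Real.exp (-L) * I := by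
    intro L hL hLβ
    obtain ⟨D, X1, hbase⟩ := hC.base hinit hL
    have h0 : ∫ x, wexp X 0 x * w t x ≤ ∫ x, wexp X (L * (2 - 1)) x * w t x := by
      refine integral_mono (hC.intgw ht (intg_wexp hX0 0)) (hC.intgw ht (intg_wexp hX0 _)) fun x => ?_
      refine mul_le_mul_of_nonneg_right ?_ (hC.w0 t ht x)
      unfold wexp; apply Real.exp_le_exp.2; nlinarith
    have hev : ∀ᶠ N : ℕ in Filter.atTop, ∫ x, wexp X (L * (2 - 1)) x * w t x ≤
        (8 * K) ^ N * (D * Real.exp (-((β ^ 2) ^ N * X))) + 2 * Real.exp (-L) * I := by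
      have hb2 : 1 < β ^ 2 := by nlinarith
      have htop := tendsto_pow_atTop_atTop_of_one_lt hb2
      filter_upwards [htop.eventually_ge_atTop (X1)] with N hN
      have hbN : 1 ≤ β ^ (2 * N) := one_le_pow₀ hβ.le
      have hN' : X1 ≤ β ^ (2 * N) * X := by
        rw [← pow_mul] at hN
        nlinarith
      have hXN : X ≤ β ^ (2 * N) * X := by nlinarith
      have hb := hbase (β ^ (2 * N) * X) (by linarith) hN' (by
        refine lt_of_le_of_lt ?_ ht.2
        calc 1 / (β ^ (2 * N) * X) ^ 2 ≤ 1 / X ^ 2 := by gcongr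
          _ = t := hXt) (L * (2 - 1 / β ^ N)) (by
            have : 0 ≤ 1 / β ^ N := by positivity
            nlinarith)
      have h := hC.chain2 hβ hβK hL hLβ N X 1 _ hX1 (by rw [hXt]; exact ht.2) one_pos le_rfl h4 hb t
        ⟨by rw [hXt]; linarith, by rw [hXt]⟩
      refine h.trans ?_
      rw [pow_mul]
      refine add_le_add_right ?_ _
      refine mul_le_mul_of_nonneg_right ?_ hI0
      refine mul_le_mul ?_ ?_ (Real.exp_pos _).le (by norm_num)
      · have : (0:ℝ) ≤ (1/2) ^ N := by positivity
        linarith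
      · apply Real.exp_le_exp.2; nlinarith
    have hlim := (chain_lim (show 1 < β ^ 2 by nlinarith) (show 1 ≤ 8 * K by linarith) hX1 D).add_const (2 * Real.exp (-L) * I)
    rw [zero_add] at hlim
    exact h0.trans (ge_of_tendsto hlim hev)
  have hle : ∫ x, wexp X 0 x * w t x ≤ 0 := by
    have l1 : Filter.Tendsto (fun L : ℝ => 2 * Real.exp (-L) * I) Filter.atTop (nhds 0) := by
      have := (Real.tendsto_exp_neg_atTop_nhds_zero.const_mul 2).mul_const I
      simpa using this
    have l2 : ∀ᶠ L : ℝ in Filter.atTop, 8 * K * Real.exp (-(2 * L * (β - 1))) ≤ 1 / 2 := by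
      have h1 : Filter.Tendsto (fun L : ℝ => 2 * L * (β - 1)) Filter.atTop Filter.atTop :=
        (Filter.tendsto_id.const_mul_atTop (by norm_num : (0:ℝ) < 2)).atTop_mul_const (by linarith)
      have h2 := ((Real.tendsto_exp_neg_atTop_nhds_zero.comp h1).const_mul (8 * K))
      rw [mul_zero] at h2
      exact h2.eventually (ge_mem_nhds (by norm_num))
    refine ge_of_tendsto l1 ?_
    filter_upwards [l2, Filter.eventually_ge_atTop 0] with L h1 h2 using key L h2 h1
  have hz : (fun x => wexp X 0 x * w t x) = 0 := by
    have hc : Continuous (fun x => wexp X 0 x * w t x) := (cont_wexp X 0).mul (hC.rw.c2 ht).c0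
    have h0 : 0 ≤ fun x => wexp X 0 x * w t x := fun x => mul_nonneg (wexp_pos _ _ _).le (hC.w0 t ht x)
    have hi : ∫ x, wexp X 0 x * w t x = 0 := le_antisymm hle (integral_nonneg h0)
    have := (integral_eq_zero_iff_of_nonneg h0 (hC.intgw ht (intg_wexp hX0 0))).1 hi
    exact (hc.ae_eq_iff_eq volume continuous_zero).1 this
  have := congrFun hz x
  simp only [Pi.zero_apply, mul_eq_zero] at this
  exact this.resolve_left (wexp_pos _ _ _).ne'

section heat
variable {d : ℕ}

/-- convolution-type operator -/
def TT (κ : EuclideanSpace ℝ (Fin d) → ℝ) (l : ℝ) (f : EuclideanSpace ℝ (Fin d) → ℝ) (x : EuclideanSpace ℝ (Fin d)) : ℝ :=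
  ∫ y, κ y * f (x + l • y)

/-- continuous kernel with Gaussian bound -/
structure GB (κ : EuclideanSpace ℝ (Fin d) → ℝ) : Prop where
  cont : Continuous κ
  bd : ∃ C, ∀ y, |κ y| ≤ C * Real.exp (-‖y‖ ^ 2 / 2)

lemma intg_gauss {b : ℝ} (hb : 0 < b) : Integrable (fun y : EuclideanSpace ℝ (Fin d) => Real.exp (-b * ‖y‖ ^ 2)) := by
  have := (GaussianFourier.integrable_cexp_neg_mul_sq_norm_add (V := EuclideanSpace ℝ (Fin d)) (b := (b:ℂ)) (by simpa using hb) 0 0).norm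
  refine this.congr (Filter.Eventually.of_forall fun y => ?_)
  simp only [Complex.norm_exp]
  congr 1
  have : (-(b:ℂ) * (‖y‖:ℂ) ^ 2 + 0 * ((inner ℝ (0:EuclideanSpace ℝ (Fin d)) y : ℝ) : ℂ)) = ((-b * ‖y‖ ^ 2 : ℝ) : ℂ) := by
    push_cast; ring
  rw [this, Complex.ofReal_re]

lemma GB.intg {κ : EuclideanSpace ℝ (Fin d) → ℝ} (h : GB κ) : Integrable κ := by
  obtain ⟨C, hC⟩ := h.bd
  refine Integrable.mono' ((intg_gauss (d := d) (b := 1/2) (by norm_num)).const_mul C) h.cont.aestronglyMeasurable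
    (Filter.Eventually.of_forall fun y => ?_)
  rw [Real.norm_eq_abs]; convert hC y using 3; ring

lemma GB.intg_abs {κ : EuclideanSpace ℝ (Fin d) → ℝ} (h : GB κ) : Integrable (fun y => |κ y|) := h.intg.abs

lemma norm_le_gauss (y : EuclideanSpace ℝ (Fin d)) : ‖y‖ ≤ 2 * Real.exp (‖y‖ ^ 2 / 4) := by
  have := Real.add_one_le_exp (‖y‖ ^ 2 / 4)
  nlinarith [sq_nonneg (‖y‖ - 1)]

lemma GB.intg_mom {κ : EuclideanSpace ℝ (Fin d) → ℝ} (h : GB κ) : Integrable (fun y => |κ y| * ‖y‖) := by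
  obtain ⟨C, hC⟩ := h.bd
  refine Integrable.mono' ((intg_gauss (d := d) (b := 1/4) (by norm_num)).const_mul (C * 2))
    (h.cont.abs.mul continuous_norm).aestronglyMeasurable
    (Filter.Eventually.of_forall fun y => ?_)
  rw [Real.norm_eq_abs, abs_of_nonneg (by positivity)]
  have h1 := mul_le_mul (hC y) (norm_le_gauss y) (norm_nonneg y) ((abs_nonneg _).trans (hC y))
  refine h1.trans (le_of_eq ?_)
  rw [mul_mul_mul_comm, ← Real.exp_add]
  congr 2; ring

lemma TT.intg {κ : EuclideanSpace ℝ (Fin d) → ℝ} (h : GB κ) {f : EuclideanSpace ℝ (Fin d) → ℝ} (hf : Continuous f) {B : ℝ}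
    (hB : ∀ x, |f x| ≤ B) (l : ℝ) (x : EuclideanSpace ℝ (Fin d)) : Integrable (fun y => κ y * f (x + l • y)) := by
  apply h.intg.mul_bdd (c := B) (by fun_prop)
  exact Filter.Eventually.of_forall fun x => by rw [Real.norm_eq_abs]; exact hB _

lemma TT.bound {κ : EuclideanSpace ℝ (Fin d) → ℝ} (h : GB κ) {f : EuclideanSpace ℝ (Fin d) → ℝ} {B : ℝ}
    (hB : ∀ x, |f x| ≤ B) (l : ℝ) (x : EuclideanSpace ℝ (Fin d)) : |TT κ l f x| ≤ B * ∫ y, |κ y| := by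
  unfold TT
  rw [← integral_const_mul, ← Real.norm_eq_abs]
  refine norm_integral_le_of_norm_le (h.intg_abs.const_mul B) (Filter.Eventually.of_forall fun y => ?_)
  rw [Real.norm_eq_abs, abs_mul, mul_comm]
  exact mul_le_mul_of_nonneg_right (hB _) (abs_nonneg _)

lemma TT.contOn {κ : EuclideanSpace ℝ (Fin d) → ℝ} (h : GB κ) {Y : Type*} [TopologicalSpace Y] [FirstCountableTopology Y] {s : Set Y}
    {H : Y → EuclideanSpace ℝ (Fin d) → ℝ} {B : ℝ} {l : Y → ℝ} {X : Y → EuclideanSpace ℝ (Fin d)}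
    (hB : ∀ p ∈ s, ∀ x, |H p x| ≤ B) (hHx : ∀ p ∈ s, Continuous (H p)) 
    (hc : ∀ y, ContinuousOn (fun p => H p (X p + l p • y)) s) :
    ContinuousOn (fun p => TT κ (l p) (H p) (X p)) s := by
  unfold TT
  refine continuousOn_of_dominated (bound := fun y => |κ y| * B) ?_ ?_ (h.intg_abs.mul_const B) ?_
  · intro p hp
    have := h.cont
    have := hHx p hp
    exact Continuous.aestronglyMeasurable (by fun_prop)
  · intro p hp
    refine Filter.Eventually.of_forall fun y => ?_
    rw [Real.norm_eq_abs, abs_mul]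
    exact mul_le_mul_of_nonneg_left (hB p hp _) (abs_nonneg _)
  · exact Filter.Eventually.of_forall fun y => (hc y).const_smul (κ y)

/-- differentiation in space moves to the kernel -/
lemma TT.hasDeriv {κ κ' : EuclideanSpace ℝ (Fin d) → ℝ} (h : GB κ) (h' : GB κ') (v : EuclideanSpace ℝ (Fin d))
    (hd : ∀ y, HasDerivAt (fun s : ℝ => κ (y + s • v)) (κ' y) 0)
    {f : EuclideanSpace ℝ (Fin d) → ℝ} (hf : Continuous f) {B : ℝ}
    (hB : ∀ x, |f x| ≤ B) {l : ℝ} (hl : 0 < l) (x : EuclideanSpace ℝ (Fin d)) :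
    HasDerivAt (fun s : ℝ => TT κ l f (x + s • v)) (-(1 / l) * TT κ' l f x) 0 := by
  have e : ∀ s : ℝ, TT κ l f (x + s • v) = ∫ y, κ (y + (-(s / l)) • v) * f (x + l • y) := by
    intro s
    unfold TT
    rw [← integral_add_right_eq_self (fun y => κ (y + (-(s / l)) • v) * f (x + l • y)) ((s / l) • v)]
    congr 1; ext y
    congr 2
    · rw [add_assoc, ← add_smul]; simp
    · rw [smul_add, smul_smul, mul_div_cancel₀ _ hl.ne', add_assoc, add_comm (s • v)]
  simp_rw [e]
  have hds : ∀ y (s : ℝ), HasDerivAt (fun s : ℝ => κ (y + s • v)) (κ' (y + s • v)) s := by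
    intro y s
    have h1 := hd (y + s • v)
    have h2 : HasDerivAt (fun r : ℝ => κ (y + s • v + (r - s) • v)) (κ' (y + s • v)) s := by
      have h3 : HasDerivAt (fun s_1 : ℝ => κ (y + s • v + s_1 • v)) (κ' (y + s • v)) (s - s) := by rwa [sub_self]
      exact h3.comp_sub_const s s
    refine h2.congr_of_eventuallyEq (Filter.Eventually.of_forall fun r => ?_)
    simp only
    rw [add_assoc, ← add_smul]; congr 3; ring
  obtain ⟨C, hC⟩ := h'.bd
  have hC0 : 0 ≤ C := by
    have := (abs_nonneg _).trans (hC 0); simpa using this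
  have hB0 : 0 ≤ B := (abs_nonneg _).trans (hB 0)
  have main := (hasDerivAt_integral_of_dominated_loc_of_deriv_le (μ := volume) (𝕜 := ℝ)
    (F := fun (r : ℝ) (y : EuclideanSpace ℝ (Fin d)) => κ (y + r • v) * f (x + l • y))
    (F' := fun (r : ℝ) (y : EuclideanSpace ℝ (Fin d)) => κ' (y + r • v) * f (x + l • y)) (x₀ := 0)
    (s := Metric.ball 0 1) (bound := fun y => C * Real.exp (‖v‖ ^ 2 / 2) * Real.exp (-(1/4) * ‖y‖ ^ 2) * B)
    (Metric.ball_mem_nhds 0 one_pos) ?_ ?_ ?_ ?_ ?_ ?_).2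
  · have h2 : HasDerivAt (fun s : ℝ => -(s / l)) (-(1 / l)) 0 := ((hasDerivAt_id (0:ℝ)).div_const l).neg
    have main' : HasDerivAt (fun r : ℝ => ∫ y, κ (y + r • v) * f (x + l • y)) (TT κ' l f x) (-(0 / l)) := by
      simpa [TT] using main
    have := main'.comp (0:ℝ) h2
    refine this.congr_deriv ?_
    ring
  · refine Filter.Eventually.of_forall fun r => Continuous.aestronglyMeasurable ?_
    have := h.cont
    fun_prop
  · simpa using TT.intg h hf hB l x
  · refine Continuous.aestronglyMeasurable ?_
    have := h'.cont
    fun_prop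
  · refine Filter.Eventually.of_forall fun y r hr => ?_
    rw [Real.norm_eq_abs, abs_mul]
    refine mul_le_mul ?_ (hB _) (abs_nonneg _) (by positivity)
    refine (hC _).trans ?_
    rw [mul_assoc, ← Real.exp_add]
    refine mul_le_mul_of_nonneg_left (Real.exp_le_exp.2 ?_) hC0
    have hr1 : |r| ≤ 1 := by
      rw [Metric.mem_ball, dist_zero_right, Real.norm_eq_abs] at hr; exact hr.le
    have h3 : ‖y‖ ≤ ‖y + r • v‖ + ‖v‖ := by
      calc ‖y‖ = ‖(y + r • v) - r • v‖ := by congr 1; abel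
        _ ≤ ‖y + r • v‖ + ‖r • v‖ := norm_sub_le _ _
        _ ≤ ‖y + r • v‖ + ‖v‖ := by
          rw [norm_smul, Real.norm_eq_abs]
          have := mul_le_mul_of_nonneg_right hr1 (norm_nonneg v)
          linarith
    nlinarith [norm_nonneg y, norm_nonneg (y + r • v), norm_nonneg v, sq_nonneg (‖y + r • v‖ - ‖v‖)]
  · exact ((intg_gauss (d := d) (b := 1/4) (by norm_num)).const_mul _).mul_const B
  · exact Filter.Eventually.of_forall fun y r _ => (hds y r).mul_const _

/-- normalised Gaussian -/
def gk (y : EuclideanSpace ℝ (Fin d)) : ℝ := Real.exp (-‖y‖ ^ 2) / ∫ y : EuclideanSpace ℝ (Fin d), Real.exp (-‖y‖ ^ 2)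

def g1 (v y : EuclideanSpace ℝ (Fin d)) : ℝ := -2 * inner ℝ y v * gk y
def g2 (i : Fin d) (y : EuclideanSpace ℝ (Fin d)) : ℝ := (4 * y i ^ 2 - 2) * gk y

lemma intg_gauss1 : Integrable (fun y : EuclideanSpace ℝ (Fin d) => Real.exp (-‖y‖ ^ 2)) := by
  have := intg_gauss (d := d) (b := 1) one_pos
  simpa using this

lemma gauss_pos : 0 < ∫ y : EuclideanSpace ℝ (Fin d), Real.exp (-‖y‖ ^ 2) := integral_exp_pos intg_gauss1

lemma gk_pos (y : EuclideanSpace ℝ (Fin d)) : 0 < gk y := div_pos (Real.exp_pos _) gauss_pos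

lemma gk_int : ∫ y : EuclideanSpace ℝ (Fin d), gk y = 1 := by
  unfold gk; rw [integral_div, div_self gauss_pos.ne']

lemma cont_gk : Continuous (gk : EuclideanSpace ℝ (Fin d) → ℝ) := by unfold gk; fun_prop

lemma GB_poly {q : EuclideanSpace ℝ (Fin d) → ℝ} (hq : Continuous q) {C : ℝ} (hC : ∀ y, |q y| ≤ C * (1 + ‖y‖ ^ 2 / 2)) :
    GB (fun y => q y * gk y) where
  cont := hq.mul cont_gk
  bd := by
    have hp := gauss_pos (d := d)
    refine ⟨C / ∫ y : EuclideanSpace ℝ (Fin d), Real.exp (-‖y‖ ^ 2), fun y => ?_⟩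
    have hC0 : 0 ≤ C := by have := (abs_nonneg _).trans (hC 0); simpa using this
    rw [abs_mul, abs_of_pos (gk_pos y), gk, ← mul_div_assoc, div_mul_eq_mul_div]
    refine div_le_div_of_nonneg_right ?_ hp.le
    have h1 : |q y| ≤ C * Real.exp (‖y‖ ^ 2 / 2) := (hC y).trans (mul_le_mul_of_nonneg_left (by linarith [Real.add_one_le_exp (‖y‖ ^ 2 / 2)]) hC0)
    calc |q y| * Real.exp (-‖y‖ ^ 2) ≤ C * Real.exp (‖y‖ ^ 2 / 2) * Real.exp (-‖y‖ ^ 2) := by gcongr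
      _ = _ := by rw [mul_assoc, ← Real.exp_add]; congr 2; ring

lemma GB_gk : GB (gk : EuclideanSpace ℝ (Fin d) → ℝ) := by
  have := GB_poly (d := d) (q := fun _ => 1) continuous_const (C := 1) (fun y => by simp; positivity)
  simpa using this

lemma GB_g1 (v : EuclideanSpace ℝ (Fin d)) : GB (g1 v) := by
  refine GB_poly (q := fun y => -2 * inner ℝ y v) (by fun_prop) (C := 2 * ‖v‖) (fun y => ?_)
  rw [abs_mul]
  have := abs_real_inner_le_norm y v
  simp only [abs_neg, Nat.abs_ofNat]
  nlinarith [norm_nonneg v, mul_nonneg (norm_nonneg v) (sq_nonneg (‖y‖ - 1))]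

lemma GB_g2 (i : Fin d) : GB (g2 i) := by
  refine GB_poly (q := fun y => 4 * y i ^ 2 - 2) (by fun_prop) (C := 8) (fun y => ?_)
  have h1 := PiLp.norm_apply_le y i
  rw [Real.norm_eq_abs] at h1
  have : y i ^ 2 ≤ ‖y‖ ^ 2 := by rw [← sq_abs]; nlinarith [abs_nonneg (y i)]
  rw [abs_le]; constructor <;> nlinarith [sq_nonneg (y i)]

lemma gk_deriv (v y : EuclideanSpace ℝ (Fin d)) : HasDerivAt (fun s : ℝ => gk (y + s • v)) (g1 v y) 0 := by
  have h0 : HasDerivAt (fun s : ℝ => ‖y + s • v‖ ^ 2) (2 * inner ℝ y v) 0 := by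
    have h1 : HasDerivAt (fun s : ℝ => y + s • v) v 0 := by
      simpa using ((hasDerivAt_id (0:ℝ)).smul_const v).const_add y
    simpa using h1.norm_sq
  have := (h0.fun_neg.exp).div_const (∫ y : EuclideanSpace ℝ (Fin d), Real.exp (-‖y‖ ^ 2))
  refine this.congr_deriv ?_
  simp [g1, gk]; ring

lemma g1_deriv (i : Fin d) (y : EuclideanSpace ℝ (Fin d)) : HasDerivAt (fun s : ℝ => g1 (eb i) (y + s • eb i)) (g2 i y) 0 := by
  have h0 : HasDerivAt (fun s : ℝ => -2 * inner ℝ (y + s • (eb i : EuclideanSpace ℝ (Fin d))) (eb i)) (-2) 0 := by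
    have e : ∀ s : ℝ, -2 * inner ℝ (y + s • (eb i : EuclideanSpace ℝ (Fin d))) (eb i) = -2 * (y i) + (-2) * s := by
      intro s; simp [eb, inner_add_left, inner_smul_left, EuclideanSpace.inner_single_right]; ring
    simp_rw [e]
    simpa using ((hasDerivAt_id (0:ℝ)).const_mul (-2)).const_add (-2 * y i)
  have := h0.fun_mul (gk_deriv (eb i) y)
  unfold g1 g2
  refine this.congr_deriv ?_
  simp [g1, eb, EuclideanSpace.inner_single_right]; ring

lemma g2_int (i : Fin d) : ∫ y, g2 i y = 0 := by
  have h := TT.hasDeriv (GB_g1 (eb i)) (GB_g2 i) (eb i) (g1_deriv i) (f := fun _ => 1) continuous_const (B := 1) (fun x => by simp)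
    (l := 1) one_pos 0
  have h2 : HasDerivAt (fun s : ℝ => TT (g1 (eb i)) 1 (fun _ => 1) (0 + s • eb i)) 0 0 := by
    unfold TT
    exact hasDerivAt_const _ _
  have := h.unique h2
  simpa [TT] using this

lemma sum_g2 (y : EuclideanSpace ℝ (Fin d)) : ∑ i, g2 i y = (4 * ‖y‖ ^ 2 - 2 * d) * gk y := by
  unfold g2
  rw [← Finset.sum_mul, Finset.sum_sub_distrib, ← Finset.mul_sum, EuclideanSpace.norm_sq_eq]
  simp; left; ring

lemma TT.lip2 {i : Fin d} {f : EuclideanSpace ℝ (Fin d) → ℝ} (hf : Continuous f) {B Lp : ℝ}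
    (hB : ∀ x, |f x| ≤ B) (hL : ∀ x v, |f (x + v) - f x| ≤ Lp * ‖v‖) {l : ℝ} (hl : 0 ≤ l) (x : EuclideanSpace ℝ (Fin d)) :
    |TT (g2 i) l f x| ≤ Lp * l * ∫ y, |g2 i y| * ‖y‖ := by
  have h1 : TT (g2 i) l f x = ∫ y, g2 i y * (f (x + l • y) - f x) := by
    unfold TT
    have : ∫ y, g2 i y * f x = 0 := by rw [integral_mul_const, g2_int, zero_mul]
    rw [← sub_zero (∫ y, g2 i y * f (x + l • y)), ← this, ← integral_sub (TT.intg (GB_g2 i) hf hB l x) ((GB_g2 i).intg.mul_const _)]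
    congr 1; ext y; ring
  rw [h1, ← integral_const_mul, ← Real.norm_eq_abs]
  refine norm_integral_le_of_norm_le ((GB_g2 i).intg_mom.const_mul _) (Filter.Eventually.of_forall fun y => ?_)
  rw [Real.norm_eq_abs, abs_mul]
  have := hL x (l • y)
  rw [norm_smul, Real.norm_eq_abs, abs_of_nonneg hl] at this
  calc |g2 i y| * |f (x + l • y) - f x| ≤ |g2 i y| * (Lp * (l * ‖y‖)) := by gcongr
    _ = _ := by ring

lemma intg_g1n : Integrable (fun y : EuclideanSpace ℝ (Fin d) => 2 * ‖y‖ * gk y) := by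
  have := (GB_gk (d := d)).intg_mom.const_mul 2
  refine this.congr (Filter.Eventually.of_forall fun y => ?_)
  simp only [abs_of_pos (gk_pos y)]; ring

lemma TT.lip1 {f : EuclideanSpace ℝ (Fin d) → ℝ} (hf : Continuous f) {B : ℝ}
    (hB : ∀ x, |f x| ≤ B) {l : ℝ} (hl : 0 < l) (x v : EuclideanSpace ℝ (Fin d)) :
    |TT gk l f (x + v) - TT gk l f x| ≤ B / l * (∫ y : EuclideanSpace ℝ (Fin d), 2 * ‖y‖ * gk y) * ‖v‖ := by
  have hd : ∀ s : ℝ, HasDerivAt (fun s : ℝ => TT gk l f (x + s • v)) (-(1 / l) * TT (g1 v) l f (x + s • v)) s := by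
    intro s
    have h1 := TT.hasDeriv GB_gk (GB_g1 v) v (gk_deriv v) hf hB hl (x + s • v)
    have h3 : HasDerivAt (fun r : ℝ => TT gk l f (x + s • v + r • v)) (-(1 / l) * TT (g1 v) l f (x + s • v)) (s - s) := by rwa [sub_self]
    refine (h3.comp_sub_const s s).congr_of_eventuallyEq (Filter.Eventually.of_forall fun r => ?_)
    simp only
    rw [add_assoc, ← add_smul]; congr 3; ring
  have hB0 : 0 ≤ B := (abs_nonneg _).trans (hB 0)
  have hb : ∀ x, |TT (g1 v) l f x| ≤ B * ((∫ y : EuclideanSpace ℝ (Fin d), 2 * ‖y‖ * gk y) * ‖v‖) := by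
    intro x
    refine (TT.bound (GB_g1 v) hB l x).trans (mul_le_mul_of_nonneg_left ?_ hB0)
    rw [← integral_mul_const]
    refine integral_mono (GB_g1 v).intg_abs (intg_g1n.mul_const _) fun y => ?_
    simp only [g1, abs_mul, abs_neg, Nat.abs_ofNat, abs_of_pos (gk_pos y)]
    have := mul_le_mul_of_nonneg_right (abs_real_inner_le_norm y v) (gk_pos y).le
    linarith
  have := (convex_univ (𝕜 := ℝ) (E := ℝ)).norm_image_sub_le_of_norm_hasDerivWithin_le
    (f := fun s : ℝ => TT gk l f (x + s • v)) (fun s _ => (hd s).hasDerivWithinAt)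
    (C := B / l * (∫ y : EuclideanSpace ℝ (Fin d), 2 * ‖y‖ * gk y) * ‖v‖) (fun s _ => by
      rw [Real.norm_eq_abs, abs_mul, abs_neg, abs_of_pos (by positivity : 0 < 1 / l)]
      calc 1 / l * |TT (g1 v) l f (x + s • v)| ≤ 1 / l * (B * ((∫ y : EuclideanSpace ℝ (Fin d), 2 * ‖y‖ * gk y) * ‖v‖)) := by gcongr; exact hb _
        _ = _ := by ring) (Set.mem_univ 0) (Set.mem_univ 1)
  simpa using this

/-- time (scale) derivative -/
lemma TT.hasDeriv_l {f : EuclideanSpace ℝ (Fin d) → ℝ} (hf : Continuous f) {B : ℝ}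
    (hB : ∀ x, |f x| ≤ B) {l : ℝ} (hl : 0 < l) (x : EuclideanSpace ℝ (Fin d)) :
    HasDerivAt (fun l : ℝ => TT gk l f x) (1 / (2 * l) * ∑ i, TT (g2 i) l f x) l := by
  have e : ∀ r : ℝ, 0 < r → TT gk r f x = ∫ y, ((l / r) ^ d * gk ((l / r) • y)) * f (x + l • y) := by
    intro r hr
    have h1 := Measure.integral_comp_smul (μ := (volume : Measure (EuclideanSpace ℝ (Fin d)))) (fun y => gk y * f (x + r • y)) (l / r)
    have h2 : ∀ y : EuclideanSpace ℝ (Fin d), r • (l / r) • y = l • y := by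
      intro y; rw [smul_smul, mul_div_cancel₀ _ hr.ne']
    simp only [h2, finrank_euclideanSpace, Fintype.card_fin] at h1
    have hp : 0 < (l / r) ^ d := by positivity
    simp_rw [mul_assoc]
    rw [integral_const_mul, h1, abs_of_pos (by positivity), smul_eq_mul, ← mul_assoc, mul_inv_cancel₀ hp.ne', one_mul, TT]
  have hB0 : 0 ≤ B := (abs_nonneg _).trans (hB 0)
  set Z := ∫ y : EuclideanSpace ℝ (Fin d), Real.exp (-‖y‖ ^ 2) with hZ
  have hZ0 : 0 < Z := gauss_pos
  have hdm : ∀ (y : EuclideanSpace ℝ (Fin d)) (m : ℝ), HasDerivAt (fun m : ℝ => m ^ d * gk (m • y))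
      ((d * m ^ (d-1) - 2 * m ^ (d + 1) * ‖y‖ ^ 2) * gk (m • y)) m := by
    intro y m
    have h1 : HasDerivAt (fun m : ℝ => -(m ^ 2 * ‖y‖ ^ 2)) (-(2 * m * ‖y‖ ^ 2)) m := by
      simpa using ((hasDerivAt_pow 2 m).mul_const (‖y‖ ^ 2)).fun_neg
    have h2 := ((hasDerivAt_pow d m).fun_mul (h1.exp.div_const Z))
    have e2 : ∀ m : ℝ, gk (m • y) = Real.exp (-(m ^ 2 * ‖y‖ ^ 2)) / Z := by
      intro m; rw [gk, norm_smul, mul_pow, Real.norm_eq_abs, sq_abs]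
    simp_rw [e2]
    refine h2.congr_deriv ?_
    ring
  have main := (hasDerivAt_integral_of_dominated_loc_of_deriv_le (μ := volume) (𝕜 := ℝ)
    (F := fun (m : ℝ) (y : EuclideanSpace ℝ (Fin d)) => (m ^ d * gk (m • y)) * f (x + l • y))
    (F' := fun (m : ℝ) (y : EuclideanSpace ℝ (Fin d)) => ((d * m ^ (d-1) - 2 * m ^ (d + 1) * ‖y‖ ^ 2) * gk (m • y)) * f (x + l • y)) (x₀ := 1)
    (s := Set.Ioo (1/2) 2) (bound := fun y => (d * 2 ^ (d-1) + 16 * 2 ^ (d+1)) * Real.exp (-(1/8) * ‖y‖ ^ 2) / Z * B)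
    (Ioo_mem_nhds (by norm_num) (by norm_num)) ?_ ?_ ?_ ?_ ?_ ?_).2
  · have h2 : HasDerivAt (fun r : ℝ => l / r) (-(1 / l)) l := by
      have := (hasDerivAt_inv hl.ne').const_mul l
      simp only [← div_eq_mul_inv] at this
      refine this.congr_deriv ?_
      field_simp
    have hll : l / l = 1 := div_self hl.ne'
    rw [← hll] at main
    have := main.comp l h2
    have h3 := this.congr_of_eventuallyEq (f₁ := fun l : ℝ => TT gk l f x) (by
      filter_upwards [Ioi_mem_nhds hl] with r hr using e r hr)
    refine h3.congr_deriv ?_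
    rw [hll]
    have h4 : ∑ i, TT (g2 i) l f x = ∫ y, (4 * ‖y‖ ^ 2 - 2 * d) * gk y * f (x + l • y) := by
      unfold TT
      rw [← integral_finsetSum _ (fun i _ => TT.intg (GB_g2 i) hf hB l x)]
      congr 1; ext y; rw [← Finset.sum_mul, sum_g2]
    rw [h4, ← integral_mul_const, ← integral_const_mul]
    congr 1; ext y
    simp only [one_pow, one_smul]
    field_simp
    ring
  · refine Filter.Eventually.of_forall fun r => Continuous.aestronglyMeasurable ?_
    have := cont_gk (d := d)
    fun_prop
  · simpa using TT.intg GB_gk hf hB l x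
  · refine Continuous.aestronglyMeasurable ?_
    have := cont_gk (d := d)
    fun_prop
  · refine Filter.Eventually.of_forall fun y m hm => ?_
    have hm0 : 0 < m := by linarith [hm.1]
    rw [Real.norm_eq_abs, abs_mul]
    refine mul_le_mul ?_ (hB _) (abs_nonneg _) (by positivity)
    rw [abs_mul, abs_of_pos (gk_pos _), gk, ← mul_div_assoc]
    refine div_le_div_of_nonneg_right ?_ hZ0.le
    have b1 : |(d * m ^ (d-1) - 2 * m ^ (d + 1) * ‖y‖ ^ 2)| ≤ d * 2 ^ (d-1) + 2 * 2 ^ (d+1) * ‖y‖ ^ 2 := by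
      have p1 : m ^ (d-1) ≤ 2 ^ (d-1) := pow_le_pow_left₀ hm0.le hm.2.le _
      have p2 : m ^ (d+1) ≤ 2 ^ (d+1) := pow_le_pow_left₀ hm0.le hm.2.le _
      have q1 : 0 ≤ (d:ℝ) * m ^ (d-1) := by positivity
      have q2 : 0 ≤ 2 * m ^ (d + 1) * ‖y‖ ^ 2 := by positivity
      have r1 : (d:ℝ) * m ^ (d-1) ≤ d * 2 ^ (d-1) := by gcongr
      have r2 : 2 * m ^ (d + 1) * ‖y‖ ^ 2 ≤ 2 * 2 ^ (d + 1) * ‖y‖ ^ 2 := by gcongr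
      rw [abs_le]; constructor <;> linarith
    have b2 : d * 2 ^ (d-1) + 2 * 2 ^ (d+1) * ‖y‖ ^ 2 ≤ (d * 2 ^ (d-1) + 16 * 2 ^ (d+1)) * Real.exp (1/8 * ‖y‖ ^ 2) := by
      have h1 := Real.add_one_le_exp (1/8 * ‖y‖ ^ 2)
      have h2 : 1 ≤ Real.exp (1/8 * ‖y‖ ^ 2) := Real.one_le_exp (by positivity)
      have q1 : 0 ≤ (d:ℝ) * 2 ^ (d-1) := by positivity
      have q2 : (0:ℝ) < 2 ^ (d+1) := by positivity
      nlinarith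
    have b3 : Real.exp (-‖m • y‖ ^ 2) ≤ Real.exp (-(1/4) * ‖y‖ ^ 2) := by
      apply Real.exp_le_exp.2
      rw [norm_smul, mul_pow, Real.norm_eq_abs, sq_abs]
      have : (1/4:ℝ) ≤ m ^ 2 := by nlinarith [hm.1]
      nlinarith [sq_nonneg ‖y‖]
    calc _ ≤ ((d * 2 ^ (d-1) + 16 * 2 ^ (d+1)) * Real.exp (1/8 * ‖y‖ ^ 2)) * Real.exp (-(1/4) * ‖y‖ ^ 2) :=
          mul_le_mul (b1.trans b2) b3 (Real.exp_pos _).le (by positivity)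
      _ = _ := by rw [mul_assoc, ← Real.exp_add]; congr 2; ring
  · exact (((intg_gauss (d := d) (b := 1/8) (by norm_num)).const_mul _).div_const Z).mul_const B
  · exact Filter.Eventually.of_forall fun y m _ => (hdm y m).mul_const _

end heat

section duh
variable {d : ℕ}

/-- forcing term hypotheses -/
structure DH (τ B L : ℝ) (h : ℝ → EuclideanSpace ℝ (Fin d) → ℝ) : Prop where
  cont : Continuous (fun p : ℝ × EuclideanSpace ℝ (Fin d) => h p.1 p.2)
  bd : ∀ t x, |h t x| ≤ B
  lip : ∀ t ∈ Set.Ioo 0 τ, ∀ x v, |h t (x + v) - h t x| ≤ L / √t * ‖v‖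

/-- parabolic length -/
def ell (t θ : ℝ) : ℝ := 2 * √(t * (1 - θ))

lemma ell_pos {t θ : ℝ} (ht : 0 < t) (hθ : θ ∈ Set.Ioo (0:ℝ) 1) : 0 < ell t θ := by
  have : 0 < 1 - θ := by linarith [hθ.2]
  unfold ell; positivity

lemma ell_eq {t θ : ℝ} (ht : 0 < t) : ell t θ = 2 * √t * √(1 - θ) := by
  unfold ell; rw [Real.sqrt_mul ht.le]; ring

lemma ell_sq {t θ : ℝ} (ht : 0 < t) (hθ : θ ∈ Set.Ioo (0:ℝ) 1) : ell t θ ^ 2 = 4 * (t * (1 - θ)) := by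
  have : 0 < 1 - θ := by linarith [hθ.2]
  unfold ell; rw [mul_pow, Real.sq_sqrt (by positivity)]; norm_num

lemma intg_sqrt : IntegrableOn (fun θ : ℝ => 1 / √θ) (Set.Ioo 0 1) := by
  have h := (intervalIntegral.intervalIntegrable_rpow' (a := 0) (b := 1) (r := -(1/2)) (by norm_num)).1
  rw [integrableOn_Ioc_iff_integrableOn_Ioo] at h
  refine h.congr_fun (fun θ hθ => ?_) measurableSet_Ioo
  simp only
  rw [Real.rpow_neg hθ.1.le, Real.sqrt_eq_rpow]; simp

lemma intg_sqrt' : IntegrableOn (fun θ : ℝ => 1 / √(1 - θ)) (Set.Ioo 0 1) := by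
  have h := (intervalIntegral.intervalIntegrable_rpow' (a := 0) (b := 1) (r := -(1/2)) (by norm_num)).comp_sub_left 1
  have h := h.symm.1
  simp only [sub_self, sub_zero] at h
  rw [integrableOn_Ioc_iff_integrableOn_Ioo] at h
  refine h.congr_fun (fun θ hθ => ?_) measurableSet_Ioo
  have : 0 < 1 - θ := by linarith [hθ.2]
  simp only
  rw [Real.rpow_neg this.le, Real.sqrt_eq_rpow]; simp

lemma sqrt2_le {a b : ℝ} (ha : 0 < a) (hb : 0 < b) : 1 / (√a * √b) ≤ 1 / √(a + b) * (1 / √a + 1 / √b) := by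
  have h1 := Real.sqrt_pos.2 ha
  have h2 := Real.sqrt_pos.2 hb
  have h3 := Real.sqrt_pos.2 (add_pos ha hb)
  have h4 : √(a + b) ≤ √a + √b := Real.sqrt_le_iff.2 ⟨by positivity, by
    nlinarith [Real.sq_sqrt ha.le, Real.sq_sqrt hb.le]⟩
  have : 1 / √(a + b) * (1 / √a + 1 / √b) = (√a + √b) / √(a+b) * (1 / (√a * √b)) := by field_simp; ring
  rw [this]
  have h5 : 1 ≤ (√a + √b) / √(a+b) := by rw [one_le_div h3]; exact h4
  have h6 : 0 < 1 / (√a * √b) := by positivity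
  nlinarith

lemma intg_sqrt2 : IntegrableOn (fun θ : ℝ => 1 / (√θ * √(1 - θ))) (Set.Ioo 0 1) := by
  refine Integrable.mono' (intg_sqrt.add intg_sqrt') ?_ ?_
  · refine ContinuousOn.aestronglyMeasurable ?_ measurableSet_Ioo
    refine ContinuousOn.div continuousOn_const (by fun_prop) fun θ hθ => ?_
    have : 0 < 1 - θ := by linarith [hθ.2]
    have := hθ.1
    positivity
  · refine ae_restrict_of_forall_mem measurableSet_Ioo fun θ hθ => ?_
    have h1 : 0 < 1 - θ := by linarith [hθ.2]
    have h2 := hθ.1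
    rw [Real.norm_eq_abs, abs_of_nonneg (by positivity)]
    have := sqrt2_le h2 h1
    simpa using this

lemma thetaD {Φ Φ' : ℝ → EuclideanSpace ℝ (Fin d) → ℝ} {v : EuclideanSpace ℝ (Fin d)}
    (hd : ∀ θ ∈ Set.Ioo (0:ℝ) 1, ∀ x, HasDerivAt (fun s : ℝ => Φ θ (x + s • v)) (Φ' θ x) 0)
    (hc : ∀ x, ContinuousOn (fun θ => Φ θ x) (Set.Ioo 0 1)) (hc' : ∀ x, ContinuousOn (fun θ => Φ' θ x) (Set.Ioo 0 1))
    {b0 b : ℝ → ℝ} (i0 : IntegrableOn b0 (Set.Ioo 0 1)) (i1 : IntegrableOn b (Set.Ioo 0 1))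
    (h0 : ∀ θ ∈ Set.Ioo (0:ℝ) 1, ∀ x, |Φ θ x| ≤ b0 θ) (h1 : ∀ θ ∈ Set.Ioo (0:ℝ) 1, ∀ x, |Φ' θ x| ≤ b θ)
    (x : EuclideanSpace ℝ (Fin d)) :
    HasDerivAt (fun s : ℝ => ∫ θ in Set.Ioo (0:ℝ) 1, Φ θ (x + s • v)) (∫ θ in Set.Ioo (0:ℝ) 1, Φ' θ x) 0 := by
  have hds : ∀ θ ∈ Set.Ioo (0:ℝ) 1, ∀ s : ℝ, HasDerivAt (fun s : ℝ => Φ θ (x + s • v)) (Φ' θ (x + s • v)) s := by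
    intro θ hθ s
    have h3 : HasDerivAt (fun r : ℝ => Φ θ (x + s • v + r • v)) (Φ' θ (x + s • v)) (s - s) := by
      rw [sub_self]; exact hd θ hθ _
    refine (h3.comp_sub_const s s).congr_of_eventuallyEq (Filter.Eventually.of_forall fun r => ?_)
    simp only
    rw [add_assoc, ← add_smul]; congr 3; ring
  have main := (hasDerivAt_integral_of_dominated_loc_of_deriv_le (μ := volume.restrict (Set.Ioo (0:ℝ) 1)) (𝕜 := ℝ)
    (F := fun (s : ℝ) (θ : ℝ) => Φ θ (x + s • v))
    (F' := fun (s : ℝ) (θ : ℝ) => Φ' θ (x + s • v)) (x₀ := 0)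
    (s := Set.univ) (bound := b) Filter.univ_mem ?_ ?_ ?_ ?_ i1 ?_).2
  · simpa using main
  · exact Filter.Eventually.of_forall fun s => (hc _).aestronglyMeasurable measurableSet_Ioo
  · exact Integrable.mono' i0 ((hc _).aestronglyMeasurable measurableSet_Ioo) (ae_restrict_of_forall_mem measurableSet_Ioo fun θ hθ => h0 θ hθ _)
  · exact (hc' _).aestronglyMeasurable measurableSet_Ioo
  · exact ae_restrict_of_forall_mem measurableSet_Ioo fun θ hθ s _ => h1 θ hθ _
  · exact ae_restrict_of_forall_mem measurableSet_Ioo fun θ hθ s _ => hds θ hθ s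

lemma thetaC {Ψ : ℝ → ℝ → EuclideanSpace ℝ (Fin d) → ℝ} {τ : ℝ}
    (hc : ∀ θ ∈ Set.Ioo (0:ℝ) 1, ContinuousOn (fun p : ℝ × EuclideanSpace ℝ (Fin d) => Ψ θ p.1 p.2) (Set.Ioo 0 τ ×ˢ Set.univ))
    (hm : ∀ t ∈ Set.Ioo 0 τ, ∀ x, ContinuousOn (fun θ => Ψ θ t x) (Set.Ioo 0 1)) 
    {b : ℝ → ℝ} (i1 : IntegrableOn b (Set.Ioo 0 1)) (h1 : ∀ θ ∈ Set.Ioo (0:ℝ) 1, ∀ t ∈ Set.Ioo 0 τ, ∀ x, |Ψ θ t x| ≤ b θ) :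
    ContinuousOn (fun p : ℝ × EuclideanSpace ℝ (Fin d) => ∫ θ in Set.Ioo (0:ℝ) 1, Ψ θ p.1 p.2) (Set.Ioo 0 τ ×ˢ Set.univ) := by
  refine continuousOn_of_dominated (bound := b) ?_ ?_ i1 ?_
  · rintro ⟨t, x⟩ ⟨ht, -⟩
    exact (hm t ht x).aestronglyMeasurable measurableSet_Ioo
  · rintro ⟨t, x⟩ ⟨ht, -⟩
    exact ae_restrict_of_forall_mem measurableSet_Ioo fun θ hθ => h1 θ hθ t ht x
  · exact ae_restrict_of_forall_mem measurableSet_Ioo fun θ hθ => hc θ hθ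

variable {τ B L : ℝ} {h : ℝ → EuclideanSpace ℝ (Fin d) → ℝ}

lemma DH.B0 (hh : DH τ B L h) : 0 ≤ B := (abs_nonneg _).trans (hh.bd 0 0)
lemma DH.cx (hh : DH τ B L h) (t : ℝ) : Continuous (h t) := by
  have := hh.cont
  exact this.comp (by fun_prop : Continuous fun x => (t, x))

lemma DH.cT (hh : DH τ B L h) {κ : EuclideanSpace ℝ (Fin d) → ℝ} (hk : GB κ) :
    Continuous (fun p : ℝ × ℝ × EuclideanSpace ℝ (Fin d) => TT κ (ell p.2.1 p.1) (h (p.2.1 * p.1)) p.2.2) := by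
  rw [← continuousOn_univ]
  refine TT.contOn (B := B) hk (fun p _ x => hh.bd _ _) (fun p _ => hh.cx _) (fun y => Continuous.continuousOn ?_)
  have := hh.cont
  have e : (fun p : ℝ × ℝ × EuclideanSpace ℝ (Fin d) => h (p.2.1 * p.1) (p.2.2 + ell p.2.1 p.1 • y)) =
    (fun p : ℝ × EuclideanSpace ℝ (Fin d) => h p.1 p.2) ∘ (fun p : ℝ × ℝ × EuclideanSpace ℝ (Fin d) => (p.2.1 * p.1, p.2.2 + ell p.2.1 p.1 • y)) := rfl
  rw [e]
  refine this.comp ?_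
  unfold ell
  fun_prop

/-- the Duhamel term and its derivatives -/
def Du (h : ℝ → EuclideanSpace ℝ (Fin d) → ℝ) (t : ℝ) (x : EuclideanSpace ℝ (Fin d)) : ℝ :=
  t * ∫ θ in Set.Ioo (0:ℝ) 1, TT gk (ell t θ) (h (t * θ)) x
def Du1 (h : ℝ → EuclideanSpace ℝ (Fin d) → ℝ) (t : ℝ) (x : EuclideanSpace ℝ (Fin d)) (i : Fin d) : ℝ :=
  t * ∫ θ in Set.Ioo (0:ℝ) 1, -(1 / ell t θ) * TT (g1 (eb i)) (ell t θ) (h (t * θ)) x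
def Du2 (h : ℝ → EuclideanSpace ℝ (Fin d) → ℝ) (t : ℝ) (x : EuclideanSpace ℝ (Fin d)) (i : Fin d) : ℝ :=
  t * ∫ θ in Set.Ioo (0:ℝ) 1, (1 / ell t θ ^ 2) * TT (g2 i) (ell t θ) (h (t * θ)) x

lemma Du.cont (hh : DH τ B L h) : Continuous (fun p : ℝ × EuclideanSpace ℝ (Fin d) => Du h p.1 p.2) := by
  unfold Du
  refine continuous_fst.mul ?_
  refine continuous_of_dominated (bound := fun _ => B * ∫ y : EuclideanSpace ℝ (Fin d), |gk y|) ?_ ?_ ?_ ?_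
  · intro p
    have := hh.cT GB_gk
    exact Continuous.aestronglyMeasurable (this.comp (by fun_prop : Continuous fun θ : ℝ => (θ, p.1, p.2)))
  · intro p
    exact Filter.Eventually.of_forall fun θ => TT.bound GB_gk (hh.bd _) _ _
  · exact integrable_const _
  · refine Filter.Eventually.of_forall fun θ => ?_
    exact (hh.cT GB_gk).comp (by fun_prop : Continuous fun p : ℝ × EuclideanSpace ℝ (Fin d) => (θ, p.1, p.2))

lemma gk_abs_int : ∫ y : EuclideanSpace ℝ (Fin d), |gk y| = 1 := by
  simp_rw [abs_of_pos (gk_pos _)]; exact gk_int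

lemma Du.bound (hh : DH τ B L h) {t : ℝ} (ht : 0 ≤ t) (x : EuclideanSpace ℝ (Fin d)) : |Du h t x| ≤ t * B := by
  unfold Du
  rw [abs_mul, abs_of_nonneg ht]
  refine mul_le_mul_of_nonneg_left ?_ ht
  have := norm_setIntegral_le_of_norm_le_const (μ := volume) (s := Set.Ioo (0:ℝ) 1) (f := fun θ => TT gk (ell t θ) (h (t * θ)) x) (C := B)
    (by simp) (fun θ _ => by
      have := TT.bound GB_gk (hh.bd (t * θ)) (ell t θ) x
      rwa [gk_abs_int, mul_one] at this)
  simpa using this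

/-- bounding constants -/
def M1 (d : ℕ) : ℝ := ∫ y : EuclideanSpace ℝ (Fin d), 2 * ‖y‖ * gk y
def M2 {d : ℕ} (i : Fin d) : ℝ := ∫ y, |g2 i y| * ‖y‖
def J1 : ℝ := ∫ θ in Set.Ioo (0:ℝ) 1, 1 / √(1 - θ)
def J2 : ℝ := ∫ θ in Set.Ioo (0:ℝ) 1, 1 / (√θ * √(1 - θ))

lemma M1_nonneg (d : ℕ) : 0 ≤ M1 d := integral_nonneg fun y => by have := gk_pos y; positivity
lemma M2_nonneg (i : Fin d) : 0 ≤ M2 i := integral_nonneg fun y => by positivity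
lemma J1_nonneg : 0 ≤ J1 := integral_nonneg fun y => by positivity
lemma J2_nonneg : 0 ≤ J2 := integral_nonneg fun y => by positivity

lemma Du.lip (hh : DH τ B L h) {t : ℝ} (ht : 0 < t) (x v : EuclideanSpace ℝ (Fin d)) :
    |Du h t (x + v) - Du h t x| ≤ B * √t * (M1 d * J1) * ‖v‖ := by
  have hst := Real.sqrt_pos.2 ht
  have ii : ∀ x, IntegrableOn (fun θ => TT gk (ell t θ) (h (t * θ)) x) (Set.Ioo 0 1) := by
    intro x
    refine Integrable.mono' (integrable_const (B * ∫ y : EuclideanSpace ℝ (Fin d), |gk y|)) ?_ (Filter.Eventually.of_forall fun θ => TT.bound GB_gk (hh.bd _) _ _)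
    exact Continuous.aestronglyMeasurable ((hh.cT GB_gk).comp (by fun_prop : Continuous fun θ : ℝ => (θ, t, x)))
  unfold Du
  rw [← mul_sub, ← integral_sub (ii _) (ii _), abs_mul, abs_of_pos ht]
  have h1 : |∫ θ in Set.Ioo (0:ℝ) 1, (TT gk (ell t θ) (h (t * θ)) (x + v) - TT gk (ell t θ) (h (t * θ)) x)| ≤
      ∫ θ in Set.Ioo (0:ℝ) 1, (B / √t * M1 d * ‖v‖) * (1 / √(1 - θ)) := by
    rw [← Real.norm_eq_abs]
    refine norm_integral_le_of_norm_le (intg_sqrt'.const_mul _) (ae_restrict_of_forall_mem measurableSet_Ioo fun θ hθ => ?_)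
    have h2 := TT.lip1 (hh.cx (t * θ)) (hh.bd _) (ell_pos ht hθ) x v
    refine h2.trans ?_
    have h3 : 0 < √(1 - θ) := Real.sqrt_pos.2 (by linarith [hθ.2])
    have h4 := hh.B0
    have h5 := M1_nonneg d
    rw [ell_eq ht, ← M1]
    have e : B / √t * M1 d * ‖v‖ * (1 / √(1 - θ)) = 2 * (B / (2 * √t * √(1 - θ)) * M1 d * ‖v‖) := by
      field_simp
    rw [e]
    have : 0 ≤ B / (2 * √t * √(1 - θ)) * M1 d * ‖v‖ := by positivity
    linarith
  rw [integral_const_mul, ← J1] at h1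
  calc _ ≤ t * (B / √t * M1 d * ‖v‖ * J1) := mul_le_mul_of_nonneg_left h1 ht.le
    _ = (√t * √t) * (B / √t * M1 d * ‖v‖ * J1) := by rw [Real.mul_self_sqrt ht.le]
    _ = _ := by field_simp

lemma ph1_bd (hh : DH τ B L h) {t θ : ℝ} (ht : 0 < t) (hθ : θ ∈ Set.Ioo (0:ℝ) 1) (x : EuclideanSpace ℝ (Fin d)) (i : Fin d) :
    |-(1 / ell t θ) * TT (g1 (eb i)) (ell t θ) (h (t * θ)) x| ≤ (B * ∫ y : EuclideanSpace ℝ (Fin d), |g1 (eb i) y|) / √t * (1 / √(1 - θ)) := by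
  have hst := Real.sqrt_pos.2 ht
  have h3 : 0 < √(1 - θ) := Real.sqrt_pos.2 (by linarith [hθ.2])
  rw [abs_mul, abs_neg, abs_of_pos (by have := ell_pos ht hθ; positivity)]
  have h1 := TT.bound (GB_g1 (eb i)) (hh.bd (t * θ)) (ell t θ) x
  have h0 := (abs_nonneg _).trans h1
  rw [ell_eq ht] at *
  calc _ ≤ 1 / (2 * √t * √(1 - θ)) * (B * ∫ y : EuclideanSpace ℝ (Fin d), |g1 (eb i) y|) := by gcongr
    _ = (1/2) * ((B * ∫ y : EuclideanSpace ℝ (Fin d), |g1 (eb i) y|) / √t * (1 / √(1 - θ))) := by field_simp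
    _ ≤ _ := by
      have : 0 ≤ (B * ∫ y : EuclideanSpace ℝ (Fin d), |g1 (eb i) y|) / √t * (1 / √(1 - θ)) := by positivity
      linarith

lemma ph2_bd (hh : DH τ B L h) (hL : 0 ≤ L) {t θ : ℝ} (ht : t ∈ Set.Ioo 0 τ) (hθ : θ ∈ Set.Ioo (0:ℝ) 1) (x : EuclideanSpace ℝ (Fin d)) (i : Fin d) :
    |(1 / ell t θ ^ 2) * TT (g2 i) (ell t θ) (h (t * θ)) x| ≤ (L * M2 i / t) * (1 / (√θ * √(1 - θ))) := by
  have ht0 := ht.1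
  have hst := Real.sqrt_pos.2 ht0
  have h3 : 0 < √(1 - θ) := Real.sqrt_pos.2 (by linarith [hθ.2])
  have h4 : 0 < √θ := Real.sqrt_pos.2 hθ.1
  have hl := ell_pos ht0 hθ
  have hM := M2_nonneg i
  rw [abs_mul, abs_of_pos (by positivity)]
  have h1 := TT.lip2 (i := i) (hh.cx (t * θ)) (hh.bd _) (hh.lip (t * θ) ⟨mul_pos ht0 hθ.1, by nlinarith [ht.2, hθ.2]⟩) hl.le x
  rw [← M2] at h1
  calc _ ≤ 1 / ell t θ ^ 2 * (L / √(t * θ) * ell t θ * M2 i) := by gcongr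
    _ = L * M2 i / (√(t * θ) * ell t θ) := by
      have : 0 < √(t * θ) := Real.sqrt_pos.2 (mul_pos ht0 hθ.1)
      field_simp
    _ = (1/2) * (L * M2 i / (√t * √t) * (1 / (√θ * √(1 - θ)))) := by
      rw [ell_eq ht0, Real.sqrt_mul ht0.le]
      field_simp
    _ = (1/2) * (L * M2 i / t * (1 / (√θ * √(1 - θ)))) := by rw [Real.mul_self_sqrt ht0.le]
    _ ≤ _ := by
      have : 0 ≤ L * M2 i / t * (1 / (√θ * √(1 - θ))) := by positivity
      linarith

lemma cell (t : ℝ) : Continuous (fun θ => ell t θ) := by unfold ell; fun_prop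
lemma cell' (θ : ℝ) : Continuous (fun t => ell t θ) := by unfold ell; fun_prop

lemma Du.d1 (hh : DH τ B L h) {t : ℝ} (ht : 0 < t) (x : EuclideanSpace ℝ (Fin d)) (i : Fin d) :
    HasDerivAt (fun s : ℝ => Du h t (x + s • eb i)) (Du1 h t x i) 0 := by
  unfold Du Du1
  refine HasDerivAt.const_mul t ?_
  refine thetaD (Φ := fun θ x => TT gk (ell t θ) (h (t * θ)) x) (Φ' := fun θ x => -(1 / ell t θ) * TT (g1 (eb i)) (ell t θ) (h (t * θ)) x)
    (fun θ hθ x => TT.hasDeriv GB_gk (GB_g1 (eb i)) (eb i) (gk_deriv (eb i)) (hh.cx _) (hh.bd _) (ell_pos ht hθ) x) ?_ ?_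
    (integrable_const (B * ∫ y : EuclideanSpace ℝ (Fin d), |gk y|)) (intg_sqrt'.const_mul _) (fun θ _ x => TT.bound GB_gk (hh.bd _) _ _)
    (fun θ hθ x => ph1_bd hh ht hθ x i) x
  · intro x
    exact ((hh.cT GB_gk).comp (by fun_prop : Continuous fun θ : ℝ => (θ, t, x))).continuousOn
  · intro x
    have h1 := ((hh.cT (GB_g1 (eb i))).comp (by fun_prop : Continuous fun θ : ℝ => (θ, t, x))).continuousOn (s := Set.Ioo 0 1)
    exact ((continuousOn_const.div (cell t).continuousOn fun θ hθ => (ell_pos ht hθ).ne').neg).mul h1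

lemma Du.d2 (hh : DH τ B L h) (hL : 0 ≤ L) {t : ℝ} (ht : t ∈ Set.Ioo 0 τ) (x : EuclideanSpace ℝ (Fin d)) (i : Fin d) :
    HasDerivAt (fun s : ℝ => Du1 h t (x + s • eb i) i) (Du2 h t x i) 0 := by
  unfold Du1 Du2
  refine HasDerivAt.const_mul t ?_
  refine thetaD (Φ := fun θ x => -(1 / ell t θ) * TT (g1 (eb i)) (ell t θ) (h (t * θ)) x)
    (Φ' := fun θ x => (1 / ell t θ ^ 2) * TT (g2 i) (ell t θ) (h (t * θ)) x)
    (fun θ hθ x => ?_) ?_ ?_ (intg_sqrt'.const_mul _) (intg_sqrt2.const_mul _) (fun θ hθ x => ph1_bd hh ht.1 hθ x i)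
    (fun θ hθ x => ph2_bd hh hL ht hθ x i) x
  · have := (TT.hasDeriv (GB_g1 (eb i)) (GB_g2 i) (eb i) (g1_deriv i) (hh.cx (t * θ)) (hh.bd _) (ell_pos ht.1 hθ) x).const_mul (-(1 / ell t θ))
    refine this.congr_deriv ?_
    have := ell_pos ht.1 hθ
    field_simp
  · intro x
    have h1 := ((hh.cT (GB_g1 (eb i))).comp (by fun_prop : Continuous fun θ : ℝ => (θ, t, x))).continuousOn (s := Set.Ioo 0 1)
    exact ((continuousOn_const.div (cell t).continuousOn fun θ hθ => (ell_pos ht.1 hθ).ne').neg).mul h1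
  · intro x
    have h1 := ((hh.cT (GB_g2 i)).comp (by fun_prop : Continuous fun θ : ℝ => (θ, t, x))).continuousOn (s := Set.Ioo 0 1)
    exact (continuousOn_const.div ((cell t).pow 2).continuousOn fun θ hθ => (pow_pos (ell_pos ht.1 hθ) 2).ne').mul h1

lemma Du2.bound (hh : DH τ B L h) (hL : 0 ≤ L) {t : ℝ} (ht : t ∈ Set.Ioo 0 τ) (x : EuclideanSpace ℝ (Fin d)) (i : Fin d) :
    |Du2 h t x i| ≤ L * M2 i * J2 := by
  have ht0 := ht.1
  unfold Du2
  rw [abs_mul, abs_of_pos ht.1]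
  have h1 : |∫ θ in Set.Ioo (0:ℝ) 1, (1 / ell t θ ^ 2) * TT (g2 i) (ell t θ) (h (t * θ)) x| ≤ ∫ θ in Set.Ioo (0:ℝ) 1, (L * M2 i / t) * (1 / (√θ * √(1 - θ))) := by
    rw [← Real.norm_eq_abs]
    exact norm_integral_le_of_norm_le (intg_sqrt2.const_mul _) (ae_restrict_of_forall_mem measurableSet_Ioo fun θ hθ => ph2_bd hh hL ht hθ x i)
  rw [integral_const_mul, ← J2] at h1
  calc _ ≤ t * (L * M2 i / t * J2) := mul_le_mul_of_nonneg_left h1 ht0.le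
    _ = _ := by field_simp

lemma Du1.cont (hh : DH τ B L h) (i : Fin d) :
    ContinuousOn (fun p : ℝ × EuclideanSpace ℝ (Fin d) => Du1 h p.1 p.2 i) (Set.Ioo 0 τ ×ˢ Set.univ) := by
  unfold Du1
  have key : ContinuousOn (fun p : ℝ × EuclideanSpace ℝ (Fin d) => ∫ θ in Set.Ioo (0:ℝ) 1, √p.1 * (-(1 / ell p.1 θ) * TT (g1 (eb i)) (ell p.1 θ) (h (p.1 * θ)) p.2)) (Set.Ioo 0 τ ×ˢ Set.univ) := by
    refine thetaC (Ψ := fun θ t x => √t * (-(1 / ell t θ) * TT (g1 (eb i)) (ell t θ) (h (t * θ)) x)) ?_ ?_ (intg_sqrt'.const_mul (B * ∫ y : EuclideanSpace ℝ (Fin d), |g1 (eb i) y|)) ?_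
    · intro θ hθ
      have h1 := ((hh.cT (GB_g1 (eb i))).comp (by fun_prop : Continuous fun p : ℝ × EuclideanSpace ℝ (Fin d) => (θ, p.1, p.2))).continuousOn (s := (Set.Ioo 0 τ ×ˢ Set.univ))
      refine ((Real.continuous_sqrt.comp continuous_fst).continuousOn).mul (((continuousOn_const.div ((cell' θ).comp continuous_fst).continuousOn ?_).neg).mul h1)
      rintro ⟨t, x⟩ ⟨ht, -⟩
      exact (ell_pos ht.1 hθ).ne'
    · intro t ht x
      have h1 := ((hh.cT (GB_g1 (eb i))).comp (by fun_prop : Continuous fun θ : ℝ => (θ, t, x))).continuousOn (s := Set.Ioo 0 1)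
      exact continuousOn_const.mul (((continuousOn_const.div (cell t).continuousOn fun θ hθ => (ell_pos ht.1 hθ).ne').neg).mul h1)
    · intro θ hθ t ht x
      have hst := Real.sqrt_pos.2 ht.1
      rw [abs_mul, abs_of_pos hst]
      refine (mul_le_mul_of_nonneg_left (ph1_bd hh ht.1 hθ x i) hst.le).trans (le_of_eq ?_)
      field_simp
  refine (((Real.continuous_sqrt.comp continuous_fst).continuousOn).mul key).congr ?_
  rintro ⟨t, x⟩ ⟨ht, -⟩
  simp only [Function.comp, Pi.mul_apply]
  rw [integral_const_mul, ← mul_assoc, Real.mul_self_sqrt ht.1.le]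

lemma Du2.cont (hh : DH τ B L h) (hL : 0 ≤ L) (i : Fin d) :
    ContinuousOn (fun p : ℝ × EuclideanSpace ℝ (Fin d) => Du2 h p.1 p.2 i) (Set.Ioo 0 τ ×ˢ Set.univ) := by
  unfold Du2
  have key : ContinuousOn (fun p : ℝ × EuclideanSpace ℝ (Fin d) => ∫ θ in Set.Ioo (0:ℝ) 1, p.1 * ((1 / ell p.1 θ ^ 2) * TT (g2 i) (ell p.1 θ) (h (p.1 * θ)) p.2)) (Set.Ioo 0 τ ×ˢ Set.univ) := by
    refine thetaC (Ψ := fun θ t x => t * ((1 / ell t θ ^ 2) * TT (g2 i) (ell t θ) (h (t * θ)) x)) ?_ ?_ (intg_sqrt2.const_mul (L * M2 i)) ?_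
    · intro θ hθ
      have h1 := ((hh.cT (GB_g2 i)).comp (by fun_prop : Continuous fun p : ℝ × EuclideanSpace ℝ (Fin d) => (θ, p.1, p.2))).continuousOn (s := (Set.Ioo 0 τ ×ˢ Set.univ))
      refine continuousOn_fst.mul ((continuousOn_const.div (((cell' θ).comp continuous_fst).pow 2).continuousOn ?_).mul h1)
      rintro ⟨t, x⟩ ⟨ht, -⟩
      exact (pow_pos (ell_pos ht.1 hθ) 2).ne'
    · intro t ht x
      have h1 := ((hh.cT (GB_g2 i)).comp (by fun_prop : Continuous fun θ : ℝ => (θ, t, x))).continuousOn (s := Set.Ioo 0 1)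
      exact continuousOn_const.mul ((continuousOn_const.div ((cell t).pow 2).continuousOn fun θ hθ => (pow_pos (ell_pos ht.1 hθ) 2).ne').mul h1)
    · intro θ hθ t ht x
      have ht0 := ht.1
      rw [abs_mul, abs_of_pos ht.1]
      refine (mul_le_mul_of_nonneg_left (ph2_bd hh hL ht hθ x i) ht.1.le).trans (le_of_eq ?_)
      field_simp
  refine key.congr ?_
  rintro ⟨t, x⟩ ⟨ht, -⟩
  simp only
  rw [integral_const_mul]

end duh

section duht
variable {d : ℕ}

lemma TT_zero (f : EuclideanSpace ℝ (Fin d) → ℝ) (x : EuclideanSpace ℝ (Fin d)) : TT gk 0 f x = f x := by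
  unfold TT; simp only [zero_smul, add_zero]; rw [integral_mul_const, gk_int, one_mul]

lemma P_dt {f : EuclideanSpace ℝ (Fin d) → ℝ} (hf : Continuous f) {B : ℝ}
    (hB : ∀ x, |f x| ≤ B) {σ : ℝ} (hσ : 0 < σ) (x : EuclideanSpace ℝ (Fin d)) :
    HasDerivAt (fun σ : ℝ => TT gk (2 * √σ) f x) (1 / (4 * σ) * ∑ i, TT (g2 i) (2 * √σ) f x) σ := by
  have hs := Real.sqrt_pos.2 hσ
  have h1 := TT.hasDeriv_l hf hB (l := 2 * √σ) (by positivity) x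
  have h2 := (Real.hasDerivAt_sqrt hσ.ne').const_mul 2
  have := HasDerivAt.comp σ h1 h2
  refine this.congr_deriv ?_
  have e : σ = √σ * √σ := (Real.mul_self_sqrt hσ.le).symm
  have : 1 / (4 * σ) = 1 / (2 * (2 * √σ)) * (2 * (1 / (2 * √σ))) := by
    conv_lhs => rw [e]
    field_simp; norm_num
  rw [this]; ring

lemma intg_sqrtr {r : ℝ} : IntegrableOn (fun θ : ℝ => 1 / √θ) (Set.Ioo 0 r) := by
  rcases le_or_gt r 0 with hr | hr
  · rw [Set.Ioo_eq_empty (by linarith)]; exact integrableOn_empty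
  have h := (intervalIntegral.intervalIntegrable_rpow' (a := 0) (b := r) (r := -(1/2)) (by norm_num)).1
  rw [integrableOn_Ioc_iff_integrableOn_Ioo] at h
  refine h.congr_fun (fun θ hθ => ?_) measurableSet_Ioo
  simp only
  rw [Real.rpow_neg hθ.1.le, Real.sqrt_eq_rpow]; simp

lemma intg_sqrtr' {r : ℝ} : IntegrableOn (fun θ : ℝ => 1 / √(r - θ)) (Set.Ioo 0 r) := by
  have h := (intervalIntegral.intervalIntegrable_rpow' (a := 0) (b := r) (r := -(1/2)) (by norm_num)).comp_sub_left r
  have h := h.symm.1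
  simp only [sub_self, sub_zero] at h
  rw [integrableOn_Ioc_iff_integrableOn_Ioo] at h
  refine h.congr_fun (fun θ hθ => ?_) measurableSet_Ioo
  have : 0 < r - θ := by linarith [hθ.2]
  simp only
  rw [Real.rpow_neg this.le, Real.sqrt_eq_rpow]; simp

lemma intg_sqrtr2 {r : ℝ} : IntegrableOn (fun s : ℝ => 1 / (√s * √(r - s))) (Set.Ioo 0 r) := by
  refine Integrable.mono' ((intg_sqrtr.add intg_sqrtr').const_mul (1 / √r)) ?_ ?_
  · refine ContinuousOn.aestronglyMeasurable ?_ measurableSet_Ioo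
    refine ContinuousOn.div continuousOn_const (by fun_prop) fun θ hθ => ?_
    have : 0 < r - θ := by linarith [hθ.2]
    have := hθ.1
    positivity
  · refine ae_restrict_of_forall_mem measurableSet_Ioo fun θ hθ => ?_
    have h1 : 0 < r - θ := by linarith [hθ.2]
    have h2 := hθ.1
    rw [Real.norm_eq_abs, abs_of_nonneg (by positivity)]
    have := sqrt2_le h2 h1
    simpa using this

lemma scale_int {r : ℝ} (hr : 0 < r) (G : ℝ → ℝ) : r * ∫ θ in Set.Ioo (0:ℝ) 1, G (r * θ) = ∫ s in Set.Ioo 0 r, G s := by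
  rw [← integral_Ioc_eq_integral_Ioo, ← integral_Ioc_eq_integral_Ioo, ← intervalIntegral.integral_of_le zero_le_one,
    ← intervalIntegral.integral_of_le hr.le, intervalIntegral.mul_integral_comp_mul_left]
  simp

/-- time derivative kernel -/
def aa (f : EuclideanSpace ℝ (Fin d) → ℝ) (x : EuclideanSpace ℝ (Fin d)) (σ : ℝ) : ℝ := 1 / (4 * σ) * ∑ i, TT (g2 i) (2 * √σ) f x

lemma aa_bound {f : EuclideanSpace ℝ (Fin d) → ℝ} (hf : Continuous f) {B Lp : ℝ}
    (hB : ∀ x, |f x| ≤ B) (hL : ∀ x v, |f (x + v) - f x| ≤ Lp * ‖v‖) {σ : ℝ} (hσ : 0 < σ) (x : EuclideanSpace ℝ (Fin d)) :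
    |aa f x σ| ≤ Lp * (∑ i : Fin d, M2 i) / 2 * (1 / √σ) := by
  have hs := Real.sqrt_pos.2 hσ
  unfold aa
  rw [abs_mul, abs_of_pos (by positivity)]
  have h1 : |∑ i, TT (g2 i) (2 * √σ) f x| ≤ ∑ i, Lp * (2 * √σ) * M2 i :=
    (Finset.abs_sum_le_sum_abs _ _).trans (Finset.sum_le_sum fun i _ => TT.lip2 hf hB hL (by positivity) x)
  rw [← Finset.mul_sum] at h1
  have e : σ = √σ * √σ := (Real.mul_self_sqrt hσ.le).symm
  calc _ ≤ 1 / (4 * σ) * (Lp * (2 * √σ) * ∑ i : Fin d, M2 i) := by gcongr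
    _ = 1 / (4 * (√σ * √σ)) * (Lp * (2 * √σ) * ∑ i : Fin d, M2 i) := by rw [← e]
    _ = _ := by field_simp; ring

lemma cTs {f : EuclideanSpace ℝ (Fin d) → ℝ} (hf : Continuous f) {B : ℝ} (hB : ∀ x, |f x| ≤ B) {κ : EuclideanSpace ℝ (Fin d) → ℝ} (hk : GB κ) :
    Continuous (fun p : ℝ × EuclideanSpace ℝ (Fin d) => TT κ (2 * √p.1) f p.2) := by
  rw [← continuousOn_univ]
  refine TT.contOn (B := B) (H := fun _ => f) hk (fun p _ x => hB _) (fun p _ => hf) (fun y => Continuous.continuousOn ?_)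
  fun_prop

lemma aa_cont {f : EuclideanSpace ℝ (Fin d) → ℝ} (hf : Continuous f) {B : ℝ} (hB : ∀ x, |f x| ≤ B) :
    ContinuousOn (fun p : ℝ × EuclideanSpace ℝ (Fin d) => aa f p.2 p.1) (Set.Ioi 0 ×ˢ Set.univ) := by
  unfold aa
  refine ContinuousOn.mul (continuousOn_const.div (by fun_prop) ?_) (continuousOn_finsetSum _ fun i _ => (cTs hf hB (GB_g2 i)).continuousOn)
  rintro ⟨t, x⟩ ⟨ht, -⟩
  have : (0:ℝ) < t := ht
  positivity

lemma P_int {f : EuclideanSpace ℝ (Fin d) → ℝ} (hf : Continuous f) {B Lp : ℝ}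
    (hB : ∀ x, |f x| ≤ B) (hL : ∀ x v, |f (x + v) - f x| ≤ Lp * ‖v‖) {σ : ℝ} (hσ : 0 < σ) (x : EuclideanSpace ℝ (Fin d)) :
    TT gk (2 * √σ) f x = f x + ∫ r in (0:ℝ)..σ, aa f x r := by
  have := intervalIntegral.integral_eq_sub_of_hasDerivAt_of_le (f := fun σ : ℝ => TT gk (2 * √σ) f x) (f' := aa f x) hσ.le ?_ ?_ ?_
  · rw [this]; simp [TT_zero]
  · exact ((cTs hf hB GB_gk).comp (by fun_prop : Continuous fun s : ℝ => (s, x))).continuousOn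
  · intro s hs
    exact P_dt hf hB hs.1 x
  · rw [intervalIntegrable_iff_integrableOn_Ioo_of_le hσ.le]
    refine Integrable.mono' (intg_sqrtr.const_mul (Lp * (∑ i : Fin d, M2 i) / 2)) ?_ ?_
    · refine ContinuousOn.aestronglyMeasurable ?_ measurableSet_Ioo
      exact (aa_cont hf hB).comp (by fun_prop : Continuous fun s : ℝ => (s, x)).continuousOn (fun s hs => ⟨hs.1, trivial⟩)
    · exact ae_restrict_of_forall_mem measurableSet_Ioo fun s hs => aa_bound hf hB hL hs.1 x

variable {τ B L : ℝ} {h : ℝ → EuclideanSpace ℝ (Fin d) → ℝ}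

lemma Du.integral (hh : DH τ B L h) (hL : 0 ≤ L) {t : ℝ} (ht : t ∈ Set.Ioo 0 τ) (x : EuclideanSpace ℝ (Fin d)) :
    Du h t x = ∫ r in (0:ℝ)..t, (h r x + ∑ i, Du2 h r x i) := by
  have ht0 := ht.1
  set φ : ℝ → ℝ → ℝ := fun s r => if s < r then aa (h s) x (r - s) else 0 with hφ
  set MM := ∑ i : Fin d, M2 i with hMM
  have hMM0 : 0 ≤ MM := Finset.sum_nonneg fun i _ => M2_nonneg i
  have hmem : ∀ s ∈ Set.Ioo 0 t, s ∈ Set.Ioo 0 τ := fun s hs => ⟨hs.1, hs.2.trans ht.2⟩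
  have e1 : Du h t x = ∫ s in Set.Ioo 0 t, TT gk (2 * √(t - s)) (h s) x := by
    rw [← scale_int ht.1, Du]
    congr 2; ext θ; rw [ell]; congr 3; ring
  have e2 : ∀ s ∈ Set.Ioo 0 t, TT gk (2 * √(t - s)) (h s) x = h s x + ∫ r in Set.Ioo 0 t, φ s r := by
    intro s hs
    rw [P_int (hh.cx s) (hh.bd s) (hh.lip s (hmem s hs)) (by linarith [hs.2] : 0 < t - s) x]
    congr 1
    have h1 : ∫ r in Set.Ioo 0 t, φ s r = ∫ r in Set.Ioo s t, φ s r := by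
      refine setIntegral_eq_of_subset_of_forall_sdiff_eq_zero measurableSet_Ioo (Set.Ioo_subset_Ioo_left hs.1.le) fun r hr => ?_
      have : ¬ s < r := fun hc => hr.2 ⟨hc, hr.1.2⟩
      simp only [hφ, if_neg this]
    have h2 : ∫ r in Set.Ioo s t, φ s r = ∫ r in Set.Ioo s t, aa (h s) x (r - s) := by
      refine setIntegral_congr_fun measurableSet_Ioo fun r hr => ?_
      simp only [hφ, if_pos hr.1]
    rw [h1, h2, ← integral_Ioc_eq_integral_Ioo, ← intervalIntegral.integral_of_le hs.2.le,
      intervalIntegral.integral_comp_sub_right (fun r => aa (h s) x r) s, sub_self]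
  have e3 : ∀ r ∈ Set.Ioo 0 t, ∫ s in Set.Ioo 0 t, φ s r = ∑ i, Du2 h r x i := by
    intro r hr
    have h1 : ∫ s in Set.Ioo 0 t, φ s r = ∫ s in Set.Ioo 0 r, aa (h s) x (r - s) := by
      rw [setIntegral_eq_of_subset_of_forall_sdiff_eq_zero measurableSet_Ioo (Set.Ioo_subset_Ioo_right hr.2.le : Set.Ioo 0 r ⊆ Set.Ioo 0 t) fun s hs => ?_]
      · refine setIntegral_congr_fun measurableSet_Ioo fun s hs => ?_
        simp only [hφ, if_pos hs.2]
      · have : ¬ s < r := fun hc => hs.2 ⟨hs.1.1, hc⟩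
        simp only [hφ, if_neg this]
    rw [h1, ← scale_int hr.1]
    unfold Du2
    rw [← Finset.mul_sum, ← integral_finsetSum]
    · congr 1
      refine setIntegral_congr_fun measurableSet_Ioo fun θ hθ => ?_
      simp only [aa]
      rw [Finset.mul_sum]
      refine Finset.sum_congr rfl fun i _ => ?_
      rw [ell_sq hr.1 hθ, ell]
      have : r - r * θ = r * (1 - θ) := by ring
      rw [this]
    · intro i _
      refine Integrable.mono' (intg_sqrt2.const_mul (L * M2 i / r)) ?_ (ae_restrict_of_forall_mem measurableSet_Ioo fun θ hθ => ph2_bd hh hL (hmem r hr) hθ x i)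
      refine ContinuousOn.aestronglyMeasurable ?_ measurableSet_Ioo
      have h1 := ((hh.cT (GB_g2 i)).comp (by fun_prop : Continuous fun θ : ℝ => (θ, r, x))).continuousOn (s := Set.Ioo 0 1)
      exact (continuousOn_const.div ((cell r).pow 2).continuousOn fun θ hθ => (pow_pos (ell_pos hr.1 hθ) 2).ne').mul h1
  have hmeas : Measurable (fun p : ℝ × ℝ => φ p.2 p.1) := by
    simp only [hφ]
    refine Measurable.ite (measurableSet_lt measurable_snd measurable_fst) ?_ measurable_const
    unfold aa
    refine Measurable.mul (by fun_prop) (Finset.measurable_sum _ fun i _ => ?_)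
    refine Continuous.measurable ?_
    rw [← continuousOn_univ]
    refine TT.contOn (B := B) (X := fun _ => x) (GB_g2 i) (fun p _ x => hh.bd _ _) (fun p _ => hh.cx _) (fun y => Continuous.continuousOn ?_)
    have := hh.cont
    exact this.comp (by fun_prop : Continuous fun p : ℝ × ℝ => (p.2, x + (2 * √(p.1 - p.2)) • y))
  have hbd : ∀ r ∈ Set.Ioo 0 t, ∀ s ∈ Set.Ioo 0 t, |φ s r| ≤ Set.indicator (Set.Ioo 0 r) (fun s => L * MM / 2 * (1 / (√s * √(r - s)))) s := by
    intro r hr s hs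
    by_cases hsr : s < r
    · rw [Set.indicator_of_mem (show s ∈ Set.Ioo 0 r from ⟨hs.1, hsr⟩)]
      simp only [hφ, if_pos hsr]
      have hrs : 0 < r - s := by linarith
      refine (aa_bound (hh.cx s) (hh.bd s) (hh.lip s (hmem s hs)) hrs x).trans (le_of_eq ?_)
      have h1 := Real.sqrt_pos.2 hrs
      have h2 := Real.sqrt_pos.2 hs.1
      rw [← hMM]
      field_simp
    · rw [Set.indicator_of_notMem (fun hc => hsr hc.2)]
      simp only [hφ, if_neg hsr, abs_zero, le_refl]
  have hindint : ∀ r ∈ Set.Ioo 0 t, IntegrableOn (Set.indicator (Set.Ioo 0 r) (fun s => L * MM / 2 * (1 / (√s * √(r - s))))) (Set.Ioo 0 t) := by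
    intro r hr
    have := (integrable_indicator_iff measurableSet_Ioo).2 (intg_sqrtr2 (r := r).const_mul (L * MM / 2))
    exact this.integrableOn
  have hval : ∀ r ∈ Set.Ioo 0 t, ∫ s in Set.Ioo 0 t, Set.indicator (Set.Ioo 0 r) (fun s => L * MM / 2 * (1 / (√s * √(r - s)))) s = L * MM / 2 * J2 := by
    intro r hr
    have hr0 := hr.1
    rw [setIntegral_indicator measurableSet_Ioo, Set.inter_eq_right.2 (Set.Ioo_subset_Ioo_right hr.2.le), ← scale_int hr.1, integral_const_mul, J2,
      mul_left_comm, ← integral_const_mul]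
    congr 1
    refine setIntegral_congr_fun measurableSet_Ioo fun θ hθ => ?_
    have h1 : 0 < 1 - θ := by linarith [hθ.2]
    have h2 := hθ.1
    have e : r - r * θ = r * (1 - θ) := by ring
    rw [e, Real.sqrt_mul hr0.le, Real.sqrt_mul hr0.le]
    have h3 := Real.sqrt_pos.2 hr0
    have h4 := Real.sqrt_pos.2 h1
    have h5 := Real.sqrt_pos.2 h2
    have h6 : r = √r * √r := (Real.mul_self_sqrt hr0.le).symm
    calc r * (1 / (√r * √θ * (√r * √(1 - θ)))) = (√r * √r) * (1 / (√r * √θ * (√r * √(1 - θ)))) := by rw [← h6]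
      _ = _ := by field_simp
  have hinner : ∀ r ∈ Set.Ioo 0 t, IntegrableOn (fun s => φ s r) (Set.Ioo 0 t) := fun r hr =>
    Integrable.mono' (hindint r hr) (hmeas.comp (by fun_prop : Measurable fun s : ℝ => (r, s))).aestronglyMeasurable
      (ae_restrict_of_forall_mem measurableSet_Ioo fun s hs => hbd r hr s hs)
  have hprod : Integrable (fun p : ℝ × ℝ => φ p.2 p.1) ((volume.restrict (Set.Ioo 0 t)).prod (volume.restrict (Set.Ioo 0 t))) := by
    rw [integrable_prod_iff hmeas.aestronglyMeasurable]
    refine ⟨ae_restrict_of_forall_mem measurableSet_Ioo hinner, ?_⟩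
    refine Integrable.mono' (integrable_const (L * MM / 2 * J2)) hmeas.aestronglyMeasurable.norm.integral_prod_right' ?_
    refine ae_restrict_of_forall_mem measurableSet_Ioo fun r hr => ?_
    rw [Real.norm_eq_abs, abs_of_nonneg (integral_nonneg fun s => norm_nonneg _), ← hval r hr]
    exact setIntegral_mono_on (hinner r hr).norm (hindint r hr) measurableSet_Ioo fun s hs => hbd r hr s hs
  have ih : IntegrableOn (fun s => h s x) (Set.Ioo 0 t) := by
    have : Continuous fun s => h s x := hh.cont.comp (by fun_prop : Continuous fun s : ℝ => (s, x))
    exact (this.integrableOn_Icc).mono_set Set.Ioo_subset_Icc_self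
  have i2 : IntegrableOn (fun s => ∫ r in Set.Ioo 0 t, φ s r) (Set.Ioo 0 t) := hprod.integral_prod_right
  have i3 : IntegrableOn (fun r => ∑ i, Du2 h r x i) (Set.Ioo 0 t) := by
    have : IntegrableOn (fun r => ∫ s in Set.Ioo 0 t, φ s r) (Set.Ioo 0 t) := hprod.integral_prod_left
    exact this.congr_fun e3 measurableSet_Ioo
  have sw : ∫ s in Set.Ioo 0 t, ∫ r in Set.Ioo 0 t, φ s r = ∫ r in Set.Ioo 0 t, ∫ s in Set.Ioo 0 t, φ s r :=
    (integral_integral_swap (f := fun r s => φ s r) hprod).symm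
  rw [e1, setIntegral_congr_fun measurableSet_Ioo e2, integral_add ih i2, sw, setIntegral_congr_fun measurableSet_Ioo e3,
    ← integral_add ih i3, intervalIntegral.integral_of_le ht.1.le, integral_Ioc_eq_integral_Ioo]

lemma Du.dt (hh : DH τ B L h) (hL : 0 ≤ L) {t : ℝ} (ht : t ∈ Set.Ioo 0 τ) (x : EuclideanSpace ℝ (Fin d)) :
    HasDerivAt (fun t => Du h t x) (h t x + ∑ i, Du2 h t x i) t := by
  have c : ContinuousOn (fun r => h r x + ∑ i, Du2 h r x i) (Set.Ioo 0 τ) := by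
    have : Continuous fun s => h s x := hh.cont.comp (by fun_prop : Continuous fun s : ℝ => (s, x))
    refine this.continuousOn.add (continuousOn_finsetSum _ fun i _ => ?_)
    exact (Du2.cont hh hL i).comp (by fun_prop : Continuous fun s : ℝ => (s, x)).continuousOn (fun s hs => ⟨hs, trivial⟩)
  have key : HasDerivAt (fun t => ∫ r in (0:ℝ)..t, (h r x + ∑ i, Du2 h r x i)) (h t x + ∑ i, Du2 h t x i) t := by
    apply intervalIntegral.integral_hasDerivAt_right
    · rw [intervalIntegrable_iff_integrableOn_Ioo_of_le ht.1.le]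
      refine Integrable.mono' (integrable_const (B + ∑ i : Fin d, L * M2 i * J2)) ((c.mono (Set.Ioo_subset_Ioo_right ht.2.le)).aestronglyMeasurable measurableSet_Ioo) ?_
      refine ae_restrict_of_forall_mem measurableSet_Ioo fun r hr => ?_
      rw [Real.norm_eq_abs]
      refine (abs_add_le _ _).trans (add_le_add (hh.bd _ _) ((Finset.abs_sum_le_sum_abs _ _).trans (Finset.sum_le_sum fun i _ => ?_)))
      exact Du2.bound hh hL ⟨hr.1, hr.2.trans ht.2⟩ x i
    · exact c.stronglyMeasurableAtFilter isOpen_Ioo t ht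
    · exact c.continuousAt (Ioo_mem_nhds ht.1 ht.2)
  refine key.congr_of_eventuallyEq ?_
  filter_upwards [Ioo_mem_nhds ht.1 ht.2] with r hr using Du.integral hh hL hr x

end duht

section picard
variable {d : ℕ}

lemma Du.intgθ {τ B L : ℝ} {h : ℝ → EuclideanSpace ℝ (Fin d) → ℝ} (hh : DH τ B L h) (t : ℝ) (x : EuclideanSpace ℝ (Fin d)) :
    IntegrableOn (fun θ => TT gk (ell t θ) (h (t * θ)) x) (Set.Ioo 0 1) := by
  have : Continuous (fun θ => TT gk (ell t θ) (h (t * θ)) x) :=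
    (hh.cT GB_gk).comp (by fun_prop : Continuous fun θ : ℝ => (θ, t, x))
  exact this.integrableOn_Icc.mono_set Set.Ioo_subset_Icc_self

lemma Du.sub {τ B L τ' B' L' : ℝ} {h h' : ℝ → EuclideanSpace ℝ (Fin d) → ℝ} (hh : DH τ B L h) (hh' : DH τ' B' L' h') (t : ℝ) (x : EuclideanSpace ℝ (Fin d)) :
    Du h t x - Du h' t x = Du (fun t x => h t x - h' t x) t x := by
  unfold Du
  rw [← mul_sub, ← integral_sub (Du.intgθ hh t x) (Du.intgθ hh' t x)]
  congr 2; ext θ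
  unfold TT
  rw [← integral_sub (TT.intg GB_gk (hh.cx _) (hh.bd _) _ _) (TT.intg GB_gk (hh'.cx _) (hh'.bd _) _ _)]
  congr 1; ext y; ring

/-- mild solution -/
lemma mild_exist {B Λ M τ : ℝ} (hΛ : 0 ≤ Λ) (hτ : 0 < τ) (hτΛ : τ * Λ < 1) {ft : ℝ → ℝ}
    (hB : ∀ y, |ft y| ≤ B) (hL : ∀ y y', |ft y - ft y'| ≤ Λ * |y - y'|) {g : EuclideanSpace ℝ (Fin d) → ℝ}
    (hg : Continuous g) (hM : ∀ x, |g x| ≤ M) :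
    ∃ z : ℝ → EuclideanSpace ℝ (Fin d) → ℝ, Continuous (fun p : ℝ × EuclideanSpace ℝ (Fin d) => z p.1 p.2) ∧
      ∀ t ∈ Set.Icc 0 τ, ∀ x, z t x = TT gk (2 * √t) g x + Du (fun t x => ft (z t x)) t x := by
  have hfc : Continuous ft := by
    refine (LipschitzWith.of_dist_le_mul (K := ⟨Λ, hΛ⟩) fun y y' => ?_).continuous
    exact hL y y'
  let X := BoundedContinuousFunction (ℝ × EuclideanSpace ℝ (Fin d)) ℝ
  let hv : X → ℝ → EuclideanSpace ℝ (Fin d) → ℝ := fun v t x => ft (v (t, x))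
  have hDH : ∀ v : X, DH 0 B 0 (hv v) := fun v =>
    { cont := hfc.comp v.continuous
      bd := fun t x => hB _
      lip := fun t ht => by simp at ht }
  let cl : ℝ → ℝ := fun t => max 0 (min t τ)
  have clc : Continuous cl := by fun_prop
  have cl0 : ∀ t, 0 ≤ cl t := fun t => le_max_left _ _
  have cl1 : ∀ t, cl t ≤ τ := fun t => max_le hτ.le (min_le_right _ _)
  have cont : ∀ v : X, Continuous (fun p : ℝ × EuclideanSpace ℝ (Fin d) => TT gk (2 * √(cl p.1)) g p.2 + Du (hv v) (cl p.1) p.2) := by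
    intro v
    have h1 := (cTs hg hM GB_gk).comp (by fun_prop : Continuous fun p : ℝ × EuclideanSpace ℝ (Fin d) => (cl p.1, p.2))
    have h2 := (Du.cont (hDH v)).comp (by fun_prop : Continuous fun p : ℝ × EuclideanSpace ℝ (Fin d) => (cl p.1, p.2))
    exact h1.add h2
  have hB0 : 0 ≤ B := (abs_nonneg _).trans (hB 0)
  let Γ : X → X := fun v => BoundedContinuousFunction.ofNormedAddCommGroup _ (cont v) (M + τ * B) (by
    intro p
    rw [Real.norm_eq_abs]
    refine (abs_add_le _ _).trans (add_le_add ?_ ((Du.bound (hDH v) (cl0 _) _).trans (by gcongr; exact cl1 _)))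
    have := TT.bound GB_gk hM (2 * √(cl p.1)) p.2
    rwa [gk_abs_int, mul_one] at this)
  have hΓ : ∀ v (p : ℝ × EuclideanSpace ℝ (Fin d)), Γ v p = TT gk (2 * √(cl p.1)) g p.2 + Du (hv v) (cl p.1) p.2 := fun v p => rfl
  have hcon : ContractingWith ⟨τ * Λ, by positivity⟩ Γ := by
    refine ⟨by exact_mod_cast hτΛ, LipschitzWith.of_dist_le_mul fun v w => ?_⟩
    change dist (Γ v) (Γ w) ≤ τ * Λ * dist v w
    rw [BoundedContinuousFunction.dist_le (by positivity)]
    intro p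
    rw [hΓ, hΓ, dist_add_left, Real.dist_eq, Du.sub (hDH v) (hDH w)]
    have hD : DH 0 (Λ * dist v w) 0 (fun t x => hv v t x - hv w t x) :=
      { cont := (hDH v).cont.sub (hDH w).cont
        bd := fun t x => (hL _ _).trans (mul_le_mul_of_nonneg_left (BoundedContinuousFunction.dist_coe_le_dist (f := v) (g := w) (t, x)) hΛ)
        lip := fun t ht => by simp at ht }
    refine (Du.bound hD (cl0 _) _).trans ?_
    have : 0 ≤ Λ * dist v w := by positivity
    nlinarith [cl1 p.1]
  let z := hcon.fixedPoint
  have hz : Γ z = z := hcon.fixedPoint_isFixedPt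
  refine ⟨fun t x => z (t, x), z.continuous, fun t ht x => ?_⟩
  have : cl t = t := by simp only [cl]; rw [min_eq_left ht.2, max_eq_right ht.1]
  have e : z (t, x) = Γ z (t, x) := by rw [hz]
  change z (t, x) = _
  rw [e, hΓ]
  simp only [this]
  rfl

/-- constants -/
def LLc (d : ℕ) (B M : ℝ) : ℝ := M * M1 d / 2 + B * (M1 d * J1)
def Kcc (d : ℕ) (B Λ M : ℝ) : ℝ := (∑ i : Fin d, (M * (∫ y, |g2 i y|) / 2 + 2 * (Λ * LLc d B M * M2 i * J2))) + 2 * B + 2 * LLc d B M + 1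

lemma LLc_nonneg {d : ℕ} {B M : ℝ} (hB : 0 ≤ B) (hM : 0 ≤ M) : 0 ≤ LLc d B M := by
  have := M1_nonneg d
  have := J1_nonneg
  unfold LLc; positivity

lemma Kcc_ge {d : ℕ} {B Λ M : ℝ} (hB : 0 ≤ B) (hΛ : 0 ≤ Λ) (hM : 0 ≤ M) : 1 ≤ Kcc d B Λ M := by
  have h1 := LLc_nonneg (d := d) hB hM
  have : 0 ≤ (∑ i : Fin d, (M * (∫ y, |g2 i y|) / 2 + 2 * (Λ * LLc d B M * M2 i * J2))) := Finset.sum_nonneg fun i _ => by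
    have := M2_nonneg i
    have := J2_nonneg
    have : 0 ≤ (∫ y, |g2 i y|) := integral_nonneg fun y => abs_nonneg _
    positivity
  unfold Kcc; linarith

/-- comparison solution -/
lemma heat_exist {B Λ M τ : ℝ} (hΛ : 0 ≤ Λ) (hτ : 0 < τ) (hτ1 : τ ≤ 1) (hτΛ : τ * Λ < 1) {ft : ℝ → ℝ}
    (hB : ∀ y, |ft y| ≤ B) (hL : ∀ y y', |ft y - ft y'| ≤ Λ * |y - y'|) {g : EuclideanSpace ℝ (Fin d) → ℝ}
    (hg : Continuous g) (hM : ∀ x, |g x| ≤ M) :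
    ∃ (z zt : ℝ → EuclideanSpace ℝ (Fin d) → ℝ) (zx zxx : ℝ → EuclideanSpace ℝ (Fin d) → Fin d → ℝ),
      Continuous (fun p : ℝ × EuclideanSpace ℝ (Fin d) => z p.1 p.2) ∧ (∀ x, z 0 x = g x) ∧ Reg τ z zt zx zxx ∧
      (∀ t ∈ Set.Icc 0 τ, ∀ x, |z t x| ≤ M + τ * B) ∧
      (∀ c, (∀ x, g x ≤ c) → ∀ t ∈ Set.Icc 0 τ, ∀ x, z t x ≤ c + τ * B) ∧
      (∀ t ∈ Set.Ioo 0 τ, ∀ x, zt t x = (∑ i, zxx t x i) + ft (z t x)) ∧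
      (∀ t ∈ Set.Ioo 0 τ, ∀ x, |zt t x| ≤ Kcc d B Λ M / (2 * t)) ∧
      (∀ t ∈ Set.Ioo 0 τ, ∀ x i, |zx t x i| ≤ Kcc d B Λ M / √(2 * t)) ∧
      (∀ t ∈ Set.Ioo 0 τ, ∀ x i, |zxx t x i| ≤ Kcc d B Λ M / (2 * t)) := by
  have hfc : Continuous ft := (LipschitzWith.of_dist_le_mul (K := ⟨Λ, hΛ⟩) fun y y' => hL y y').continuous
  have hB0 : 0 ≤ B := (abs_nonneg _).trans (hB 0)
  have hM0 : 0 ≤ M := (abs_nonneg _).trans (hM 0)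
  obtain ⟨z, zc, hz⟩ := mild_exist hΛ hτ hτΛ hB hL hg hM
  set h : ℝ → EuclideanSpace ℝ (Fin d) → ℝ := fun t x => ft (z t x) with hh
  set LL := LLc d B M with hLL
  have hLL0 : 0 ≤ LL := LLc_nonneg hB0 hM0
  have D0 : DH 0 B 0 h := ⟨hfc.comp zc, fun t x => hB _, fun t ht => by simp at ht⟩
  have lz : ∀ t ∈ Set.Ioo 0 τ, ∀ x v, |z t (x + v) - z t x| ≤ LL / √t * ‖v‖ := by
    intro t ht x v
    have ht0 := ht.1
    have hs := Real.sqrt_pos.2 ht.1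
    rw [hz t ⟨ht.1.le, ht.2.le⟩, hz t ⟨ht.1.le, ht.2.le⟩]
    have h1 := TT.lip1 hg hM (l := 2 * √t) (by positivity) x v
    have h2 := Du.lip D0 ht.1 x v
    rw [show ∀ a b c e : ℝ, a + b - (c + e) = (a - c) + (b - e) from fun _ _ _ _ => by ring]
    refine (abs_add_le _ _).trans ((add_le_add h1 h2).trans ?_)
    rw [← add_mul]
    refine mul_le_mul_of_nonneg_right ?_ (norm_nonneg v)
    have h3 : √t ≤ 1 / √t := by
      rw [le_div_iff₀ hs, Real.mul_self_sqrt ht.1.le]; linarith [ht.2]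
    have hm : 0 ≤ M1 d * J1 := mul_nonneg (M1_nonneg d) J1_nonneg
    calc M / (2 * √t) * (∫ y : EuclideanSpace ℝ (Fin d), 2 * ‖y‖ * gk y) + B * √t * (M1 d * J1)
        ≤ M / (2 * √t) * M1 d + B * (1 / √t) * (M1 d * J1) := by
          refine add_le_add le_rfl ?_
          gcongr
      _ = LL / √t := by rw [hLL, LLc]; field_simp
  set L := Λ * LL with hLdef
  have hL0 : 0 ≤ L := by positivity
  have D : DH τ B L h := ⟨D0.cont, D0.bd, fun t ht x v => by
    refine (hL _ _).trans ?_
    have := mul_le_mul_of_nonneg_left (lz t ht x v) hΛ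
    calc _ ≤ _ := this
      _ = _ := by rw [hLdef]; ring⟩
  set zt : ℝ → EuclideanSpace ℝ (Fin d) → ℝ := fun t x => aa g x t + (h t x + ∑ i, Du2 h t x i) with hzt
  set zx : ℝ → EuclideanSpace ℝ (Fin d) → Fin d → ℝ := fun t x i => -(1 / (2 * √t)) * TT (g1 (eb i)) (2 * √t) g x + Du1 h t x i with hzx
  set zxx : ℝ → EuclideanSpace ℝ (Fin d) → Fin d → ℝ := fun t x i => 1 / (4 * t) * TT (g2 i) (2 * √t) g x + Du2 h t x i with hzxx
  have cinv : ContinuousOn (fun p : ℝ × EuclideanSpace ℝ (Fin d) => -(1 / (2 * √p.1))) (Set.Ioo 0 τ ×ˢ Set.univ) := by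
    refine (continuousOn_const.div (by fun_prop) ?_).neg
    rintro ⟨t, x⟩ ⟨ht, -⟩
    have := Real.sqrt_pos.2 ht.1
    positivity
  have cinv2 : ContinuousOn (fun p : ℝ × EuclideanSpace ℝ (Fin d) => (1 / (4 * p.1))) (Set.Ioo 0 τ ×ˢ Set.univ) := by
    refine (continuousOn_const.div (by fun_prop) ?_)
    rintro ⟨t, x⟩ ⟨ht, -⟩
    have := ht.1
    simp only at this
    positivity
  have pde : ∀ t ∈ Set.Ioo 0 τ, ∀ x, zt t x = (∑ i, zxx t x i) + ft (z t x) := by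
    intro t ht x
    simp only [hzt, hzxx, aa, Finset.sum_add_distrib, Finset.mul_sum, hh]
    ring
  have reg : Reg τ z zt zx zxx :=
    { dt := fun t ht x => by
        have := (P_dt hg hM ht.1 x).fun_add (Du.dt D hL0 ht x)
        refine this.congr_of_eventuallyEq ?_
        filter_upwards [Ioo_mem_nhds ht.1 ht.2] with r hr using hz r ⟨hr.1.le, hr.2.le⟩ x
      dx := fun t ht x i => by
        have hs := Real.sqrt_pos.2 ht.1
        have := (TT.hasDeriv GB_gk (GB_g1 (eb i)) (eb i) (gk_deriv (eb i)) hg hM (l := 2 * √t) (by positivity) x).fun_add (Du.d1 D ht.1 x i)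
        refine this.congr_of_eventuallyEq (Filter.Eventually.of_forall fun s => hz t ⟨ht.1.le, ht.2.le⟩ _)
      dxx := fun t ht x i => by
        have hs := Real.sqrt_pos.2 ht.1
        have := ((TT.hasDeriv (GB_g1 (eb i)) (GB_g2 i) (eb i) (g1_deriv i) hg hM (l := 2 * √t) (by positivity) x).const_mul (-(1 / (2 * √t)))).fun_add (Du.d2 D hL0 ht x i)
        refine this.congr_deriv ?_
        simp only [hzxx]
        congr 1
        rw [← mul_assoc]
        congr 1
        have e : t = √t * √t := (Real.mul_self_sqrt ht.1.le).symm
        conv_rhs => rw [e]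
        field_simp; norm_num
      ck := zc.continuousOn
      ckt := by
        refine ((aa_cont hg hM).mono (Set.prod_mono (fun t ht => ht.1) le_rfl)).add (D.cont.continuousOn.add (continuousOn_finsetSum _ fun i _ => Du2.cont D hL0 i))
      ckx := fun i => (cinv.mul (cTs hg hM (GB_g1 (eb i))).continuousOn).add (Du1.cont D i)
      ckxx := fun i => (cinv2.mul (cTs hg hM (GB_g2 i)).continuousOn).add (Du2.cont D hL0 i) }
  set Ki : Fin d → ℝ := fun i => (M * (∫ y, |g2 i y|) / 2 + 2 * (L * M2 i * J2)) with hKi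
  have hKi0 : ∀ i, 0 ≤ Ki i := fun i => by
    have := M2_nonneg i
    have := J2_nonneg
    have : 0 ≤ (∫ y, |g2 i y|) := integral_nonneg fun y => abs_nonneg _
    simp only [hKi]; positivity
  have hKcc : Kcc d B Λ M = ∑ i, Ki i + 2 * B + 2 * LL + 1 := rfl
  have b2 : ∀ t ∈ Set.Ioo 0 τ, ∀ x i, |zxx t x i| ≤ Ki i / (2 * t) := by
    intro t ht x i
    have ht0 := ht.1
    have h1 := TT.bound (GB_g2 i) hM (2 * √t) x
    have h2 := Du2.bound D hL0 ht x i
    have h3 : 0 ≤ L * M2 i * J2 := (abs_nonneg _).trans h2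
    calc _ ≤ |1 / (4 * t) * TT (g2 i) (2 * √t) g x| + |Du2 h t x i| := abs_add_le _ _
      _ ≤ 1 / (4 * t) * (M * ∫ y, |g2 i y|) + L * M2 i * J2 * (1 / t) := by
          rw [abs_mul, abs_of_pos (by positivity)]
          refine add_le_add (by gcongr) (h2.trans ?_)
          refine le_mul_of_one_le_right h3 ?_
          rw [one_le_div ht0]; linarith [ht.2]
      _ = _ := by simp only [hKi]; field_simp; ring
  have hle : ∀ i, Ki i ≤ ∑ i, Ki i := fun i => Finset.single_le_sum (fun i _ => hKi0 i) (Finset.mem_univ i)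
  have tb : ∀ t ∈ Set.Icc 0 τ, ∀ x, |Du h t x| ≤ τ * B := fun t ht x => (Du.bound D0 ht.1 x).trans (by gcongr; exact ht.2)
  refine ⟨z, zt, zx, zxx, zc, ?_, reg, ?_, ?_, pde, ?_, ?_, ?_⟩
  · intro x
    rw [hz 0 ⟨le_rfl, hτ.le⟩]
    simp [TT_zero, Du]
  · intro t ht x
    rw [hz t ht]
    have := TT.bound GB_gk hM (2 * √t) x
    rw [gk_abs_int, mul_one] at this
    exact (abs_add_le _ _).trans (add_le_add this (tb t ht x))
  · intro c hc t ht x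
    rw [hz t ht]
    refine add_le_add ?_ ((le_abs_self _).trans (tb t ht x))
    unfold TT
    have : c = ∫ y : EuclideanSpace ℝ (Fin d), gk y * c := by rw [integral_mul_const, gk_int, one_mul]
    rw [this]
    exact integral_mono (TT.intg GB_gk hg hM _ x) (GB_gk.intg.mul_const c) fun y => mul_le_mul_of_nonneg_left (hc _) (gk_pos y).le
  · intro t ht x
    have ht0 := ht.1
    rw [pde t ht x]
    calc _ ≤ |∑ i, zxx t x i| + |ft (z t x)| := abs_add_le _ _
      _ ≤ (∑ i, Ki i / (2 * t)) + B * (1 / t) := by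
          refine add_le_add ((Finset.abs_sum_le_sum_abs _ _).trans (Finset.sum_le_sum fun i _ => b2 t ht x i)) ((hB _).trans ?_)
          refine le_mul_of_one_le_right hB0 ?_
          rw [one_le_div ht0]; linarith [ht.2]
      _ = (∑ i, Ki i + 2 * B) / (2 * t) := by rw [← Finset.sum_div]; field_simp
      _ ≤ _ := by rw [hKcc]; exact div_le_div_of_nonneg_right (by linarith) (by positivity)
  · intro t ht x i
    have ht0 := ht.1
    have hs := Real.sqrt_pos.2 ht.1
    have h1 : |zx t x i| ≤ LL / √t := by
      refine (reg.dx t ht x i).le_of_lip' (by positivity) (Filter.Eventually.of_forall fun s => ?_)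
      have := lz t ht x (s • eb i)
      simpa [norm_smul] using this
    refine h1.trans ?_
    have hS := Finset.sum_nonneg fun i (_ : i ∈ Finset.univ) => hKi0 i
    have h2 : √(2 * t) ≤ 2 * √t := by
      rw [Real.sqrt_mul (by norm_num)]
      gcongr
      rw [Real.sqrt_le_left (by norm_num)]; norm_num
    calc LL / √t = 2 * LL / (2 * √t) := by field_simp
      _ ≤ 2 * LL / √(2 * t) := by gcongr
      _ ≤ _ := by rw [hKcc]; gcongr; linarith
  · intro t ht x i
    have ht0 := ht.1
    refine (b2 t ht x i).trans ?_
    rw [hKcc]; gcongr; linarith [hle i]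

end picard

section zeta

lemma zetaR_hasDeriv {x : ℝ} (hx : x < 1) : HasDerivAt zetaR (deriv riemannZeta (x:ℂ)).re x := by
  have h1 : (x:ℂ) ≠ 1 := by exact_mod_cast hx.ne
  have := (differentiableAt_riemannZeta h1).hasDerivAt.real_of_complex
  exact this

lemma zetaR_derivCont : ContinuousOn (fun x : ℝ => (deriv riemannZeta (x:ℂ)).re) (Set.Iio 1) := by
  have h : ContinuousOn (deriv riemannZeta) {1}ᶜ := by
    have h0 : DifferentiableOn ℂ riemannZeta {1}ᶜ := fun s hs => (differentiableAt_riemannZeta hs).differentiableWithinAt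
    exact (h0.deriv isOpen_compl_singleton).continuousOn
  refine Complex.continuous_re.comp_continuousOn (h.comp Complex.continuous_ofReal.continuousOn fun x hx => ?_)
  have : x < 1 := hx
  have h1 : (x:ℂ) ≠ 1 := by exact_mod_cast this.ne
  exact h1

lemma zetaR_zero {k : ℕ} (hk : 0 < k) : zetaR (-(2 * (k:ℝ))) = 0 := by
  obtain ⟨n, rfl⟩ : ∃ n, k = n + 1 := ⟨k - 1, by omega⟩
  have := riemannZeta_neg_two_mul_nat_add_one n
  unfold zetaR
  have e : ((-(2 * ((n + 1 : ℕ) : ℝ)) : ℝ) : ℂ) = -2 * (n + 1) := by push_cast; ring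
  rw [e, this]; rfl

lemma zetaR_gt {s : ℝ} (hs : 1 < s) : ∃ r : ℝ, 0 < r ∧ riemannZeta (s:ℂ) = (r:ℂ) := by
  have h1 : riemannZeta (s:ℂ) = ∑' n : ℕ, 1 / ((n:ℂ) + 1) ^ (s:ℂ) := zeta_eq_tsum_one_div_nat_add_one_cpow (by simpa using hs)
  refine ⟨∑' n : ℕ, 1 / ((n:ℝ) + 1) ^ s, ?_, ?_⟩
  · have hsum : Summable (fun n : ℕ => 1 / ((n:ℝ) + 1) ^ s) := by
      have := (summable_nat_add_iff 1).2 (Real.summable_one_div_nat_rpow.2 hs)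
      simpa using this
    exact hsum.tsum_pos (fun n => by positivity) 0 (by positivity)
  · rw [h1, Complex.ofReal_tsum]
    congr 1; ext n
    push_cast
    congr 1
    have := Complex.ofReal_cpow (x := (n:ℝ) + 1) (by positivity) s
    rw [this]; push_cast; rfl

lemma zetaR_one_sub {s : ℝ} (hs : 1 < s) : ∃ r : ℝ, 0 < r ∧ zetaR (1 - s) = r * Real.cos (Real.pi * s / 2) := by
  obtain ⟨r, hr, he⟩ := zetaR_gt hs
  have h := riemannZeta_one_sub (s := (s:ℂ)) (fun n hn => by
    have : s = -(n:ℝ) := by exact_mod_cast hn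
    have h2 : (0:ℝ) ≤ n := Nat.cast_nonneg n
    linarith) (by exact_mod_cast hs.ne')
  refine ⟨2 * (2 * Real.pi) ^ (-s) * Real.Gamma s * r, ?_, ?_⟩
  · have := Real.Gamma_pos_of_pos (by linarith : 0 < s)
    have := Real.pi_pos
    positivity
  · unfold zetaR
    have e : ((1 - s : ℝ) : ℂ) = 1 - (s:ℂ) := by push_cast; rfl
    rw [e, h, he]
    have e2 : (2 * (Real.pi:ℂ)) ^ (-(s:ℂ)) = (((2 * Real.pi) ^ (-s) : ℝ) : ℂ) := by
      rw [Complex.ofReal_cpow (by have := Real.pi_pos; positivity)]; push_cast; rfl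
    have e3 : Complex.cos ((Real.pi:ℂ) * s / 2) = ((Real.cos (Real.pi * s / 2) : ℝ) : ℂ) := by push_cast; rfl
    rw [e2, e3, Complex.Gamma_ofReal]
    norm_cast
    ring

lemma zetaR_neg {n : ℕ} (hn : 0 < n) {x : ℝ} (h1 : -(4 * (n:ℝ)) - 2 < x) (h2 : x < -(4 * (n:ℝ))) : zetaR x < 0 := by
  have hn1 : (1:ℝ) ≤ n := by exact_mod_cast hn
  obtain ⟨r, hr, he⟩ := zetaR_one_sub (s := 1 - x) (by linarith)
  rw [sub_sub_cancel] at he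
  rw [he]
  refine mul_neg_of_pos_of_neg hr ?_
  have hp := Real.pi_pos
  have : Real.cos (Real.pi * (1 - x) / 2 - n * (2 * Real.pi)) < 0 :=
    Real.cos_neg_of_pi_div_two_lt_of_lt (by nlinarith) (by nlinarith)
  rwa [Real.cos_sub_nat_mul_two_pi] at this

lemma zetaR_pos {n : ℕ} (hn : 0 < n) {x : ℝ} (h1 : -(4 * (n:ℝ)) < x) (h2 : x < -(4 * (n:ℝ)) + 2) : 0 < zetaR x := by
  have hn1 : (1:ℝ) ≤ n := by exact_mod_cast hn
  obtain ⟨r, hr, he⟩ := zetaR_one_sub (s := 1 - x) (by linarith)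
  rw [sub_sub_cancel] at he
  rw [he]
  refine mul_pos hr ?_
  have hp := Real.pi_pos
  have : 0 < Real.cos (Real.pi * (1 - x) / 2 - n * (2 * Real.pi)) :=
    Real.cos_pos_of_mem_Ioo ⟨by nlinarith, by nlinarith⟩
  rwa [Real.cos_sub_nat_mul_two_pi] at this

lemma zetaR_mono : ∃ a : ℝ, 7 / 8 ≤ a ∧ a < 1 ∧ ∀ y y', a ≤ y → y ≤ y' → y' < 1 → zetaR y' ≤ zetaR y := by
  set f : ℂ → ℂ := Function.update (fun s => (s - 1) * riemannZeta s) 1 1 with hf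
  have hfa : AnalyticAt ℂ f 1 := by
    refine Complex.analyticAt_of_differentiable_on_punctured_nhds_of_continuousAt ?_ ?_
    · filter_upwards [self_mem_nhdsWithin] with s hs
      have hs : s ≠ 1 := hs
      have : DifferentiableAt ℂ (fun s => (s - 1) * riemannZeta s) s := by
        exact (by fun_prop : DifferentiableAt ℂ (fun s : ℂ => s - 1) s).mul (differentiableAt_riemannZeta hs)
      refine this.congr_of_eventuallyEq ?_
      filter_upwards [isOpen_ne.mem_nhds hs] with r hr
      exact Function.update_of_ne hr _ _
    · rw [hf, continuousAt_update_same]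
      exact riemannZeta_residue_one
  have hf1 : f 1 = 1 := Function.update_self _ _ _
  have hlim : Filter.Tendsto (fun s : ℂ => deriv f s * (s - 1) - f s) (nhds 1) (nhds (-1)) := by
    have c : ContinuousAt (fun s : ℂ => deriv f s * (s - 1) - f s) 1 :=
      (hfa.deriv.continuousAt.mul (by fun_prop)).sub hfa.continuousAt
    have := c.tendsto
    simpa [hf1] using this
  have hev : ∀ᶠ s : ℂ in nhds 1, (deriv f s * (s - 1) - f s).re < 0 := by
    have := (Complex.continuous_re.tendsto _).comp hlim
    exact this.eventually (gt_mem_nhds (by norm_num))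
  have hevR : ∀ᶠ x : ℝ in nhds 1, (deriv f (x:ℂ) * ((x:ℂ) - 1) - f (x:ℂ)).re < 0 ∧ AnalyticAt ℂ f (x:ℂ) := by
    have : Filter.Tendsto (fun x : ℝ => (x:ℂ)) (nhds 1) (nhds 1) := by
      have := Complex.continuous_ofReal.tendsto 1
      simpa using this
    exact this.eventually (hev.and hfa.eventually_analyticAt)
  obtain ⟨ε, hε, hball⟩ := Metric.eventually_nhds_iff.1 hevR
  refine ⟨max (7/8) (1 - ε/2), le_max_left _ _, max_lt (by norm_num) (by linarith), ?_⟩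
  set a := max (7/8 : ℝ) (1 - ε/2) with ha
  have hd : ∀ x : ℝ, a ≤ x → x < 1 → (deriv riemannZeta (x:ℂ)).re ≤ 0 := by
    intro x hx hx1
    have h1 : (x:ℂ) ≠ 1 := by exact_mod_cast hx1.ne
    have hxe := (le_max_right (7/8 : ℝ) (1 - ε/2)).trans hx
    obtain ⟨hn, han⟩ := hball (y := x) (by rw [Real.dist_eq, abs_lt]; constructor <;> linarith)
    have h2 : HasDerivAt (fun s : ℂ => f s / (s - 1)) ((deriv f (x:ℂ) * ((x:ℂ) - 1) - f x * 1) / ((x:ℂ) - 1) ^ 2) (x:ℂ) :=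
      han.differentiableAt.hasDerivAt.fun_div ((hasDerivAt_id _).sub_const 1) (sub_ne_zero.2 h1)
    have h3 : riemannZeta =ᶠ[nhds (x:ℂ)] (fun s : ℂ => f s / (s - 1)) := by
      filter_upwards [isOpen_ne.mem_nhds h1] with r hr
      have : f r = (r - 1) * riemannZeta r := Function.update_of_ne hr _ _
      rw [this, mul_div_cancel_left₀ _ (sub_ne_zero.2 hr)]
    rw [(h2.congr_of_eventuallyEq h3).deriv, mul_one]
    have e : ((x:ℂ) - 1) ^ 2 = (((x - 1) ^ 2 : ℝ) : ℂ) := by push_cast; rfl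
    rw [e, Complex.div_ofReal_re]
    exact (div_neg_of_neg_of_pos hn (by have : x - 1 ≠ 0 := by linarith
                                        positivity)).le
  intro y y' hy hyy hy'
  have : AntitoneOn zetaR (Set.Ico a 1) := by
    refine antitoneOn_of_deriv_nonpos (convex_Ico a 1) (fun x hx => (zetaR_hasDeriv hx.2).continuousAt.continuousWithinAt) ?_ ?_
    · intro x hx
      rw [interior_Ico] at hx
      exact (zetaR_hasDeriv hx.2).differentiableAt.differentiableWithinAt
    · intro x hx
      rw [interior_Ico] at hx
      rw [(zetaR_hasDeriv hx.2).deriv]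
      exact hd x hx.1.le hx.2
  exact this ⟨hy, hyy.trans_lt hy'⟩ ⟨hy.trans hyy, hy'⟩ hyy

end zeta

section ureg
variable {d : ℕ}

lemma ux_cont {τ : ℝ} {u : ℝ → EuclideanSpace ℝ (Fin d) → ℝ} {ux uxx : ℝ → EuclideanSpace ℝ (Fin d) → Fin d → ℝ} (i : Fin d)
    (hc : ContinuousOn (fun p : ℝ × EuclideanSpace ℝ (Fin d) => u p.1 p.2) (Set.Ioo 0 τ ×ˢ Set.univ))
    (hx : ∀ t ∈ Set.Ioo 0 τ, ∀ x, HasDerivAt (fun s : ℝ => u t (x + s • eb i)) (ux t x i) 0)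
    (hxx : ∀ t ∈ Set.Ioo 0 τ, ∀ x, HasDerivAt (fun s : ℝ => ux t (x + s • eb i) i) (uxx t x i) 0)
    (hcxx : ContinuousOn (fun p : ℝ × EuclideanSpace ℝ (Fin d) => uxx p.1 p.2 i) (Set.Ioo 0 τ ×ˢ Set.univ)) :
    ContinuousOn (fun p : ℝ × EuclideanSpace ℝ (Fin d) => ux p.1 p.2 i) (Set.Ioo 0 τ ×ˢ Set.univ) := by
  have hopen : IsOpen (Set.Ioo 0 τ ×ˢ (Set.univ : Set (EuclideanSpace ℝ (Fin d)))) := isOpen_Ioo.prod isOpen_univ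
  intro p0 hp0
  apply ContinuousAt.continuousWithinAt
  have c2 := hcxx.continuousAt (hopen.mem_nhds hp0)
  have hbd : ∀ᶠ p in nhds p0, |uxx p.1 p.2 i| < |uxx p0.1 p0.2 i| + 1 ∧ p ∈ Set.Ioo 0 τ ×ˢ (Set.univ : Set (EuclideanSpace ℝ (Fin d))) :=
    (c2.abs.eventually (gt_mem_nhds (by linarith))).and (hopen.mem_nhds hp0)
  set C := |uxx p0.1 p0.2 i| + 1 with hC
  have hC0 : 0 < C := by positivity
  obtain ⟨δ, hδ, hball⟩ := Metric.eventually_nhds_iff.1 hbd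
  apply continuousAt_of_locally_uniform_approx_of_continuousAt
  intro U hU
  obtain ⟨ε, hε, hεU⟩ := Metric.mem_uniformity_dist.1 hU
  set s := min (δ / 4) (ε / (2 * C)) with hs
  have hs0 : 0 < s := by positivity
  refine ⟨Metric.ball p0 (δ / 2), Metric.ball_mem_nhds _ (by positivity), fun p => (u p.1 (p.2 + s • eb i) - u p.1 p.2) / s, ?_, ?_⟩
  · refine ContinuousAt.div_const (ContinuousAt.sub ?_ (hc.continuousAt (hopen.mem_nhds hp0))) s
    have h1 : ContinuousAt (fun p : ℝ × EuclideanSpace ℝ (Fin d) => u p.1 p.2) (p0.1, p0.2 + s • eb i) :=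
      hc.continuousAt (hopen.mem_nhds ⟨hp0.1, trivial⟩)
    exact h1.comp (f := fun p : ℝ × EuclideanSpace ℝ (Fin d) => (p.1, p.2 + s • eb i)) (by fun_prop)
  · rintro ⟨t, x⟩ hp
    apply hεU
    have hdx : ∀ ξ ∈ Set.Icc 0 s, |uxx t (x + ξ • eb i) i| < C := by
      intro ξ hξ
      refine (hball (y := (t, x + ξ • eb i)) ?_).1
      have h1 : dist (t, x + ξ • eb i) (t, x) ≤ δ / 4 := by
        rw [Prod.dist_eq, dist_self]
        simp only [dist_self_add_left, norm_smul, EuclideanSpace.norm_single, norm_one, mul_one, Real.norm_eq_abs]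
        rw [abs_of_nonneg hξ.1]
        exact max_le (by positivity) (hξ.2.trans (min_le_left _ _))
      have h2 : dist (t, x) p0 < δ / 2 := hp
      linarith [dist_triangle (t, x + ξ • eb i) (t, x) p0]
    have htm : t ∈ Set.Ioo 0 τ := (hball (y := (t, x)) (lt_trans hp (by linarith))).2.1
    have d1 : ∀ r, HasDerivAt (fun s : ℝ => u t (x + s • eb i)) (ux t (x + r • eb i) i) r := fun r =>
      line_shift (f' := fun x => ux t x i) (fun x => hx t htm x) x r
    have d2 : ∀ r, HasDerivAt (fun s : ℝ => ux t (x + s • eb i) i) (uxx t (x + r • eb i) i) r := fun r =>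
      line_shift (f := fun x => ux t x i) (f' := fun x => uxx t x i) (fun x => hxx t htm x) x r
    obtain ⟨ξ, hξ, e1⟩ := exists_hasDerivAt_eq_slope _ _ hs0 (fun r _ => (d1 r).continuousAt.continuousWithinAt) (fun r _ => d1 r)
    obtain ⟨η, hη, e2⟩ := exists_hasDerivAt_eq_slope _ _ hξ.1 (fun r _ => (d2 r).continuousAt.continuousWithinAt) (fun r _ => d2 r)
    simp only [zero_smul, add_zero, sub_zero] at e1 e2
    rw [Real.dist_eq]
    simp only
    rw [← e1, abs_sub_comm]
    have e3 : ux t (x + ξ • eb i) i - ux t x i = uxx t (x + η • eb i) i * ξ := by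
      rw [e2]; field_simp [hξ.1.ne']
    rw [e3, abs_mul, abs_of_pos hξ.1]
    have h5 := hdx η ⟨hη.1.le, hη.2.le.trans hξ.2.le⟩
    have h6 : s * C ≤ ε / 2 := by
      have := min_le_right (δ / 4) (ε / (2 * C))
      rw [← hs] at this
      calc s * C ≤ ε / (2 * C) * C := by gcongr
        _ = ε / 2 := by field_simp
    have h7 : |uxx t (x + η • eb i) i| * ξ ≤ C * s := mul_le_mul h5.le hξ.2.le hξ.1.le hC0.le
    linarith

/-- classical solution data on `[0,τ)` -/
structure Sol (τ : ℝ) (F : ℝ → ℝ) (u ut : ℝ → EuclideanSpace ℝ (Fin d) → ℝ)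
    (ux uxx : ℝ → EuclideanSpace ℝ (Fin d) → Fin d → ℝ) : Prop where
  cu : ContinuousOn (fun p : ℝ × EuclideanSpace ℝ (Fin d) => u p.1 p.2) (Set.Ico 0 τ ×ˢ Set.univ)
  reg : Reg τ u ut ux uxx
  pde : ∀ t ∈ Set.Ioo 0 τ, ∀ x, ut t x = (∑ i, uxx t x i) + F (u t x)
  lt : ∀ t ∈ Set.Ico 0 τ, ∀ x, u t x < 1
  bd : ∀ t1 < τ, ∃ C, ∀ t ∈ Set.Icc 0 t1, ∀ x, |u t x| ≤ C

lemma Sol.mono {τ τ' : ℝ} {F : ℝ → ℝ} {u ut : ℝ → EuclideanSpace ℝ (Fin d) → ℝ}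
    {ux uxx : ℝ → EuclideanSpace ℝ (Fin d) → Fin d → ℝ} (h : Sol τ F u ut ux uxx) (hτ : τ' ≤ τ) : Sol τ' F u ut ux uxx where
  cu := h.cu.mono (Set.prod_mono (Set.Ico_subset_Ico_right hτ) le_rfl)
  reg :=
    have hh : Set.Ioo 0 τ' ⊆ Set.Ioo 0 τ := Set.Ioo_subset_Ioo_right hτ
    have h2 : Set.Ioo 0 τ' ×ˢ (Set.univ : Set (EuclideanSpace ℝ (Fin d))) ⊆ Set.Ioo 0 τ ×ˢ Set.univ := Set.prod_mono hh le_rfl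
    ⟨fun t ht => h.reg.dt t (hh ht), fun t ht => h.reg.dx t (hh ht), fun t ht => h.reg.dxx t (hh ht),
     h.reg.ck.mono h2, h.reg.ckt.mono h2, fun i => (h.reg.ckx i).mono h2, fun i => (h.reg.ckxx i).mono h2⟩
  pde := fun t ht => h.pde t ⟨ht.1, ht.2.trans_le hτ⟩
  lt := fun t ht => h.lt t ⟨ht.1, ht.2.trans_le hτ⟩
  bd := fun t1 ht => h.bd t1 (ht.trans_le hτ)

lemma Sol.shift {τ s : ℝ} {F : ℝ → ℝ} {u ut : ℝ → EuclideanSpace ℝ (Fin d) → ℝ}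
    {ux uxx : ℝ → EuclideanSpace ℝ (Fin d) → Fin d → ℝ} (h : Sol τ F u ut ux uxx) (hs : 0 ≤ s) :
    Sol (τ - s) F (fun t x => u (t + s) x) (fun t x => ut (t + s) x) (fun t x i => ux (t + s) x i) (fun t x i => uxx (t + s) x i) := by
  have hm : ∀ t ∈ Set.Ioo 0 (τ - s), t + s ∈ Set.Ioo 0 τ := fun t ht => ⟨by linarith [ht.1], by linarith [ht.2]⟩
  have hm' : ∀ t ∈ Set.Ico 0 (τ - s), t + s ∈ Set.Ico 0 τ := fun t ht => ⟨by linarith [ht.1], by linarith [ht.2]⟩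
  have hcc : Continuous (fun p : ℝ × EuclideanSpace ℝ (Fin d) => (p.1 + s, p.2)) := by fun_prop
  refine ⟨?_, ⟨?_, ?_, ?_, ?_, ?_, ?_, ?_⟩, ?_, ?_, ?_⟩
  · exact h.cu.comp hcc.continuousOn fun p hp => ⟨hm' _ hp.1, trivial⟩
  · intro t ht x
    have := (h.reg.dt _ (hm t ht) x)
    exact this.comp_add_const t s
  · exact fun t ht => h.reg.dx _ (hm t ht)
  · exact fun t ht => h.reg.dxx _ (hm t ht)
  · exact h.reg.ck.comp hcc.continuousOn fun p hp => ⟨hm _ hp.1, trivial⟩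
  · exact h.reg.ckt.comp hcc.continuousOn fun p hp => ⟨hm _ hp.1, trivial⟩
  · exact fun i => (h.reg.ckx i).comp hcc.continuousOn fun p hp => ⟨hm _ hp.1, trivial⟩
  · exact fun i => (h.reg.ckxx i).comp hcc.continuousOn fun p hp => ⟨hm _ hp.1, trivial⟩
  · exact fun t ht x => h.pde _ (hm t ht) x
  · exact fun t ht x => h.lt _ (hm' t ht) x
  · intro t1 ht1
    obtain ⟨C, hC⟩ := h.bd (t1 + s) (by linarith)
    exact ⟨C, fun t ht x => hC _ ⟨by linarith [ht.1], by linarith [ht.2]⟩ x⟩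

end ureg

section init
variable {d : ℕ}

lemma sep_deriv {c c' : ℝ → ℝ} (hc : ∀ y, HasDerivAt c (c' y) y) (x : EuclideanSpace ℝ (Fin d)) (i : Fin d) :
    HasDerivAt (fun s : ℝ => ∑ j, c ((x + s • eb i) j)) (c' (x i)) 0 := by
  have h : ∀ j ∈ (Finset.univ : Finset (Fin d)), HasDerivAt (fun s : ℝ => c ((x + s • eb i) j)) (if j = i then c' (x i) else 0) 0 := by
    intro j _
    by_cases hj : j = i
    · subst hj
      rw [if_pos rfl]
      have h1 : HasDerivAt (fun s : ℝ => (x + s • (eb j : EuclideanSpace ℝ (Fin d))) j) 1 0 := by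
        simp only [PiLp.add_apply, PiLp.smul_apply, eb, EuclideanSpace.single_apply, if_true, smul_eq_mul, mul_one]
        exact (hasDerivAt_id (0:ℝ)).const_add (x j)
      have h2 : HasDerivAt c (c' (x j)) ((x + (0:ℝ) • (eb j : EuclideanSpace ℝ (Fin d))) j) := by simpa using hc (x j)
      have := HasDerivAt.comp (0:ℝ) h2 h1
      rw [mul_one] at this
      exact this
    · rw [if_neg hj]
      simp only [PiLp.add_apply, PiLp.smul_apply, eb, EuclideanSpace.single_apply, if_neg hj, smul_zero, add_zero]
      exact hasDerivAt_const _ _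
  have := HasDerivAt.fun_sum h
  simpa using this

lemma init_decay {τ K : ℝ} (hK : 0 ≤ K) {w wt : ℝ → EuclideanSpace ℝ (Fin d) → ℝ}
    {wx wxx : ℝ → EuclideanSpace ℝ (Fin d) → Fin d → ℝ}
    (hc : ContinuousOn (fun p : ℝ × EuclideanSpace ℝ (Fin d) => w p.1 p.2) (Set.Ico 0 τ ×ˢ Set.univ))
    (reg : Reg τ w wt wx wxx) (h0 : ∀ x, w 0 x = 0) (hw1 : ∀ t ∈ Set.Ico 0 τ, ∀ x, w t x ≤ K)
    (hsub : ∀ R : ℝ, ∃ tR, 0 < tR ∧ tR ≤ τ ∧ ∀ t ∈ Set.Ioo 0 tR, ∀ x : EuclideanSpace ℝ (Fin d), (∀ i, |x i| ≤ R) →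
      wt t x ≤ (∑ i, wxx t x i) + K * w t x) :
    ∀ r : ℝ, ∃ C c t0 : ℝ, 0 < c ∧ 0 < t0 ∧ ∀ t ∈ Set.Ioo 0 t0, t < τ → ∀ x : EuclideanSpace ℝ (Fin d), ‖x‖ ≤ r → w t x ≤ C * Real.exp (-c / t) := by
  intro r
  set R := 2 * (|r| + 1) with hR
  have hR0 : 0 < R := by positivity
  obtain ⟨tR, htR0, htRτ, hs⟩ := hsub R
  refine ⟨2 * d * K * Real.exp K, R ^ 2 / 16, min tR 1, by positivity, by positivity, fun T hT hTτ y hy => ?_⟩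
  have hT0 := hT.1
  have hTR : T < tR := hT.2.trans_le (min_le_left _ _)
  have hT1 : T < 1 := hT.2.trans_le (min_le_right _ _)
  set l := R / (4 * T) with hl
  have hl0 : 0 < l := by positivity
  set c : ℝ → ℝ := fun y => Real.exp (l * y) + Real.exp (-(l * y)) with hcdef
  set c' : ℝ → ℝ := fun y => l * (Real.exp (l * y) - Real.exp (-(l * y))) with hc'def
  have hcd : ∀ y, HasDerivAt c (c' y) y := by
    intro y
    have h1 : HasDerivAt (fun y => l * y) l y := by simpa using (hasDerivAt_id y).const_mul l
    refine (h1.exp.fun_add h1.fun_neg.exp).congr_deriv ?_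
    simp only [hc'def]; ring
  have hcd' : ∀ y, HasDerivAt c' (l ^ 2 * c y) y := by
    intro y
    have h1 : HasDerivAt (fun y => l * y) l y := by simpa using (hasDerivAt_id y).const_mul l
    refine ((h1.exp.fun_sub h1.fun_neg.exp).const_mul l).congr_deriv ?_
    simp only [hcdef]; ring
  have hc0 : ∀ y, 0 < c y := fun y => by simp only [hcdef]; positivity
  set A : ℝ → ℝ := fun t => K * Real.exp ((K + l ^ 2) * t - l * R) with hA
  have hA0 : ∀ t, 0 ≤ A t := fun t => by simp only [hA]; positivity
  have hAd : ∀ t, HasDerivAt A ((K + l ^ 2) * A t) t := by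
    intro t
    have h1 : HasDerivAt (fun t => (K + l ^ 2) * t - l * R) (K + l ^ 2) t := by simpa using ((hasDerivAt_id t).const_mul (K + l ^ 2)).sub_const (l * R)
    refine (h1.exp.const_mul K).congr_deriv ?_
    simp only [hA]; ring
  set Bf : ℝ → EuclideanSpace ℝ (Fin d) → ℝ := fun t x => A t * ∑ j, c (x j) with hBf
  have hB0 : ∀ t x, 0 ≤ Bf t x := fun t x => mul_nonneg (hA0 t) (Finset.sum_nonneg fun j _ => (hc0 _).le)
  have sub1 : Set.Ioo 0 tR ⊆ Set.Ioo 0 τ := Set.Ioo_subset_Ioo_right htRτ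
  have key := cmp_principle (τ := tR) (Λ := K) (k := fun t x => Bf t x - w t x)
    (kt := fun t x => (K + l ^ 2) * Bf t x - wt t x) (kx := fun t x i => A t * c' (x i) - wx t x i)
    (kxx := fun t x i => A t * (l ^ 2 * c (x i)) - wxx t x i) ?_ ?_ ?_ ?_ ?_ ?_ ?_ T ⟨hT0.le, hTR⟩ y
  · have h1 : w T y ≤ Bf T y := by linarith
    refine h1.trans ?_
    have h2 : ∀ j, c (y j) ≤ 2 * Real.exp (l * (R / 2)) := by
      intro j
      have h3 : |y j| ≤ R / 2 := by
        have := PiLp.norm_apply_le y j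
        rw [Real.norm_eq_abs] at this
        have := le_abs_self r
        rw [hR]; linarith
      have h4 := abs_le.1 h3
      simp only [hcdef]
      have h5 : Real.exp (l * y j) ≤ Real.exp (l * (R / 2)) := Real.exp_le_exp.2 (by nlinarith)
      have h6 : Real.exp (-(l * y j)) ≤ Real.exp (l * (R / 2)) := Real.exp_le_exp.2 (by nlinarith)
      linarith
    have h7 : ∑ j, c (y j) ≤ d * (2 * Real.exp (l * (R / 2))) := by
      refine (Finset.sum_le_sum fun j _ => h2 j).trans (le_of_eq ?_)
      simp
    calc Bf T y ≤ A T * (d * (2 * Real.exp (l * (R / 2)))) := mul_le_mul_of_nonneg_left h7 (hA0 T)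
      _ = 2 * d * K * (Real.exp ((K + l ^ 2) * T - l * R) * Real.exp (l * (R / 2))) := by simp only [hA]; ring
      _ ≤ 2 * d * K * (Real.exp K * Real.exp (-(R ^ 2 / 16) / T)) := by
          refine mul_le_mul_of_nonneg_left ?_ (by positivity)
          rw [← Real.exp_add, ← Real.exp_add]
          refine Real.exp_le_exp.2 ?_
          have e : (K + l ^ 2) * T - l * R + l * (R / 2) = K * T + (-(R ^ 2 / 16) / T) := by
            rw [hl]; field_simp; ring
          rw [e]
          nlinarith
      _ = _ := by ring
  · have : Continuous (fun p : ℝ × EuclideanSpace ℝ (Fin d) => Bf p.1 p.2) := by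
      simp only [hBf, hA, hcdef]; fun_prop
    exact this.continuousOn.sub (hc.mono (Set.prod_mono (Set.Ico_subset_Ico_right htRτ) le_rfl))
  · intro t1 ht1
    refine ⟨K, fun t ht x => ?_⟩
    have := hw1 t ⟨ht.1, ht.2.trans_lt (ht1.trans_le htRτ)⟩ x
    linarith [hB0 t x]
  · intro x; simp only [h0]; linarith [hB0 0 x]
  · intro t ht x
    refine HasDerivAt.congr_deriv (((hAd t).mul_const _).fun_sub (reg.dt t (sub1 ht) x)) ?_
    simp only [hBf]; ring
  · intro t ht x i
    exact ((sep_deriv hcd x i).const_mul (A t)).fun_sub (reg.dx t (sub1 ht) x i)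
  · intro t ht x i
    have h1 : HasDerivAt (fun s : ℝ => c' ((x + s • (eb i : EuclideanSpace ℝ (Fin d))) i)) (l ^ 2 * c (x i)) 0 := by
      have h1 : HasDerivAt (fun s : ℝ => (x + s • (eb i : EuclideanSpace ℝ (Fin d))) i) 1 0 := by
        simp only [PiLp.add_apply, PiLp.smul_apply, eb, EuclideanSpace.single_apply, if_true, smul_eq_mul, mul_one]
        exact (hasDerivAt_id (0:ℝ)).const_add (x i)
      have h2 : HasDerivAt c' (l ^ 2 * c (x i)) ((x + (0:ℝ) • (eb i : EuclideanSpace ℝ (Fin d))) i) := by simpa using hcd' (x i)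
      have := HasDerivAt.comp (0:ℝ) h2 h1
      rw [mul_one] at this
      exact this
    exact (h1.const_mul (A t)).fun_sub (reg.dxx t (sub1 ht) x i)
  · intro t ht x hneg
    have hin : ∀ i, |x i| ≤ R := by
      by_contra hcon
      push Not at hcon
      obtain ⟨i, hi⟩ := hcon
      have h1 : Real.exp (l * R) ≤ c (x i) := by
        simp only [hcdef]
        have : Real.exp (l * R) ≤ Real.exp (l * |x i|) := Real.exp_le_exp.2 (by gcongr)
        rcases abs_cases (x i) with ⟨e, _⟩ | ⟨e, _⟩
        · rw [e] at this; linarith [Real.exp_pos (-(l * x i))]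
        · rw [e, mul_neg] at this; linarith [Real.exp_pos (l * x i)]
      have h2 : c (x i) ≤ ∑ j, c (x j) := Finset.single_le_sum (f := fun j => c (x j)) (fun j _ => (hc0 _).le) (Finset.mem_univ i)
      have h3 : K ≤ Bf t x := by
        calc K = K * Real.exp (-(l * R)) * Real.exp (l * R) := by rw [mul_assoc, ← Real.exp_add]; simp
          _ ≤ A t * ∑ j, c (x j) := by
            refine mul_le_mul ?_ (h1.trans h2) (Real.exp_pos _).le (hA0 t)
            refine mul_le_mul_of_nonneg_left (Real.exp_le_exp.2 ?_) hK
            have : 0 ≤ (K + l ^ 2) * t := mul_nonneg (by positivity) ht.1.le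
            linarith
      have h4 := hw1 t ⟨ht.1.le, ht.2.trans_le htRτ⟩ x
      linarith
    have h1 := hs t ht x hin
    have e : ∑ i, (A t * (l ^ 2 * c (x i)) - wxx t x i) = l ^ 2 * Bf t x - ∑ i, wxx t x i := by
      rw [Finset.sum_sub_distrib, ← Finset.mul_sum, ← Finset.mul_sum]; simp only [hBf]; ring
    rw [e]
    linarith

end init

section propA
variable {d : ℕ}

/-- nonlinearity hypotheses -/
structure NL (F F' : ℝ → ℝ) (a : ℝ) : Prop where
  dd : ∀ y < 1, HasDerivAt F (F' y) y
  cd : ContinuousOn F' (Set.Iio 1)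
  a0 : 7 / 8 ≤ a
  a1 : a < 1
  mono : ∀ y y', a ≤ y → y ≤ y' → y' < 1 → F y ≤ F y'

lemma NL.cont {F F' : ℝ → ℝ} {a : ℝ} (h : NL F F' a) : ContinuousOn F (Set.Iio 1) :=
  fun y hy => (h.dd y hy).continuousAt.continuousWithinAt

/-- truncated nonlinearity -/
def ftr (F : ℝ → ℝ) (a C0 : ℝ) (y : ℝ) : ℝ := F (max (-C0) (min y a))

lemma lip_on {F F' : ℝ → ℝ} {a : ℝ} (h : NL F F' a) (m : ℝ) : ∃ L, 0 ≤ L ∧ ∀ y ∈ Set.Icc m a, ∀ y' ∈ Set.Icc m a, |F y - F y'| ≤ L * |y - y'| := by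
  obtain ⟨C, hC⟩ := (isCompact_Icc (a := m) (b := a)).exists_bound_of_continuousOn (h.cd.mono fun y hy => lt_of_le_of_lt hy.2 h.a1)
  refine ⟨max C 0, le_max_right _ _, fun y hy y' hy' => ?_⟩
  have := Convex.norm_image_sub_le_of_norm_hasDerivWithin_le (f := F) (f' := F') (s := Set.Icc m a) (C := max C 0)
    (fun x hx => (h.dd x (lt_of_le_of_lt hx.2 h.a1)).hasDerivWithinAt) (fun x hx => (hC x hx).trans (le_max_left _ _)) (convex_Icc m a) hy' hy
  simpa using this

lemma ftr_prop {F F' : ℝ → ℝ} {a : ℝ} (h : NL F F' a) {C0 : ℝ} (hC0 : 0 ≤ C0) : ∃ B Λ : ℝ, 0 ≤ Λ ∧ (∀ y, |ftr F a C0 y| ≤ B) ∧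
    ∀ y y', |ftr F a C0 y - ftr F a C0 y'| ≤ Λ * |y - y'| := by
  have ha := h.a0
  have hm : ∀ y, max (-C0) (min y a) ∈ Set.Icc (-C0) a := fun y => ⟨le_max_left _ _, max_le (by linarith) (min_le_right _ _)⟩
  obtain ⟨L, hL, hl⟩ := lip_on h (-C0)
  obtain ⟨B, hB⟩ := (isCompact_Icc (a := -C0) (b := a)).exists_bound_of_continuousOn (h.cont.mono fun y hy => lt_of_le_of_lt hy.2 h.a1)
  refine ⟨B, L, hL, fun y => hB _ (hm y), fun y y' => (hl _ (hm y) _ (hm y')).trans (mul_le_mul_of_nonneg_left ?_ hL)⟩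
  refine (abs_max_sub_max_le_max _ _ _ _).trans ?_
  rw [sub_self, abs_zero]
  refine max_le (abs_nonneg _) ((abs_min_sub_min_le_max _ _ _ _).trans ?_)
  rw [sub_self, abs_zero]
  exact max_le le_rfl (abs_nonneg _)

/-- excess nonlinearity -/
def nuF (F : ℝ → ℝ) (a y : ℝ) : ℝ := F y - F (min y a)
def GF (F : ℝ → ℝ) (a y : ℝ) : ℝ := ∫ r in a..y, nuF F a r

lemma nuF_zero {F : ℝ → ℝ} {a y : ℝ} (hy : y ≤ a) : nuF F a y = 0 := by unfold nuF; rw [min_eq_left hy, sub_self]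

lemma NL.nu_cont {F F' : ℝ → ℝ} {a : ℝ} (h : NL F F' a) : ContinuousOn (nuF F a) (Set.Iio 1) := by
  refine h.cont.sub (h.cont.comp (by fun_prop) fun y hy => ?_)
  exact Set.mem_Iio.2 (lt_of_le_of_lt (min_le_left _ _) (Set.mem_Iio.1 hy))

lemma NL.nu_nonneg {F F' : ℝ → ℝ} {a : ℝ} (h : NL F F' a) {y : ℝ} (hy : y < 1) : 0 ≤ nuF F a y := by
  rcases le_total y a with h1 | h1
  · rw [nuF_zero h1]
  · unfold nuF; rw [min_eq_right h1]; linarith [h.mono a y le_rfl h1 hy]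

lemma NL.uIcc_sub {F F' : ℝ → ℝ} {a : ℝ} (h : NL F F' a) {y : ℝ} (hy : y < 1) : Set.uIcc a y ⊆ Set.Iio 1 := by
  intro r hr
  rw [Set.mem_uIcc] at hr
  have := h.a1
  rcases hr with hr | hr
  · exact lt_of_le_of_lt hr.2 hy
  · exact lt_of_le_of_lt hr.2 this

lemma NL.GF_deriv {F F' : ℝ → ℝ} {a : ℝ} (h : NL F F' a) {y : ℝ} (hy : y < 1) : HasDerivAt (GF F a) (nuF F a y) y := by
  refine intervalIntegral.integral_hasDerivAt_right ((h.nu_cont.mono (h.uIcc_sub hy)).intervalIntegrable) ?_ (h.nu_cont.continuousAt (Iio_mem_nhds hy))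
  exact h.nu_cont.stronglyMeasurableAtFilter isOpen_Iio y hy

lemma NL.GF_zero {F : ℝ → ℝ} {a : ℝ} {y : ℝ} (hy : y ≤ a) : GF F a y = 0 := by
  unfold GF
  rw [intervalIntegral.integral_congr (g := fun _ => 0)]
  · simp
  · intro r hr
    rw [Set.uIcc_of_ge hy] at hr
    exact nuF_zero hr.2

lemma NL.GF_nonneg {F F' : ℝ → ℝ} {a : ℝ} (h : NL F F' a) {y : ℝ} (hy : y < 1) : 0 ≤ GF F a y := by
  rcases le_total y a with h1 | h1
  · rw [NL.GF_zero h1]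
  · exact intervalIntegral.integral_nonneg h1 fun r hr => h.nu_nonneg (lt_of_le_of_lt hr.2 hy)

lemma NL.GF_le {F F' : ℝ → ℝ} {a : ℝ} (h : NL F F' a) {y : ℝ} (hy : y < 1) : GF F a y ≤ nuF F a y / 8 := by
  rcases le_total y a with h1 | h1
  · rw [NL.GF_zero h1, nuF_zero h1]; simp
  · have h2 : GF F a y ≤ ∫ r in a..y, nuF F a y := by
      refine intervalIntegral.integral_mono_on h1 ((h.nu_cont.mono (h.uIcc_sub hy)).intervalIntegrable) (by simp) fun r hr => ?_
      unfold nuF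
      rw [min_eq_right hr.1, min_eq_right h1]
      linarith [h.mono r y hr.1 hr.2 hy]
    rw [intervalIntegral.integral_const, smul_eq_mul] at h2
    have := h.nu_nonneg hy
    have := h.a0
    nlinarith

lemma Reg.mono {τ τ' : ℝ} {u ut : ℝ → EuclideanSpace ℝ (Fin d) → ℝ}
    {ux uxx : ℝ → EuclideanSpace ℝ (Fin d) → Fin d → ℝ} (h : Reg τ u ut ux uxx) (hτ : τ' ≤ τ) : Reg τ' u ut ux uxx :=
    have hh : Set.Ioo 0 τ' ⊆ Set.Ioo 0 τ := Set.Ioo_subset_Ioo_right hτ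
    have h2 : Set.Ioo 0 τ' ×ˢ (Set.univ : Set (EuclideanSpace ℝ (Fin d))) ⊆ Set.Ioo 0 τ ×ˢ Set.univ := Set.prod_mono hh le_rfl
    ⟨fun t ht => h.dt t (hh ht), fun t ht => h.dx t (hh ht), fun t ht => h.dxx t (hh ht),
     h.ck.mono h2, h.ckt.mono h2, fun i => (h.ckx i).mono h2, fun i => (h.ckxx i).mono h2⟩

lemma cube_norm {R : ℝ} {x : EuclideanSpace ℝ (Fin d)} (h : ∀ i, |x i| ≤ R) : ‖x‖ ≤ √(d * R ^ 2) := by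
  refine Real.le_sqrt_of_sq_le ?_
  rw [EuclideanSpace.norm_sq_eq]
  calc ∑ i, ‖x i‖ ^ 2 ≤ ∑ i : Fin d, R ^ 2 := Finset.sum_le_sum fun i _ => by
        rw [Real.norm_eq_abs]; have := h i; gcongr
    _ = _ := by simp

lemma propA {F F' : ℝ → ℝ} {a : ℝ} (hF : NL F F' a) (d : ℕ) {M : ℝ} (hM0 : 0 ≤ M) : ∃ τ : ℝ, 0 < τ ∧
    ∀ (τ1 : ℝ) (u ut : ℝ → EuclideanSpace ℝ (Fin d) → ℝ) (ux uxx : ℝ → EuclideanSpace ℝ (Fin d) → Fin d → ℝ),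
      τ1 ≤ τ → Sol τ1 F u ut ux uxx → (∀ t ∈ Set.Ico 0 τ1, ∀ x, |u t x| ≤ M) → (∀ x, u 0 x ≤ -2) →
      ∀ t ∈ Set.Ico 0 τ1, ∀ x, u t x ≤ -1 := by
  have ha0 := hF.a0
  have ha1 := hF.a1
  obtain ⟨B, Λ, hΛ, hB, hL⟩ := ftr_prop hF (C0 := M + 1) (by linarith)
  set ft := ftr F a (M + 1) with hft
  have hB0 : 0 ≤ B := (abs_nonneg _).trans (hB 0)
  have hKc := Kcc_ge (d := d) hB0 hΛ hM0
  set K := Kcc d B Λ M + Λ + 2 * M + d + 4 with hKdef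
  have hd0 : (0:ℝ) ≤ d := Nat.cast_nonneg d
  have hK1 : 1 ≤ K := by linarith
  obtain ⟨s1, hs1, hcore⟩ := core_zero K hK1
  refine ⟨min (1 / (Λ + B + 2)) s1, by positivity, ?_⟩
  set τ := min (1 / (Λ + B + 2)) s1 with hτd
  have hτ0 : 0 < τ := by positivity
  have hτa : τ * (Λ + B + 2) ≤ 1 := by
    have := min_le_left (1 / (Λ + B + 2)) s1
    calc τ * (Λ + B + 2) ≤ 1 / (Λ + B + 2) * (Λ + B + 2) := by gcongr
      _ = 1 := by field_simp
  have hτ1 : τ ≤ 1 := by nlinarith [mul_nonneg hτ0.le hΛ, mul_nonneg hτ0.le hB0]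
  have hτΛ : τ * Λ < 1 := by nlinarith [mul_nonneg hτ0.le hB0]
  have hτB : τ * B ≤ 1 := by nlinarith [mul_nonneg hτ0.le hΛ]
  intro τ1 u ut ux uxx hle hS hbd hini t ht x
  have hτ10 : 0 < τ1 := ht.1.trans_lt ht.2
  have hg : Continuous (u 0) := slice_cont hS.cu ⟨le_rfl, hτ10⟩
  obtain ⟨z, zt, zx, zxx, zc, z0, rz, zb, zle, zpde, bzt, bzx, bzxx⟩ :=
    heat_exist (d := d) hΛ hτ0 hτ1 hτΛ hB hL hg (hbd 0 ⟨le_rfl, hτ10⟩)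
  have mI : ∀ t ∈ Set.Ico 0 τ1, t ∈ Set.Icc 0 τ := fun t ht => ⟨ht.1, ht.2.le.trans hle⟩
  have mO : ∀ t ∈ Set.Ioo 0 τ1, t ∈ Set.Ioo 0 τ := fun t ht => ⟨ht.1, ht.2.trans_le hle⟩
  have oI : ∀ t ∈ Set.Ioo 0 τ1, t ∈ Set.Ico 0 τ1 := fun t ht => ⟨ht.1.le, ht.2⟩
  have hz1 : ∀ t ∈ Set.Ico 0 τ1, ∀ x, z t x ≤ -1 := fun t ht x => by
    have := zle (-2) hini t (mI t ht) x; linarith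
  have hzb : ∀ t ∈ Set.Ico 0 τ1, ∀ x, |z t x| ≤ M + 1 := fun t ht x => by
    have := zb t (mI t ht) x; linarith
  have fz : ∀ t ∈ Set.Ico 0 τ1, ∀ x, u t x ≤ a → ft (u t x) = F (u t x) := by
    intro t ht x hu
    rw [hft, ftr, min_eq_left hu, max_eq_right]
    linarith [(abs_le.1 (hbd t ht x)).1]
  have fu : ∀ t ∈ Set.Ico 0 τ1, ∀ x, ft (u t x) = F (min (u t x) a) := by
    intro t ht x
    rw [hft, ftr, max_eq_right]
    refine le_min ?_ (by linarith)
    linarith [(abs_le.1 (hbd t ht x)).1]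
  have rz1 := rz.mono hle
  have rw1 := hS.reg.sub rz1
  have cw : ContinuousOn (fun p : ℝ × EuclideanSpace ℝ (Fin d) => u p.1 p.2 - z p.1 p.2) (Set.Ico 0 τ1 ×ˢ Set.univ) :=
    hS.cu.sub zc.continuousOn
  have hw0 : ∀ t ∈ Set.Ico 0 τ1, ∀ x, 0 ≤ u t x - z t x := by
    refine cmp_principle (Λ := Λ) cw ?_ ?_ rw1.dt rw1.dx rw1.dxx ?_
    · intro t1 ht1
      refine ⟨2 * M + 1, fun t ht x => ?_⟩
      have htt : t ∈ Set.Ico 0 τ1 := ⟨ht.1, ht.2.trans_lt ht1⟩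
      linarith [(abs_le.1 (hbd t htt x)).1, (abs_le.1 (hzb t htt x)).2]
    · intro x; rw [z0]; simp
    · intro t ht x hneg
      have htt := oI t ht
      have h1 := hz1 t htt x
      rw [hS.pde t ht, zpde t (mO t ht), Finset.sum_sub_distrib, ← fz t htt x (by linarith)]
      have h2 := hL (u t x) (z t x)
      rw [abs_of_neg hneg] at h2
      linarith [(abs_le.1 h2).1]
  set nu : ℝ → EuclideanSpace ℝ (Fin d) → ℝ := fun t x => nuF F a (u t x) with hnu
  set P : ℝ → EuclideanSpace ℝ (Fin d) → ℝ := fun t x => ft (u t x) - ft (z t x) with hPd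
  have hfc : Continuous ft := (LipschitzWith.of_dist_le_mul (K := ⟨Λ, hΛ⟩) fun y y' => hL y y').continuous
  have hPb : ∀ t ∈ Set.Ico 0 τ1, ∀ x, |P t x| ≤ K * (u t x - z t x) := by
    intro t ht x
    refine (hL _ _).trans ?_
    rw [abs_of_nonneg (hw0 t ht x)]
    exact mul_le_mul_of_nonneg_right (by linarith) (hw0 t ht x)
  have wpde : ∀ t ∈ Set.Ioo 0 τ1, ∀ x, ut t x - zt t x = (∑ i, (uxx t x i - zxx t x i)) + P t x + nu t x := by
    intro t ht x
    rw [hS.pde t ht, zpde t (mO t ht), Finset.sum_sub_distrib]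
    simp only [hPd, hnu, nuF]
    rw [fu t (oI t ht) x]; ring
  have hw1 : ∀ t ∈ Set.Ico 0 τ1, ∀ x, u t x - z t x ≤ K := fun t ht x => by
    linarith [(abs_le.1 (hbd t ht x)).2, (abs_le.1 (hzb t ht x)).1]
  have hult : Set.MapsTo (fun p : ℝ × EuclideanSpace ℝ (Fin d) => u p.1 p.2) (Set.Ioo 0 τ1 ×ˢ Set.univ) (Set.Iio 1) :=
    fun p hp => hS.lt p.1 (oI _ hp.1) p.2
  have hKK : Kcc d B Λ M ≤ K := by linarith
  have core : Core τ1 K a (fun t x => u t x - z t x) (fun t x => ut t x - zt t x) (fun t x i => ux t x i - zx t x i)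
      (fun t x i => uxx t x i - zxx t x i) z zt zx zxx nu (fun t x => GF F a (u t x)) P :=
    { rw := rw1
      rz := rz1
      pde := wpde
      cnu := hF.nu_cont.comp hS.reg.ck hult
      cG := ContinuousOn.comp (g := GF F a) (t := Set.Iio 1) (fun y hy => (hF.GF_deriv hy).continuousAt.continuousWithinAt) hS.reg.ck hult
      cP := (hfc.comp_continuousOn hS.reg.ck).sub (hfc.comp_continuousOn zc.continuousOn)
      nu0 := fun t ht x => hF.nu_nonneg (hS.lt t (oI t ht) x)
      dG := fun t ht x => by
        have := HasDerivAt.comp t (hF.GF_deriv (hS.lt t (oI t ht) x)) (hS.reg.dt t ht x)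
        refine this.congr_deriv ?_
        simp only [hnu]; ring
      G0 := fun t ht x => hF.GF_nonneg (hS.lt t (oI t ht) x)
      G1 := fun t ht x => hF.GF_le (hS.lt t (oI t ht) x)
      w0 := fun t ht x => hw0 t (oI t ht) x
      w1 := fun t ht x => hw1 t (oI t ht) x
      hP := fun t ht x => hPb t (oI t ht) x
      vnu := fun t ht x => by
        simp only [hnu]
        rcases le_total (u t x) a with h1 | h1
        · rw [nuF_zero h1, mul_zero]
        · exact mul_nonpos_of_nonpos_of_nonneg (by linarith) (hF.nu_nonneg (hS.lt t (oI t ht) x))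
      cz := fun t ht x => by
        have := abs_le.1 (hzb t (oI t ht) x)
        rw [abs_le]; constructor <;> linarith
      cv := fun t ht x => by
        have := abs_le.1 (hbd t (oI t ht) x)
        rw [abs_le]; constructor <;> linarith
      hY := fun t ht x => by
        have := hz1 t (oI t ht) x
        have := hS.lt t (oI t ht) x
        linarith
      hd := by linarith
      K1 := hK1
      bzt := fun t ht x => (bzt t (mO t ht) x).trans (div_le_div_of_nonneg_right hKK (by linarith [ht.1]))
      bzx := fun t ht x i => (bzx t (mO t ht) x i).trans (div_le_div_of_nonneg_right hKK (Real.sqrt_nonneg _))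
      bzxx := fun t ht x i => (bzxx t (mO t ht) x i).trans (div_le_div_of_nonneg_right hKK (by linarith [ht.1])) }
  have hsub : ∀ R : ℝ, ∃ tR, 0 < tR ∧ tR ≤ τ1 ∧ ∀ t ∈ Set.Ioo 0 tR, ∀ x : EuclideanSpace ℝ (Fin d), (∀ i, |x i| ≤ R) →
      ut t x - zt t x ≤ (∑ i, (uxx t x i - zxx t x i)) + K * (u t x - z t x) := by
    intro R
    have hev := (isCompact_closedBall (0 : EuclideanSpace ℝ (Fin d)) (√(d * R ^ 2))).eventually_forall_of_forall_eventually
      (x₀ := (0:ℝ)) (P := fun t x => t ∈ Set.Ico 0 τ1 → u t x < a) (fun y _ => by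
        have h1 : ContinuousWithinAt (fun p : ℝ × EuclideanSpace ℝ (Fin d) => u p.1 p.2) (Set.Ico 0 τ1 ×ˢ Set.univ) (0, y) :=
          hS.cu _ ⟨⟨le_rfl, hτ10⟩, trivial⟩
        have h2 := h1.eventually (gt_mem_nhds (show u 0 y < a by linarith [hini y]))
        rw [eventually_nhdsWithin_iff] at h2
        filter_upwards [h2] with p hp hpI using hp ⟨hpI, trivial⟩)
    obtain ⟨ε, hε, hball⟩ := Metric.eventually_nhds_iff.1 hev
    refine ⟨min ε τ1, by positivity, min_le_right _ _, fun t ht x hx => ?_⟩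
    have htO : t ∈ Set.Ioo 0 τ1 := ⟨ht.1, ht.2.trans_le (min_le_right _ _)⟩
    have hta : t < ε := ht.2.trans_le (min_le_left _ _)
    have hu : u t x < a := hball (y := t) (by rw [Real.dist_eq, sub_zero, abs_of_pos ht.1]; exact hta) x
      (by rw [mem_closedBall_zero_iff]; exact cube_norm hx) (oI t htO)
    rw [wpde t htO x]
    simp only [hnu, nuF_zero hu.le]
    linarith [(abs_le.1 (hPb t (oI t htO) x)).2]
  have hinit := init_decay (K := K) (by linarith) cw rw1 (fun x => by simp [z0]) hw1 hsub
  rcases ht.1.eq_or_lt with h0 | h0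
  · rw [← h0]; linarith [hini x]
  · have h1 : u t x - z t x = 0 := hcore core hinit t ⟨h0, ht.2⟩ (ht.2.le.trans (hle.trans (min_le_right _ _))) x
    linarith [hz1 t ht x]

end propA

section propQ
variable {d : ℕ} {F F' : ℝ → ℝ} {a τ M : ℝ} {u ut : ℝ → EuclideanSpace ℝ (Fin d) → ℝ}
    {ux uxx : ℝ → EuclideanSpace ℝ (Fin d) → Fin d → ℝ}

lemma cmp_lower (hF : NL F F' a) (hS : Sol τ F u ut ux uxx) (hM : ∀ t ∈ Set.Ico 0 τ, ∀ x, |u t x| ≤ M)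
    {α β : ℝ} (h0 : ∀ x, α ≤ u 0 x) (hb : ∀ t ∈ Set.Ioo 0 τ, β ≤ F (α + β * t))
    (hm : ∀ t ∈ Set.Ico 0 τ, -M ≤ α + β * t ∧ α + β * t ≤ a) :
    ∀ t ∈ Set.Ico 0 τ, ∀ x, α + β * t ≤ u t x := by
  obtain ⟨L, hL0, hL⟩ := lip_on hF (-M)
  have key := cmp_principle (τ := τ) (Λ := L) (k := fun t x => u t x - (α + β * t)) (kt := fun t x => ut t x - β)
    (kx := ux) (kxx := uxx) ?_ ?_ ?_ ?_ ?_ ?_ ?_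
  · intro t ht x
    have := key t ht x
    linarith
  · exact hS.cu.sub (by fun_prop)
  · intro t1 ht1
    refine ⟨M + a, fun t ht x => ?_⟩
    have htt : t ∈ Set.Ico 0 τ := ⟨ht.1, ht.2.trans_lt ht1⟩
    have h1 := (abs_le.1 (hM t htt x)).1
    have h2 := (hm t htt).2
    linarith
  · intro x
    have := h0 x
    simp only [mul_zero, add_zero]
    linarith
  · intro t ht x
    have h1 : HasDerivAt (fun r : ℝ => α + β * r) β t := by
      simpa using ((hasDerivAt_id t).const_mul β).const_add α
    exact (hS.reg.dt t ht x).fun_sub h1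
  · intro t ht x i
    exact (hS.reg.dx t ht x i).sub_const _
  · exact hS.reg.dxx
  · intro t ht x hk
    have htt : t ∈ Set.Ico 0 τ := ⟨ht.1.le, ht.2⟩
    rw [hS.pde t ht x]
    have h1 := (abs_le.1 (hM t htt x)).1
    have h2 := hm t htt
    have h3 := hL (u t x) ⟨h1, by linarith⟩ (α + β * t) h2
    rw [abs_of_neg hk] at h3
    have h4 := (abs_le.1 h3).1
    have h5 := hb t ht
    linarith

lemma cmp_upper (hF : NL F F' a) (hS : Sol τ F u ut ux uxx) (hM : ∀ t ∈ Set.Ico 0 τ, ∀ x, |u t x| ≤ M)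
    {α β : ℝ} (h0 : ∀ x, u 0 x ≤ α) (hb : ∀ t ∈ Set.Ioo 0 τ, F (α + β * t) ≤ β)
    (hua : ∀ t ∈ Set.Ico 0 τ, ∀ x, u t x ≤ a)
    (hm : ∀ t ∈ Set.Ico 0 τ, -M ≤ α + β * t) :
    ∀ t ∈ Set.Ico 0 τ, ∀ x, u t x ≤ α + β * t := by
  obtain ⟨L, hL0, hL⟩ := lip_on hF (-M)
  have key := cmp_principle (τ := τ) (Λ := L) (k := fun t x => (α + β * t) - u t x) (kt := fun t x => β - ut t x)
    (kx := fun t x i => - ux t x i) (kxx := fun t x i => - uxx t x i) ?_ ?_ ?_ ?_ ?_ ?_ ?_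
  · intro t ht x
    have := key t ht x
    linarith
  · exact ContinuousOn.sub (by fun_prop) hS.cu
  · intro t1 ht1
    refine ⟨M + a, fun t ht x => ?_⟩
    have htt : t ∈ Set.Ico 0 τ := ⟨ht.1, ht.2.trans_lt ht1⟩
    have h1 := hua t htt x
    have h2 := (hm t htt)
    linarith
  · intro x
    have := h0 x
    simp only [mul_zero, add_zero]
    linarith
  · intro t ht x
    have h1 : HasDerivAt (fun r : ℝ => α + β * r) β t := by
      simpa using ((hasDerivAt_id t).const_mul β).const_add α
    exact h1.fun_sub (hS.reg.dt t ht x)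
  · intro t ht x i
    exact (hS.reg.dx t ht x i).const_sub _
  · intro t ht x i
    exact (hS.reg.dxx t ht x i).fun_neg
  · intro t ht x hk
    have htt : t ∈ Set.Ico 0 τ := ⟨ht.1.le, ht.2⟩
    rw [hS.pde t ht x, Finset.sum_neg_distrib]
    have h1 := hua t htt x
    have h2 := hm t htt
    have h3 := hL (u t x) ⟨by linarith, h1⟩ (α + β * t) ⟨h2, by linarith⟩
    rw [abs_of_pos (show 0 < u t x - (α + β * t) by linarith)] at h3
    have h4 := (abs_le.1 h3).2
    have h5 := hb t ht
    linarith

lemma upper_all (hF : NL F F' a) (hS : Sol τ F u ut ux uxx) (hM : ∀ t ∈ Set.Ico 0 τ, ∀ x, |u t x| ≤ M)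
    {c : ℝ} (hc : c ≤ -2) (hc0 : F c ≤ 0) (h0 : ∀ x, u 0 x ≤ c) : ∀ t ∈ Set.Ico 0 τ, ∀ x, u t x ≤ c := by
  set M' := max M |c| with hM'
  have hMM : ∀ t ∈ Set.Ico 0 τ, ∀ x, |u t x| ≤ M' := fun t ht x => (hM t ht x).trans (le_max_left _ _)
  have hcM : -M' ≤ c := by
    have := neg_abs_le c
    have := le_max_right M |c|
    linarith
  have hM0 : 0 ≤ M' := (abs_nonneg c).trans (le_max_right _ _)
  obtain ⟨σ, hσ, hA⟩ := propA hF d hM0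
  have ha := hF.a0
  have step : ∀ s, 0 ≤ s → s < τ → (∀ x, u s x ≤ c) → ∀ t, s ≤ t → t < s + σ → t < τ → ∀ x, u t x ≤ c := by
    intro s hs hsτ hsc t hst htσ htτ x
    set τ1 := min σ (τ - s) with hτ1
    have hsol := (hS.shift hs).mono (min_le_right σ (τ - s))
    have hmem : ∀ r ∈ Set.Ico 0 τ1, r + s ∈ Set.Ico 0 τ := fun r hr =>
      ⟨by linarith [hr.1], by linarith [hr.2.trans_le (min_le_right σ (τ - s))]⟩
    have hbM : ∀ r ∈ Set.Ico 0 τ1, ∀ x, |u (r + s) x| ≤ M' := fun r hr x => hMM _ (hmem r hr) x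
    have hini : ∀ x, u (0 + s) x ≤ c := by simpa using hsc
    have h1 := hA τ1 _ _ _ _ (min_le_left _ _) hsol hbM (fun x => (hini x).trans hc)
    have h2 := cmp_upper hF hsol hbM (α := c) (β := 0) hini (fun r _ => by rw [zero_mul, add_zero]; exact hc0)
      (fun r hr x => (h1 r hr x).trans (by linarith)) (fun r _ => by linarith)
    have h3 := h2 (t - s) ⟨by linarith, lt_min (by linarith) (by linarith)⟩ x
    simpa using h3
  have ind : ∀ n : ℕ, ∀ t, 0 ≤ t → t ≤ n * (σ / 2) → t < τ → ∀ x, u t x ≤ c := by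
    intro n
    induction n with
    | zero =>
      intro t ht0 ht _ x
      have : t = 0 := by simp at ht; linarith
      rw [this]; exact h0 x
    | succ n ih =>
      intro t ht0 ht htτ x
      push_cast at ht
      rcases le_total t (n * (σ / 2)) with h | h
      · exact ih t ht0 h htτ x
      · have hn : 0 ≤ (n:ℝ) * (σ / 2) := by positivity
        exact step (n * (σ / 2)) hn (h.trans_lt htτ) (ih _ hn le_rfl (h.trans_lt htτ)) t h (by linarith) htτ x
  intro t ht x
  obtain ⟨n, hn⟩ := exists_nat_ge (t / (σ / 2))
  exact ind n t ht.1 (by rwa [div_le_iff₀ (by positivity)] at hn) ht.2 x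

lemma lower_all (hF : NL F F' a) (hS : Sol τ F u ut ux uxx) (hM : ∀ t ∈ Set.Ico 0 τ, ∀ x, |u t x| ≤ M)
    {c : ℝ} (hc : c ≤ a) (hc0 : 0 ≤ F c) (h0 : ∀ x, c ≤ u 0 x) : ∀ t ∈ Set.Ico 0 τ, ∀ x, c ≤ u t x := by
  have hMM : ∀ t ∈ Set.Ico 0 τ, ∀ x, |u t x| ≤ max M |c| := fun t ht x => (hM t ht x).trans (le_max_left _ _)
  have hcM : -(max M |c|) ≤ c := by
    have := neg_abs_le c
    have := le_max_right M |c|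
    linarith
  have := cmp_lower hF hS hMM (α := c) (β := 0) h0 (fun r _ => by rw [zero_mul, add_zero]; exact hc0) (fun r _ => by
    rw [zero_mul, add_zero]; exact ⟨hcM, hc⟩)
  simpa using this

lemma lower_dyn (hF : NL F F' a) (hS : ∀ τ, Sol τ F u ut ux uxx) (hM : ∀ t, 0 ≤ t → ∀ x, |u t x| ≤ M)
    {I p : ℝ} (hpa : p ≤ a) (hp : 0 ≤ F p) (hpos : ∀ y, I ≤ y → y < p → 0 < F y) (h0 : ∀ x, I ≤ u 0 x)
    {ε : ℝ} (hε : 0 < ε) : ∃ t0, 0 ≤ t0 ∧ ∀ t, t0 ≤ t → ∀ x, p - ε ≤ u t x := by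
  have ha1 := hF.a1
  rcases le_or_gt (p - ε) I with hI | hI
  · refine ⟨0, le_rfl, fun t ht x => ?_⟩
    rcases le_or_gt p I with hpI | hpI
    · have := lower_all hF (hS (t + 1)) (fun t ht x => hM t ht.1 x) hpa hp (fun x => hpI.trans (h0 x)) t ⟨ht, by linarith⟩ x
      linarith
    · have := lower_all hF (hS (t + 1)) (fun t ht x => hM t ht.1 x) (hpI.le.trans hpa) (hpos I le_rfl hpI).le h0 t ⟨ht, by linarith⟩ x
      linarith
  · have hcont : ContinuousOn F (Set.Icc I (p - ε / 2)) := hF.cont.mono fun y hy => by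
      have := hy.2
      exact Set.mem_Iio.2 (by linarith)
    obtain ⟨y0, hy0, hmin⟩ := isCompact_Icc.exists_isMinOn (Set.nonempty_Icc.2 (by linarith)) hcont
    set f0 := F y0 with hf0
    have hf0p : 0 < f0 := hpos y0 hy0.1 (by linarith [hy0.2])
    set τ1 := (p - ε / 2 - I) / f0 with hτ1
    set t1 := (p - ε - I) / f0 with ht1
    have ht10 : 0 ≤ t1 := div_nonneg (by linarith) hf0p.le
    have ht1τ : t1 < τ1 := div_lt_div_of_pos_right (by linarith) hf0p
    have e1 : f0 * τ1 = p - ε / 2 - I := by rw [hτ1]; field_simp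
    have e2 : f0 * t1 = p - ε - I := by rw [ht1]; field_simp
    have hrng : ∀ t ∈ Set.Ico 0 τ1, I ≤ I + f0 * t ∧ I + f0 * t ≤ p - ε / 2 := fun t ht => by
      have h1 := mul_nonneg hf0p.le ht.1
      have h2 := mul_le_mul_of_nonneg_left ht.2.le hf0p.le
      constructor <;> linarith
    have hIM : -(max M |I|) ≤ I := by
      have := neg_abs_le I
      have := le_max_right M |I|
      linarith
    have h1 := cmp_lower hF (hS τ1) (fun t ht x => (hM t ht.1 x).trans (le_max_left M |I|)) (α := I) (β := f0) h0
      (fun t ht => hmin (hrng t ⟨ht.1.le, ht.2⟩)) (fun t ht => ⟨by linarith [(hrng t ht).1], by linarith [(hrng t ht).2]⟩) t1 ⟨ht10, ht1τ⟩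
    refine ⟨t1, ht10, fun t ht x => ?_⟩
    have h2 := lower_all hF ((hS (t + 1)).shift ht10) (M := M) (fun r hr x => hM _ (by linarith [hr.1]) x) (c := p - ε) (by linarith)
      (hpos _ (by linarith) (by linarith)).le (fun x => by have := h1 x; simp only [zero_add]; linarith) (t - t1) ⟨by linarith, by linarith⟩ x
    simpa using h2

lemma upper_dyn (hF : NL F F' a) (hS : ∀ τ, Sol τ F u ut ux uxx) (hM : ∀ t, 0 ≤ t → ∀ x, |u t x| ≤ M)
    (hu1 : ∀ t, 0 ≤ t → ∀ x, u t x ≤ -2)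
    {I p : ℝ} (hI2 : I ≤ -2) (hp2 : p ≤ -2) (hp : F p ≤ 0) (hpos : ∀ y, p < y → y ≤ I → F y < 0) (h0 : ∀ x, u 0 x ≤ I)
    {ε : ℝ} (hε : 0 < ε) : ∃ t0, 0 ≤ t0 ∧ ∀ t, t0 ≤ t → ∀ x, u t x ≤ p + ε := by
  have ha0 := hF.a0
  rcases le_or_gt I (p + ε) with hI | hI
  · refine ⟨0, le_rfl, fun t ht x => ?_⟩
    rcases le_or_gt I p with hpI | hpI
    · have := upper_all hF (hS (t + 1)) (fun t ht x => hM t ht.1 x) hp2 hp (fun x => (h0 x).trans hpI) t ⟨ht, by linarith⟩ x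
      linarith
    · have := upper_all hF (hS (t + 1)) (fun t ht x => hM t ht.1 x) hI2 (hpos I hpI le_rfl).le h0 t ⟨ht, by linarith⟩ x
      linarith
  · have hcont : ContinuousOn F (Set.Icc (p + ε / 2) I) := hF.cont.mono fun y hy => by
      have := hy.2
      exact Set.mem_Iio.2 (by linarith)
    obtain ⟨y0, hy0, hmax⟩ := isCompact_Icc.exists_isMaxOn (Set.nonempty_Icc.2 (by linarith)) hcont
    set f0 := -F y0 with hf0
    have hf0p : 0 < f0 := by have := hpos y0 (by linarith [hy0.1]) hy0.2; linarith
    set τ1 := (I - (p + ε / 2)) / f0 with hτ1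
    set t1 := (I - (p + ε)) / f0 with ht1
    have ht10 : 0 ≤ t1 := div_nonneg (by linarith) hf0p.le
    have ht1τ : t1 < τ1 := div_lt_div_of_pos_right (by linarith) hf0p
    have e1 : f0 * τ1 = I - (p + ε / 2) := by rw [hτ1]; field_simp
    have e2 : f0 * t1 = I - (p + ε) := by rw [ht1]; field_simp
    have hrng : ∀ t ∈ Set.Ico 0 τ1, p + ε / 2 ≤ I + (-f0) * t ∧ I + (-f0) * t ≤ I := fun t ht => by
      have h1 := mul_nonneg hf0p.le ht.1
      have h2 := mul_le_mul_of_nonneg_left ht.2.le hf0p.le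
      constructor <;> linarith
    have hIM : -(max M |p|) ≤ p := by
      have := neg_abs_le p
      have := le_max_right M |p|
      linarith
    have h1 := cmp_upper hF (hS τ1) (fun t ht x => (hM t ht.1 x).trans (le_max_left M |p|)) (α := I) (β := -f0) h0
      (fun t ht => by
        have : F (I + (-f0) * t) ≤ F y0 := hmax (hrng t ⟨ht.1.le, ht.2⟩)
        linarith) (fun t ht x => (hu1 t ht.1 x).trans (by linarith)) (fun t ht => by linarith [(hrng t ht).1]) t1 ⟨ht10, ht1τ⟩
    refine ⟨t1, ht10, fun t ht x => ?_⟩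
    have h2 := upper_all hF ((hS (t + 1)).shift ht10) (M := M) (fun r hr x => hM _ (by linarith [hr.1]) x) (c := p + ε) (by linarith)
      (hpos _ (by linarith) (by linarith)).le (fun x => by have := h1 x; simp only [zero_add]; linarith) (t - t1) ⟨by linarith, by linarith⟩ x
    simpa using h2

end propQ

lemma zeta_NL : ∃ a, NL (fun y => -zetaR y) (fun y => -(deriv riemannZeta (y:ℂ)).re) a := by
  obtain ⟨a, h1, h2, h3⟩ := zetaR_mono
  exact ⟨a, fun y hy => (zetaR_hasDeriv hy).fun_neg, zetaR_derivCont.neg, h1, h2,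
    fun y y' hy hyy hy1 => neg_le_neg (h3 y y' hy hyy hy1)⟩

lemma toSol {d : ℕ} {F : ℝ → ℝ} {T : ℝ≥0∞} {g : EuclideanSpace ℝ (Fin d) → ℝ} {u : ℝ → EuclideanSpace ℝ (Fin d) → ℝ}
    (hu : IsHeatSolutionR d F T g u) (hult : ∀ t x, 0 ≤ t → ENNReal.ofReal t < T → u t x < 1) :
    ∃ ut ux uxx, ∀ τ : ℝ, ENNReal.ofReal τ < T → Sol τ F u ut ux uxx := by
  obtain ⟨hc, -, hbd, ut, ux, uxx, hdt, hdx, hdxx, hct, hcxx, hpde⟩ := hu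
  refine ⟨ut, ux, uxx, fun τ hτ => ?_⟩
  have hlt : ∀ t, t < τ → ENNReal.ofReal t < T := fun t ht => (ENNReal.ofReal_le_ofReal ht.le).trans_lt hτ
  have hm0 : Set.Ico 0 τ ×ˢ (Set.univ : Set (EuclideanSpace ℝ (Fin d))) ⊆ {p | 0 ≤ p.1 ∧ ENNReal.ofReal p.1 < T} :=
    fun p hp => ⟨hp.1.1, hlt _ hp.1.2⟩
  have hm1 : Set.Ioo 0 τ ×ˢ (Set.univ : Set (EuclideanSpace ℝ (Fin d))) ⊆ {p | 0 < p.1 ∧ ENNReal.ofReal p.1 < T} :=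
    fun p hp => ⟨hp.1.1, hlt _ hp.1.2⟩
  have hm2 : Set.Ioo 0 τ ×ˢ (Set.univ : Set (EuclideanSpace ℝ (Fin d))) ⊆ {p | 0 ≤ p.1 ∧ ENNReal.ofReal p.1 < T} :=
    fun p hp => ⟨hp.1.1.le, hlt _ hp.1.2⟩
  have hx : ∀ t ∈ Set.Ioo 0 τ, ∀ x i, HasDerivAt (fun s : ℝ => u t (x + s • eb i)) (ux t x i) 0 :=
    fun t ht x i => hdx t x i ht.1 (hlt t ht.2)
  have hxx : ∀ t ∈ Set.Ioo 0 τ, ∀ x i, HasDerivAt (fun s : ℝ => ux t (x + s • eb i) i) (uxx t x i) 0 :=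
    fun t ht x i => hdxx t x i ht.1 (hlt t ht.2)
  refine ⟨hc.mono hm0, ⟨fun t ht x => hdt t x ht.1 (hlt t ht.2), hx, hxx, hc.mono hm2, hct.mono hm1, fun i => ?_, fun i => (hcxx i).mono hm1⟩,
    fun t ht x => hpde t x ht.1 (hlt t ht.2), fun t ht x => hult t x ht.1 (hlt t ht.2), fun t1 ht1 => ?_⟩
  · exact ux_cont i (hc.mono hm2) (fun t ht x => hx t ht x i) (fun t ht x => hxx t ht x i) ((hcxx i).mono hm1)
  · obtain ⟨C, hC⟩ := hbd t1 (hlt t1 ht1)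
    exact ⟨C, fun t ht x => hC t x ht.1 ht.2⟩

theorem stmt9 (d : ℕ) (hd : 1 ≤ d) (T : ℝ≥0∞) (hT : 0 < T)
    (g : EuclideanSpace ℝ (Fin d) → ℝ) (hgc : Continuous g) (hgb : ∃ C, ∀ x, |g x| ≤ C)
    (u : ℝ → EuclideanSpace ℝ (Fin d) → ℝ)
    (hu : IsHeatSolutionR d (fun y => -zetaR y) T g u)
    (hult : ∀ t x, 0 ≤ t → ENNReal.ofReal t < T → u t x < 1)
    (I S : ℝ) (hI : I = ⨅ x, g x) (hS : S = ⨆ x, g x) (hSlt : S < -2)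
    (k1 : ℕ) (hk1pos : 0 < k1) (hk1le : -(2 * (k1 : ℝ)) ≤ I)
    (hk1min : ∀ k : ℕ, 0 < k → -(2 * (k : ℝ)) ≤ I → k1 ≤ k)
    (k2 : ℕ) (hk2pos : 0 < k2) (hk2ge : S ≤ -(2 * (k2 : ℝ)))
    (hk2min : ∀ k : ℕ, 0 < k → S ≤ -(2 * (k : ℝ)) → -(2 * (k2 : ℝ)) ≤ -(2 * (k : ℝ))) :
    (∀ t x, 0 ≤ t → ENNReal.ofReal t < T →
      -(2 * (k1 : ℝ)) ≤ u t x ∧ u t x ≤ -(2 * (k2 : ℝ))) ∧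
    (T = ⊤ → ∀ n1 n2 : ℕ, 0 < n1 → 0 < n2 →
      I ∈ Set.Ioo (-(4 * (n1 : ℝ)) - 2) (-(4 * (n1 : ℝ)) + 2) →
      S ∈ Set.Ioo (-(4 * (n2 : ℝ)) - 2) (-(4 * (n2 : ℝ)) + 2) →
      ∀ x, -(4 * (n1 : ℝ)) ≤ Filter.liminf (fun t => u t x) Filter.atTop ∧
        Filter.liminf (fun t => u t x) Filter.atTop ≤ Filter.limsup (fun t => u t x) Filter.atTop ∧
        Filter.limsup (fun t => u t x) Filter.atTop ≤ -(4 * (n2 : ℝ))) := by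
  obtain ⟨a, hF⟩ := zeta_NL
  have ha0 := hF.a0
  obtain ⟨ut, ux, uxx, hsol⟩ := toSol hu hult
  obtain ⟨C, hC⟩ := hgb
  have hIg : ∀ x, I ≤ u 0 x := fun x => by
    rw [hI, hu.2.1 x]
    exact ciInf_le ⟨-C, by rintro _ ⟨y, rfl⟩; exact (abs_le.1 (hC y)).1⟩ x
  have hSg : ∀ x, u 0 x ≤ S := fun x => by
    rw [hS, hu.2.1 x]
    exact le_ciSup (f := g) ⟨C, by rintro _ ⟨y, rfl⟩; exact (abs_le.1 (hC y)).2⟩ x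
  have hk1r : (1:ℝ) ≤ k1 := by exact_mod_cast hk1pos
  have hk2r : (1:ℝ) ≤ k2 := by exact_mod_cast hk2pos
  have part1 : ∀ t x, 0 ≤ t → ENNReal.ofReal t < T → -(2 * (k1 : ℝ)) ≤ u t x ∧ u t x ≤ -(2 * (k2 : ℝ)) := by
    intro t x ht htT
    obtain ⟨t', htt', ht'T⟩ : ∃ t' : ℝ, t < t' ∧ ENNReal.ofReal t' < T := by
      obtain ⟨r, hr1, hr2⟩ := ENNReal.lt_iff_exists_real_btwn.1 htT
      exact ⟨r, (ENNReal.ofReal_lt_ofReal_iff_of_nonneg ht).1 hr2.1, hr2.2⟩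
    obtain ⟨M, hM⟩ := hu.2.2.1 t' ht'T
    have hM' : ∀ r ∈ Set.Ico 0 t', ∀ y, |u r y| ≤ M := fun r hr y => hM r y hr.1 hr.2.le
    constructor
    · exact lower_all hF (hsol t' ht'T) hM' (by linarith) (by rw [zetaR_zero hk1pos, neg_zero]) (fun y => hk1le.trans (hIg y)) t ⟨ht, htt'⟩ x
    · exact upper_all hF (hsol t' ht'T) hM' (by linarith) (by rw [zetaR_zero hk2pos, neg_zero]) (fun y => (hSg y).trans hk2ge) t ⟨ht, htt'⟩ x
  refine ⟨part1, ?_⟩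
  rintro rfl n1 n2 hn1 hn2 hI1 hS1 x
  have hn1r : (1:ℝ) ≤ n1 := by exact_mod_cast hn1
  have hn2r : (1:ℝ) ≤ n2 := by exact_mod_cast hn2
  have hp1 : ∀ t, 0 ≤ t → ∀ x, -(2 * (k1 : ℝ)) ≤ u t x ∧ u t x ≤ -(2 * (k2 : ℝ)) := fun t ht x =>
    part1 t x ht ENNReal.ofReal_lt_top
  have hMg : ∀ t, 0 ≤ t → ∀ x, |u t x| ≤ 2 * k1 := fun t ht x => abs_le.2
    ⟨(hp1 t ht x).1, by linarith [(hp1 t ht x).2]⟩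
  have hz : ∀ n : ℕ, 0 < n → zetaR (-(4 * (n:ℝ))) = 0 := fun n hn => by
    have := zetaR_zero (k := 2 * n) (by omega)
    rw [← this]; push_cast; ring_nf
  have hbl : Filter.IsBoundedUnder (· ≥ ·) Filter.atTop (fun t => u t x) :=
    ⟨-(2 * (k1:ℝ)), by
      rw [Filter.eventually_map]
      filter_upwards [Filter.eventually_ge_atTop 0] with t ht using (hp1 t ht x).1⟩
  have hbu : Filter.IsBoundedUnder (· ≤ ·) Filter.atTop (fun t => u t x) :=
    ⟨-(2 * (k2:ℝ)), by
      rw [Filter.eventually_map]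
      filter_upwards [Filter.eventually_ge_atTop 0] with t ht using (hp1 t ht x).2⟩
  refine ⟨?_, Filter.liminf_le_limsup hbu hbl, ?_⟩
  · refine le_of_forall_pos_le_add fun ε hε => ?_
    obtain ⟨t0, ht0, h⟩ := lower_dyn hF (fun τ => hsol τ ENNReal.ofReal_lt_top) hMg (I := I) (p := -(4 * (n1:ℝ))) (by linarith)
      (by rw [hz n1 hn1, neg_zero]) (fun y hy hyp => by
        have := zetaR_neg hn1 (lt_of_lt_of_le hI1.1 hy) hyp
        linarith) hIg hε
    have : -(4 * (n1:ℝ)) - ε ≤ Filter.liminf (fun t => u t x) Filter.atTop := by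
      refine Filter.le_liminf_of_le hbu.isCoboundedUnder_ge ?_
      filter_upwards [Filter.eventually_ge_atTop t0] with t ht using h t ht x
    linarith
  · refine le_of_forall_pos_le_add fun ε hε => ?_
    obtain ⟨t0, ht0, h⟩ := upper_dyn hF (fun τ => hsol τ ENNReal.ofReal_lt_top) hMg (fun t ht x => (hp1 t ht x).2.trans (by linarith))
      (I := S) (p := -(4 * (n2:ℝ))) hSlt.le (by linarith)
      (by rw [hz n2 hn2, neg_zero]) (fun y hy hyp => by
        have := zetaR_pos hn2 hy (lt_of_le_of_lt hyp hS1.2)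
        linarith) hSg hε
    refine Filter.limsup_le_of_le hbl.isCoboundedUnder_le ?_
    filter_upwards [Filter.eventually_ge_atTop t0] with t ht using h t ht x
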